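/- A graph-like continuum has an open Eulerian path if and only if it has exactly two vertices of strongly odd degree and all of its remaining vertices have strongly even degree. -/

import Mathlib

open Set Topology Filter Function

universe u

/-- A compact graph-like space structure on a topological space `X`:
a closed zero-dimensional vertex set `V` together with an index type `E`
(carrying the discrete topology) such that `X \ V ≅ E × (0,1)`. -/
structure GraphLike (X : Type u) [TopologicalSpace X] where
  V : Set X
  closedV : IsClosed V
  zeroDimV : TotallyDisconnectedSpace V
  E : Type
  homeo :
    letI : TopologicalSpace E := ⊥
    Nonempty ((Vᶜ : Set X) ≃ₜ (E × ↥(Set.Ioo (0 : ℝ) 1)))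

variable {X : Type u} [TopologicalSpace X]

/-- An edge of a graph-like space: a connected component of `X \ V`. -/
def GraphLike.IsEdge (G : GraphLike X) (e : Set X) : Prop :=
  ∃ x, x ∈ (G.V)ᶜ ∧ e = connectedComponentIn (G.V)ᶜ x

/-- A subset of the vertex set which is clopen in the subspace `V`. -/
def GraphLike.ClopenIn (G : GraphLike X) (C : Set X) : Prop :=
  C ⊆ G.V ∧ IsClosed C ∧ IsClosed (G.V \ C)

/-- A separation of a graph-like space: a partition of the vertex set into
two disjoint clopen pieces. -/
structure GraphLike.Separation (G : GraphLike X) where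
  A : Set X
  B : Set X
  clopenA : G.ClopenIn A
  clopenB : G.ClopenIn B
  disjoint : A ∩ B = ∅
  union : A ∪ B = G.V

/-- The cut induced by a pair of vertex sets: all edges whose closure meets both. -/
def GraphLike.cut (G : GraphLike X) (A B : Set X) : Set (Set X) :=
  {e | G.IsEdge e ∧ (closure e ∩ A).Nonempty ∧ (closure e ∩ B).Nonempty}

/-- A cut is even if it is finite of even cardinality. -/
def GraphLike.EvenCut (G : GraphLike X) (A B : Set X) : Prop :=
  (G.cut A B).Finite ∧ Even (G.cut A B).ncard

/-- A (standard) path in a graph-like space: a continuous map from `[0,1]` sending the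
endpoints to vertices, injective on the preimage of each edge, and such that the
preimage of the vertex set has empty interior. -/
def GraphLike.IsPath (G : GraphLike X) (f : unitInterval → X) : Prop :=
  Continuous f ∧ f 0 ∈ G.V ∧ f 1 ∈ G.V ∧
    (∀ e, G.IsEdge e → Set.InjOn f (f ⁻¹' e)) ∧
    interior (f ⁻¹' G.V) = ∅

/-- An Eulerian loop: a closed path whose image contains every edge. -/
def GraphLike.IsEulerianLoop (G : GraphLike X) (f : unitInterval → X) : Prop :=
  G.IsPath f ∧ f 0 = f 1 ∧ ∀ e, G.IsEdge e → e ⊆ Set.range f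

/-- An open Eulerian path: a path with distinct endpoints whose image contains
every edge. -/
def GraphLike.IsOpenEulerianPath (G : GraphLike X) (f : unitInterval → X) : Prop :=
  G.IsPath f ∧ f 0 ≠ f 1 ∧ ∀ e, G.IsEdge e → e ⊆ Set.range f

/-- The set of `n` such that there exist `n` pairwise edge-disjoint arcs in `X`, each
with one endpoint in `A` and the other in `B`. -/
def GraphLike.arcConn (G : GraphLike X) (A B : Set X) : Set ℕ :=
  {n | ∃ f : Fin n → unitInterval → X,
    (∀ i, Continuous (f i) ∧ Function.Injective (f i) ∧ f i 0 ∈ A ∧ f i 1 ∈ B) ∧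
    ∀ i j, i ≠ j → ∀ e, G.IsEdge e → ¬(e ⊆ Set.range (f i) ∧ e ⊆ Set.range (f j))}

/-- A vertex `v` has strongly even degree if it has a clopen neighbourhood `C` in `V`
such that for every clopen neighbourhood `A ⊆ C` of `v`, the maximum number of pairwise
edge-disjoint arcs from `V ∖ A` to `v` is even. -/
def GraphLike.StronglyEvenDegree (G : GraphLike X) (v : X) : Prop :=
  ∃ C, G.ClopenIn C ∧ v ∈ C ∧
    ∀ A, G.ClopenIn A → v ∈ A → A ⊆ C →
      ∃ m, IsGreatest (G.arcConn {v} (G.V \ A)) m ∧ Even m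

/-- A vertex `v` has strongly odd degree if it has a clopen neighbourhood `C` in `V`
such that for every clopen neighbourhood `A ⊆ C` of `v`, the maximum number of pairwise
edge-disjoint arcs from `V ∖ A` to `v` is odd. -/
def GraphLike.StronglyOddDegree (G : GraphLike X) (v : X) : Prop :=
  ∃ C, G.ClopenIn C ∧ v ∈ C ∧
    ∀ A, G.ClopenIn A → v ∈ A → A ⊆ C →
      ∃ m, IsGreatest (G.arcConn {v} (G.V \ A)) m ∧ Odd m


section EPfinite
open Classical in
noncomputable def epInd {W : Type*} (S : Set W) (w : W) : ZMod 2 := if w ∈ S then 1 else 0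

lemma epInd_mem {W : Type*} {S : Set W} {w : W} (h : w ∈ S) : epInd S w = 1 := by simp [epInd, h]
lemma epInd_not_mem {W : Type*} {S : Set W} {w : W} (h : w ∉ S) : epInd S w = 0 := by simp [epInd, h]
lemma epInd_eq_one_iff {W : Type*} {S : Set W} {w : W} : epInd S w = 1 ↔ w ∈ S := by
  by_cases h : w ∈ S <;> simp [epInd, h]
lemma epInd_eq_iff {W W' : Type*} {S : Set W} {w : W} {S' : Set W'} {w' : W'} :
    epInd S w = epInd S' w' ↔ (w ∈ S ↔ w' ∈ S') := by
  by_cases h : w ∈ S <;> by_cases h' : w' ∈ S' <;> simp [epInd, h, h']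
lemma epZ_self (z : ZMod 2) : z + z = 0 := by revert z; decide
lemma epZ_cases (z : ZMod 2) : z = 0 ∨ z = 1 := by revert z; decide
lemma epZ_eq_of_add (a b : ZMod 2) (h : a + b = 0) : a = b := by revert a b; decide

noncomputable def epChi {W ι : Type*} (a b : ι → W) (S : Set W) (i : ι) : ZMod 2 :=
  epInd S (a i) + epInd S (b i)

lemma epChi_eq_zero_iff {W ι : Type*} {a b : ι → W} {S : Set W} {i : ι} :
    epChi a b S i = 0 ↔ (a i ∈ S ↔ b i ∈ S) := by
  rw [epChi, ← epInd_eq_iff]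
  constructor
  · exact epZ_eq_of_add _ _
  · intro h; rw [h]; exact epZ_self _

def epTail {W ι : Type*} (a b : ι → W) (p : ι × Bool) : W := if p.2 then a p.1 else b p.1
def epHead {W ι : Type*} (a b : ι → W) (p : ι × Bool) : W := if p.2 then b p.1 else a p.1

lemma epChi_tail_head {W ι : Type*} (a b : ι → W) (S : Set W) (p : ι × Bool) :
    epChi a b S p.1 = epInd S (epTail a b p) + epInd S (epHead a b p) := by
  rcases p with ⟨i, _ | _⟩ <;> simp [epChi, epTail, epHead, add_comm]

def EpTrail {W ι : Type*} (a b : ι → W) : W → List (ι × Bool) → W → Prop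
  | x, [], y => x = y
  | x, p :: L, y => epTail a b p = x ∧ EpTrail a b (epHead a b p) L y

lemma EpTrail.append {W ι : Type*} {a b : ι → W} {x y z : W} {L M : List (ι × Bool)}
    (h1 : EpTrail a b x L y) (h2 : EpTrail a b y M z) : EpTrail a b x (L ++ M) z := by
  induction L generalizing x with
  | nil => simp only [EpTrail] at h1; subst h1; simpa using h2
  | cons p L ih => exact ⟨h1.1, ih h1.2⟩

lemma EpTrail.split {W ι : Type*} {a b : ι → W} {x z : W} {L M : List (ι × Bool)}
    (h1 : EpTrail a b x (L ++ M) z) : ∃ y, EpTrail a b x L y ∧ EpTrail a b y M z := by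
  induction L generalizing x with
  | nil => exact ⟨x, rfl, h1⟩
  | cons p L ih =>
    obtain ⟨y, h2, h3⟩ := ih h1.2
    exact ⟨y, ⟨h1.1, h2⟩, h3⟩

lemma EpTrail.parity {W ι : Type*} {a b : ι → W} {x y : W} {L : List (ι × Bool)}
    (h : EpTrail a b x L y) (S : Set W) :
    epInd S y = epInd S x + ((L.map Prod.fst).map (epChi a b S)).sum := by
  induction L generalizing x with
  | nil => simp only [EpTrail] at h; subst h; simp
  | cons p L ih =>
    rw [ih h.2, List.map_cons, List.map_cons, List.sum_cons, epChi_tail_head, h.1]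
    have := epZ_self (epInd S x)
    linear_combination -this

open Classical in
theorem ep_finEuler {W ι : Type*} (a b : ι → W) : ∀ (n : ℕ) (F : Finset ι) (x y : W),
    F.card = n →
    (∀ S : Set W, ∑ i ∈ F, epChi a b S i = epInd S x + epInd S y) →
    (∀ S : Set W, x ∈ S → (∀ i ∈ F, a i ∈ S ↔ b i ∈ S) → ∀ i ∈ F, a i ∈ S) →
    ∃ L : List (ι × Bool), (L.map Prod.fst).Nodup ∧ (∀ i, i ∈ L.map Prod.fst ↔ i ∈ F) ∧
      EpTrail a b x L y := by
  intro n
  induction n using Nat.strong_induction_on with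
  | _ n ih =>
  intro F x y hn par conn
  by_cases hF : F = ∅
  · subst hF
    refine ⟨[], by simp, by simp, ?_⟩
    have := par {x}
    simp only [Finset.sum_empty] at this
    have h2 := (epInd_eq_iff.1 (epZ_eq_of_add _ _ this.symm)).1 rfl
    exact h2.symm
  -- an edge at x
  obtain ⟨p, hpF, hpx⟩ : ∃ p : ι × Bool, p.1 ∈ F ∧ epTail a b p = x := by
    by_contra hcon
    push Not at hcon
    obtain ⟨i, hi⟩ := Finset.nonempty_iff_ne_empty.2 hF
    have h1 : ∀ i ∈ F, a i ≠ x := fun i hi => hcon (i, true) hi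
    have h2 : ∀ i ∈ F, b i ≠ x := fun i hi => hcon (i, false) hi
    have := conn {x} rfl (fun i hi => by simp [h1 i hi, h2 i hi]) i hi
    exact h1 i hi this
  set u := epHead a b p with hu
  set F' := F.erase p.1 with hF'
  have par' : ∀ S : Set W, ∑ i ∈ F', epChi a b S i = epInd S u + epInd S y := by
    intro S
    have h1 := Finset.add_sum_erase F (epChi a b S) hpF
    have h2 := par S
    rw [← h1, epChi_tail_head, hpx, ← hu] at h2
    have := epZ_self (epInd S u)
    linear_combination h2 - this
  set R : Set W := ⋂₀ {S | u ∈ S ∧ ∀ i ∈ F', a i ∈ S ↔ b i ∈ S} with hR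
  have huR : u ∈ R := fun S hS => hS.1
  have hRcl : ∀ i ∈ F', a i ∈ R ↔ b i ∈ R := by
    intro i hi
    constructor
    · intro h S hS; exact (hS.2 i hi).1 (h S hS)
    · intro h S hS; exact (hS.2 i hi).2 (h S hS)
  have hyR : y ∈ R := by
    have := par' R
    rw [Finset.sum_eq_zero (fun i hi => epChi_eq_zero_iff.2 (hRcl i hi))] at this
    exact (epInd_eq_iff.1 (epZ_eq_of_add _ _ this.symm)).1 huR
  set F1 := F'.filter (fun i => a i ∈ R) with hF1
  set F2 := F'.filter (fun i => a i ∉ R) with hF2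
  have hcard : F'.card < n := by rw [← hn]; exact Finset.card_erase_lt_of_mem hpF
  have hc1 : F1.card < n := lt_of_le_of_lt (Finset.card_filter_le _ _) hcard
  have hc2 : F2.card < n := lt_of_le_of_lt (Finset.card_filter_le _ _) hcard
  obtain ⟨L1, hL1, hL1', hT1⟩ := ih _ hc1 F1 u y rfl (by
    intro S
    have h1 := par' (S ∩ R)
    have h2 : ∑ i ∈ F1, epChi a b S i = ∑ i ∈ F', epChi a b (S ∩ R) i := by
      rw [hF1, Finset.sum_filter]
      refine Finset.sum_congr rfl fun i hi => ?_
      have := hRcl i hi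
      split_ifs with h
      · have h' := this.1 h
        simp [epChi, epInd, h, h']
      · have h' : b i ∉ R := fun hb => h (this.2 hb)
        simp [epChi, epInd, h, h']
    rw [h2, h1]
    simp [epInd, huR, hyR]) (by
    intro S huS hS i hi
    rw [hF1, Finset.mem_filter] at hi
    have : R ⊆ S ∩ R := by
      intro w hw
      apply hw
      refine ⟨⟨huS, huR⟩, fun j hj => ?_⟩
      have hj' := hRcl j hj
      by_cases h : a j ∈ R
      · have := hS j (by rw [hF1, Finset.mem_filter]; exact ⟨hj, h⟩)
        simp [this, hj']
      · have h' : b j ∉ R := fun hb => h (hj'.2 hb)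
        simp [h, h']
    exact (this hi.2).1)
  obtain ⟨L2, hL2, hL2', hT2⟩ := ih _ hc2 F2 x x rfl (by
    intro S
    have h1 := par' (S \ R)
    have h2 : ∑ i ∈ F2, epChi a b S i = ∑ i ∈ F', epChi a b (S \ R) i := by
      rw [hF2, Finset.sum_filter]
      refine Finset.sum_congr rfl fun i hi => ?_
      have := hRcl i hi
      by_cases h : a i ∈ R
      · have h' : b i ∈ R := this.1 h
        simp [epChi, epInd, h, h']
      · have h' : b i ∉ R := fun hb => h (this.2 hb)
        simp [epChi, epInd, h, h']
    rw [h2, h1, epZ_self]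
    simp [epInd, huR, hyR]) (by
    intro S hxS hS i hi
    rw [hF2, Finset.mem_filter] at hi
    have hcl : ∀ j ∈ F, a j ∈ S ∪ R ↔ b j ∈ S ∪ R := by
      intro j hj
      by_cases hjp : j = p.1
      · have h1 : epTail a b p ∈ S ∪ R := by rw [hpx]; exact Or.inl hxS
        have h2 : epHead a b p ∈ S ∪ R := Or.inr huR
        rw [hjp]
        rcases p with ⟨q, _ | _⟩
        · simp only [epTail, epHead] at h1 h2 ⊢; exact ⟨fun _ => h1, fun _ => h2⟩
        · simp only [epTail, epHead] at h1 h2 ⊢; exact ⟨fun _ => h2, fun _ => h1⟩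
      · have hj' : j ∈ F' := Finset.mem_erase.2 ⟨hjp, hj⟩
        have hj'' := hRcl j hj'
        by_cases h : a j ∈ R
        · simp [h, hj''.1 h]
        · have h' : b j ∉ R := fun hb => h (hj''.2 hb)
          have := hS j (by rw [hF2, Finset.mem_filter]; exact ⟨hj', h⟩)
          simp [h, h', this]
    have := conn (S ∪ R) (Or.inl hxS) hcl i (Finset.mem_of_mem_erase hi.1)
    exact this.resolve_right hi.2)
  have hm : ∀ i, i ∈ (L2 ++ p :: L1).map Prod.fst ↔ i ∈ F := by
    intro i
    rw [List.map_append, List.map_cons, List.mem_append, List.mem_cons, hL1', hL2', hF1, hF2,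
      Finset.mem_filter, Finset.mem_filter, hF', Finset.mem_erase]
    by_cases hip : i = p.1
    · subst hip; simp [hpF]
    · simp only [ne_eq, hip, not_false_eq_true, true_and, false_or]
      tauto
  refine ⟨L2 ++ p :: L1, ?_, hm, hT2.append ⟨hpx, hT1⟩⟩
  rw [List.map_append, List.map_cons, List.nodup_append]
  refine ⟨hL2, List.nodup_cons.2 ⟨?_, hL1⟩, ?_⟩
  · rw [hL1']; simp [hF1, hF']
  · intro i hi j hj hij
    subst hij
    rw [hL2', hF2, Finset.mem_filter] at hi
    rw [List.mem_cons, hL1', hF1, Finset.mem_filter] at hj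
    rcases hj with h | h
    · exact (Finset.mem_erase.1 hi.1).1 h
    · exact hi.2 h.2
end EPfinite


theorem ep_rado {ι T K : Type*} [Finite T] (S : K → Set ι) (hS : ∀ k, (S k).Finite)
    (P : K → (ι → T) → Prop)
    (loc : ∀ k g g', (∀ i ∈ S k, g i = g' i) → P k g → P k g')
    (fin : ∀ Q : Finset K, ∃ g, ∀ k ∈ Q, P k g) : ∃ g, ∀ k, P k g := by
  classical
  choose G hG using fin
  let U : Ultrafilter (Finset K) := Ultrafilter.of atTop
  have hU : (U : Filter (Finset K)) ≤ atTop := Ultrafilter.of_le _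
  have h1 : ∀ j, ∃ t, ∀ᶠ Q in (U : Filter (Finset K)), G Q j = t := by
    intro j
    obtain ⟨t, ht⟩ := Ultrafilter.eq_pure_of_finite (U.map (fun Q => G Q j))
    refine ⟨t, ?_⟩
    have : ({t} : Set T) ∈ U.map (fun Q => G Q j) := by rw [ht]; exact rfl
    exact this
  choose g hg using h1
  refine ⟨g, fun k => ?_⟩
  have h2 : ∀ᶠ Q in (U : Filter (Finset K)), ∀ i ∈ S k, G Q i = g i :=
    (eventually_all_finite (hS k)).2 fun i _ => hg i
  have h3 : ∀ᶠ Q in (U : Filter (Finset K)), k ∈ Q := by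
    apply hU
    filter_upwards [eventually_ge_atTop ({k} : Finset K)] with Q hQ
    exact hQ (Finset.mem_singleton_self k)
  obtain ⟨Q, hQ1, hQ2⟩ := (h2.and h3).exists
  exact loc k _ _ hQ1 (hG Q k hQ2)

noncomputable def epS {W ι : Type*} (a b : ι → W) (A : Set W) (M : Set ι) : ZMod 2 :=
  ∑ᶠ i ∈ M, epChi a b A i

open Classical in
lemma epS_eq_sum {W ι : Type*} {a b : ι → W} {A : Set W} {M : Set ι} (T : Finset ι)
    (h : ∀ i ∈ M, epChi a b A i ≠ 0 → i ∈ T) :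
    epS a b A M = ∑ i ∈ T with i ∈ M, epChi a b A i := by
  unfold epS
  apply finsum_mem_eq_sum_of_inter_support_eq
  ext i
  simp only [mem_inter_iff, Function.mem_support, Finset.coe_filter, mem_ofPred_eq]
  constructor
  · rintro ⟨h1, h2⟩; exact ⟨⟨h i h1 h2, h1⟩, h2⟩
  · rintro ⟨⟨_, h1⟩, h2⟩; exact ⟨h1, h2⟩

lemma epS_congr {W ι : Type*} {a b : ι → W} {A : Set W} {M M' : Set ι}
    (h : ∀ i, epChi a b A i ≠ 0 → (i ∈ M ↔ i ∈ M')) :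
    epS a b A M = epS a b A M' := by
  unfold epS
  rw [← finsum_mem_inter_support, ← finsum_mem_inter_support (s := M')]
  congr 1; ext i
  have : (i ∈ M ∩ Function.support fun i => epChi a b A i) ↔
    (i ∈ M' ∩ Function.support fun i => epChi a b A i) := by
    simp only [mem_inter_iff, Function.mem_support]
    constructor
    · rintro ⟨h1, h2⟩; exact ⟨(h i h2).1 h1, h2⟩
    · rintro ⟨h1, h2⟩; exact ⟨(h i h2).2 h1, h2⟩
  simp only [this]

lemma epS_eq_sum' {W ι : Type*} {a b : ι → W} {A : Set W} {M : Set ι} (T : Finset ι)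
    (h : ∀ i, epChi a b A i ≠ 0 → (i ∈ M ↔ i ∈ T)) :
    epS a b A M = ∑ i ∈ T, epChi a b A i := by
  rw [epS_congr (M' := (T : Set ι)) (fun i hi => by rw [h i hi, Finset.mem_coe])]
  exact finsum_mem_coe_finset _ _

lemma epS_empty {W ι : Type*} {a b : ι → W} {A : Set W} : epS a b A ∅ = 0 := by
  simp [epS]

lemma epS_union {W ι : Type*} {a b : ι → W} {A : Set W} (hA : (support (epChi a b A)).Finite)
    {M N : Set ι} (h : Disjoint M N) :
    epS a b A (M ∪ N) = epS a b A M + epS a b A N :=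
  finsum_mem_union' h (hA.subset inter_subset_right) (hA.subset inter_subset_right)

lemma epS_single {W ι : Type*} {a b : ι → W} {A : Set W} (i : ι) :
    epS a b A {i} = epChi a b A i := by
  simp [epS]

lemma ep_isClopen_bool {V : Type*} [TopologicalSpace V] {K : Type*} [Finite K] (C : K → Set V)
    (hC : ∀ k, IsClopen (C k)) (S : Set (K → Prop)) : IsClopen {v | (fun k => v ∈ C k) ∈ S} := by
  have : {v | (fun k => v ∈ C k) ∈ S} = ⋃ w ∈ S, ⋂ k, {v | v ∈ C k ↔ w k} := by
    ext v
    simp only [mem_ofPred_eq, mem_iUnion, mem_iInter, exists_prop]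
    constructor
    · intro h; exact ⟨_, h, fun k => Iff.rfl⟩
    · rintro ⟨w, hw, h⟩
      have : (fun k => v ∈ C k) = w := funext fun k => propext (h k)
      rwa [this]
  rw [this]
  refine (Set.toFinite S).isClopen_biUnion fun w _ => isClopen_iInter_of_finite fun k => ?_
  by_cases hk : w k
  · simpa [hk] using hC k
  · have : {v | v ∈ C k ↔ w k} = (C k)ᶜ := by ext v; simp [hk]
    rw [this]; exact (hC k).compl



lemma ep_idxOf_lt {ι : Type*} [DecidableEq ι] (l1 l2 : List ι) (e i : ι) (h : e ∉ l1) :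
    (l1 ++ e :: l2).idxOf i < (l1 ++ e :: l2).idxOf e ↔ i ∈ l1 := by
  rw [List.idxOf_append_of_notMem h, List.idxOf_cons_self]
  by_cases hi : i ∈ l1
  · rw [List.idxOf_append_of_mem hi]
    have := List.idxOf_lt_length_iff.2 hi
    simp [hi]; omega
  · rw [List.idxOf_append_of_notMem hi]
    simp [hi]

open Classical in
lemma epS_list {W ι : Type*} {a b : ι → W} {A : Set W} (l : List ι) (hl : l.Nodup) :
    epS a b A {i | i ∈ l} = (l.map (epChi a b A)).sum := by
  rw [← List.sum_toFinset _ hl, ← finsum_mem_coe_finset, List.coe_toFinset]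
  rfl

open Classical in
theorem ep_order_fin {V ι : Type*} [TopologicalSpace V] (a b : ι → V)
    (hfin : ∀ A, IsClopen A → (support (epChi a b A)).Finite) (x y : V)
    (par : ∀ A, IsClopen A → epS a b A univ = epInd A x + epInd A y)
    (conn : ∀ A, IsClopen A → x ∈ A → (∀ i, a i ∈ A ↔ b i ∈ A) → ∀ i, a i ∈ A)
    (𝒜 : Set (Set V)) (h𝒜f : 𝒜.Finite) (h𝒜 : ∀ A ∈ 𝒜, IsClopen A) (F0 : Finset ι) :
    ∃ (lt : ι → ι → Prop) (o : ι → Bool), (∀ i, ¬ lt i i) ∧ (∀ i j k, lt i j → lt j k → lt i k) ∧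
      (∀ i ∈ F0, ∀ j ∈ F0, i = j ∨ lt i j ∨ lt j i) ∧
      ∀ A ∈ 𝒜, ∀ e ∈ F0, epInd A (epTail a b (e, o e)) = epInd A x + epS a b A {i | lt i e} := by
  have : Finite 𝒜 := h𝒜f
  let q : V → (𝒜 → Prop) := fun v A => v ∈ A.1
  have hq : ∀ S : Set (𝒜 → Prop), IsClopen (q ⁻¹' S) := fun S =>
    ep_isClopen_bool (fun A : 𝒜 => A.1) (fun A => h𝒜 _ A.2) S
  have hbdf : (⋃ A : 𝒜, support (epChi a b A.1)).Finite :=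
    Set.finite_iUnion fun A => hfin _ (h𝒜 _ A.2)
  let F1 : Finset ι := F0 ∪ hbdf.toFinset
  have hF1 : ∀ i, i ∉ F1 → q (a i) = q (b i) := by
    intro i hi
    funext A
    apply propext
    rw [← epChi_eq_zero_iff (a := a) (b := b)]
    by_contra hne
    apply hi
    refine Finset.mem_union_right _ ?_
    rw [Set.Finite.mem_toFinset, mem_iUnion]
    exact ⟨A, hne⟩
  have hchi : ∀ S i, epChi (q ∘ a) (q ∘ b) S i = epChi a b (q ⁻¹' S) i := fun S i => rfl
  have hsup : ∀ (S : Set (𝒜 → Prop)) i, epChi a b (q ⁻¹' S) i ≠ 0 → i ∈ F1 := by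
    intro S i hne
    by_contra hi
    apply hne
    rw [epChi_eq_zero_iff, mem_preimage, mem_preimage, hF1 i hi]
  obtain ⟨L, hnd, hmem, hT⟩ := ep_finEuler (q ∘ a) (q ∘ b) _ F1 (q x) (q y) rfl (by
    intro S
    have h1 := par _ (hq S)
    rw [epS_eq_sum' F1 (fun i h => by simpa using hsup S i h)] at h1
    exact h1) (by
    intro S hxS hS i hi
    refine conn _ (hq S) hxS (fun j => ?_) i
    by_cases hj : j ∈ F1
    · exact hS j hj
    · rw [mem_preimage, mem_preimage, hF1 j hj])
  set l := L.map Prod.fst with hl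
  refine ⟨fun i j => l.idxOf i < l.idxOf j, fun e => decide ((e, true) ∈ L), ?_, ?_, ?_, ?_⟩
  · intro i; exact lt_irrefl _
  · intro i j k; exact lt_trans
  · intro i hi j hj
    have hi' : i ∈ l := (hmem i).2 (Finset.mem_union_left _ hi)
    rcases lt_trichotomy (l.idxOf i) (l.idxOf j) with h | h | h
    · exact Or.inr (Or.inl h)
    · exact Or.inl ((List.idxOf_inj hi').1 h)
    · exact Or.inr (Or.inr h)
  · intro A hA e he
    have he' : e ∈ l := (hmem e).2 (Finset.mem_union_left _ he)
    obtain ⟨p, hpL, hpe⟩ := List.mem_map.1 he'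
    obtain ⟨L1, L2, hL⟩ := List.append_of_mem hpL
    have hl12 : l = L1.map Prod.fst ++ e :: L2.map Prod.fst := by
      rw [hl, hL]; simp [hpe]
    have hnd' := hnd
    rw [hl12, List.nodup_append] at hnd'
    obtain ⟨hn1, hn2, hn3⟩ := hnd'
    have he1 : e ∉ L1.map Prod.fst := fun h => hn3 e h e (by simp) rfl
    have he2 : e ∉ L2.map Prod.fst := (List.nodup_cons.1 hn2).1
    have hpo : p = (e, decide ((e, true) ∈ L)) := by
      have hu : ∀ s, (e, s) ∈ L → (e, s) = p := by
        intro s hs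
        rw [hL, List.mem_append, List.mem_cons] at hs
        rcases hs with h | h | h
        · exact absurd (List.mem_map_of_mem (f := Prod.fst) h) he1
        · exact h
        · exact absurd (List.mem_map_of_mem (f := Prod.fst) h) he2
      rcases p with ⟨e', s⟩
      simp only at hpe
      subst hpe
      rcases s with _ | _
      · have : (e', true) ∉ L := fun h => by simpa using hu _ h
        simp [this]
      · simp [hpL]
    rw [← hpo]
    rw [hL] at hT
    obtain ⟨z, hz1, hz2⟩ := hT.split
    have hpar := hz1.parity {w | w ⟨A, hA⟩}
    rw [← hz2.1] at hpar
    have hpre : q ⁻¹' {w | w ⟨A, hA⟩} = A := rfl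
    have e1 : epInd {w : 𝒜 → Prop | w ⟨A, hA⟩} (epTail (q ∘ a) (q ∘ b) p) =
        epInd A (epTail a b p) := by
      rw [epInd_eq_iff]; unfold epTail; split_ifs <;> rfl
    have e2 : epInd {w : 𝒜 → Prop | w ⟨A, hA⟩} (q x) = epInd A x := rfl
    rw [e1, e2] at hpar
    rw [hpar]
    congr 1
    have hset : {i | l.idxOf i < l.idxOf e} = {i | i ∈ L1.map Prod.fst} := by
      ext i
      show l.idxOf i < l.idxOf e ↔ i ∈ L1.map Prod.fst
      rw [hl12, ep_idxOf_lt _ _ _ _ he1]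
    show _ = epS a b A {i | l.idxOf i < l.idxOf e}
    rw [hset, epS_list _ hn1]
    rfl

open Classical in
theorem ep_order {V ι : Type*} [TopologicalSpace V] (a b : ι → V)
    (hfin : ∀ A, IsClopen A → (support (epChi a b A)).Finite) (x y : V)
    (par : ∀ A, IsClopen A → epS a b A univ = epInd A x + epInd A y)
    (conn : ∀ A, IsClopen A → x ∈ A → (∀ i, a i ∈ A ↔ b i ∈ A) → ∀ i, a i ∈ A) :
    ∃ (lt : ι → ι → Prop) (o : ι → Bool), (∀ i, ¬ lt i i) ∧ (∀ i j k, lt i j → lt j k → lt i k) ∧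
      (∀ i j, i = j ∨ lt i j ∨ lt j i) ∧
      ∀ A, IsClopen A → ∀ e, epInd A (epTail a b (e, o e)) = epInd A x + epS a b A {i | lt i e} := by
  let K := (ι × ι × ι) ⊕ ({A : Set V // IsClopen A} × ι)
  let S : K → Set ((ι × ι) ⊕ ι) := fun k => match k with
    | Sum.inl (i, j, k) => {Sum.inl (i, i), Sum.inl (i, j), Sum.inl (j, k), Sum.inl (i, k), Sum.inl (j, i)}
    | Sum.inr (A, e) => insert (Sum.inr e) ((fun i => Sum.inl (i, e)) '' (support (epChi a b A.1)))
  let P : K → ((ι × ι) ⊕ ι → Bool) → Prop := fun k g => match k with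
    | Sum.inl (i, j, k) => g (Sum.inl (i, i)) = false ∧
        (g (Sum.inl (i, j)) = true → g (Sum.inl (j, k)) = true → g (Sum.inl (i, k)) = true) ∧
        (i = j ∨ g (Sum.inl (i, j)) = true ∨ g (Sum.inl (j, i)) = true)
    | Sum.inr (A, e) => epInd A.1 (epTail a b (e, g (Sum.inr e))) =
        epInd A.1 x + epS a b A.1 {i | g (Sum.inl (i, e)) = true}
  obtain ⟨g, hg⟩ := ep_rado S (by
      rintro (⟨i, j, k⟩ | ⟨A, e⟩)
      · simp [S]
      · exact ((hfin _ A.2).image _).insert _) P (by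
      rintro (⟨i, j, k⟩ | ⟨A, e⟩) g g' h
      · simp only [S, mem_insert_iff, mem_singleton_iff, forall_eq_or_imp, forall_eq] at h
        simp only [P, h]; exact id
      · simp only [S, mem_insert_iff, forall_eq_or_imp] at h
        simp only [P]
        rw [h.1, epS_congr (M' := {i | g' (Sum.inl (i, e)) = true})]
        · exact id
        · intro i hi
          rw [mem_ofPred_eq, mem_ofPred_eq, h.2 _ ⟨i, hi, rfl⟩]) (by
      intro Q
      let 𝒜 : Set (Set V) := {A | ∃ h : IsClopen A, ∃ e, (Sum.inr (⟨A, h⟩, e) : K) ∈ Q}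
      have h𝒜f : 𝒜.Finite := by
        refine (Q.finite_toSet.image (fun k : K => match k with
          | Sum.inl _ => ∅ | Sum.inr (A, e) => A.1)).subset ?_
        rintro A ⟨h, e, hQ⟩
        exact ⟨_, hQ, rfl⟩
      let F0 : Finset ι := Q.biUnion (fun k => match k with
        | Sum.inl (i, j, k) => {i, j, k} | Sum.inr (A, e) => {e})
      obtain ⟨lt, o, h1, h2, h3, h4⟩ := ep_order_fin a b hfin x y par conn 𝒜 h𝒜f
        (fun A hA => hA.1) F0
      refine ⟨fun s => match s with | Sum.inl (i, j) => decide (lt i j) | Sum.inr e => o e, ?_⟩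
      rintro (⟨i, j, k⟩ | ⟨A, e⟩) hk
      · simp only [P, decide_eq_true_eq, decide_eq_false_iff_not]
        refine ⟨h1 i, h2 i j k, h3 i ?_ j ?_⟩
        · exact Finset.mem_biUnion.2 ⟨_, hk, by simp⟩
        · exact Finset.mem_biUnion.2 ⟨_, hk, by simp⟩
      · simp only [P, decide_eq_true_eq]
        exact h4 A.1 ⟨A.2, e, hk⟩ e (Finset.mem_biUnion.2 ⟨_, hk, by simp⟩))
  refine ⟨fun i j => g (Sum.inl (i, j)) = true, fun e => g (Sum.inr e), ?_, ?_, ?_, ?_⟩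
  · intro i
    have := (hg (Sum.inl (i, i, i))).1
    simp [this]
  · intro i j k; exact (hg (Sum.inl (i, j, k))).2.1
  · intro i j; exact (hg (Sum.inl (i, j, j))).2.2
  · intro A hA e; exact hg (Sum.inr (⟨A, hA⟩, e))


lemma ep_exists_min {α : Type*} {c : Set α} (h : c.Nonempty) (f : α → ℕ) :
    ∃ s ∈ c, ∀ t ∈ c, f s ≤ f t := by
  obtain ⟨s, hs, hm⟩ := (InvImage.wf f Nat.lt_wfRel.wf).has_min c h
  exact ⟨s, hs, fun t ht => not_lt.1 (hm t ht)⟩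

open Classical in
theorem ep_parSub_fin {V ι : Type*} [TopologicalSpace V] (a b : ι → V) (F0 : Set ι) (x y : V)
    (hsep : ∀ A, IsClopen A → x ∈ A → (∀ i ∈ F0, a i ∈ A ↔ b i ∈ A) → y ∈ A)
    (𝒜 : Set (Set V)) (h𝒜f : 𝒜.Finite) (h𝒜 : ∀ A ∈ 𝒜, IsClopen A) :
    ∃ F : Finset ι, ↑F ⊆ F0 ∧ ∀ A ∈ 𝒜, epS a b A F = epInd A x + epInd A y := by
  have : Finite 𝒜 := h𝒜f
  let q : V → (𝒜 → Prop) := fun v A => v ∈ A.1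
  have hq : ∀ S : Set (𝒜 → Prop), IsClopen (q ⁻¹' S) := fun S =>
    ep_isClopen_bool (fun A : 𝒜 => A.1) (fun A => h𝒜 _ A.2) S
  let R : Set (𝒜 → Prop) := {w | ∃ F : Finset ι, ↑F ⊆ F0 ∧
    ∀ S, ∑ i ∈ F, epChi (q ∘ a) (q ∘ b) S i = epInd S (q x) + epInd S w}
  have step : ∀ i ∈ F0, ∀ w w', (∀ S, epChi (q ∘ a) (q ∘ b) S i = epInd S w + epInd S w') →
      w ∈ R → w' ∈ R := by
    rintro i hi w w' hww ⟨F, hF, hFS⟩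
    by_cases hiF : i ∈ F
    · refine ⟨F.erase i, fun j hj => hF (Finset.mem_of_mem_erase hj), fun S => ?_⟩
      have h1 := Finset.add_sum_erase F (epChi (q ∘ a) (q ∘ b) S) hiF
      have h2 := hFS S
      rw [← h1, hww] at h2
      have := epZ_self (epInd S w')
      linear_combination h2 - this
    · refine ⟨insert i F, ?_, fun S => ?_⟩
      · intro j hj
        rw [Finset.coe_insert, mem_insert_iff] at hj
        rcases hj with rfl | hj
        · exact hi
        · exact hF hj
      · rw [Finset.sum_insert hiF, hFS, hww]
        have := epZ_self (epInd S w)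
        linear_combination this
  have hy : y ∈ q ⁻¹' R := by
    refine hsep _ (hq R) ⟨∅, by simp, fun S => by simp [epZ_self]⟩ fun i hi => ?_
    constructor
    · exact step i hi _ _ fun S => rfl
    · exact step i hi _ _ fun S => add_comm _ _
  obtain ⟨F, hF, hFS⟩ := hy
  refine ⟨F, hF, fun A hA => ?_⟩
  rw [epS_eq_sum' F (fun i _ => Finset.mem_coe)]
  exact hFS {w | w ⟨A, hA⟩}

theorem ep_parSub {V ι : Type*} [TopologicalSpace V] (a b : ι → V)
    (hfin : ∀ A, IsClopen A → (support (epChi a b A)).Finite) (F0 : Set ι) (x y : V)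
    (hsep : ∀ A, IsClopen A → x ∈ A → (∀ i ∈ F0, a i ∈ A ↔ b i ∈ A) → y ∈ A) :
    ∃ F ⊆ F0, ∀ A, IsClopen A → epS a b A F = epInd A x + epInd A y := by
  classical
  obtain ⟨g, hg⟩ := ep_rado (ι := ι) (T := Bool) (K := ι ⊕ {A : Set V // IsClopen A})
    (Sum.elim (fun i => {i}) (fun A => support (epChi a b A.1)))
    (by rintro (i | A); · simp
        · exact hfin _ A.2)
    (fun k g => Sum.elim (fun i => g i = true → i ∈ F0)
      (fun A => epS a b A.1 {i | g i = true} = epInd A.1 x + epInd A.1 y) k)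
    (by
      rintro (i | A) g g' h
      · simp only [Sum.elim_inl] at h ⊢
        rw [h i rfl]; exact id
      · simp only [Sum.elim_inr] at h ⊢
        rw [epS_congr (M' := {i | g' i = true})]
        · exact id
        · intro i hi
          rw [mem_ofPred_eq, mem_ofPred_eq, h i hi])
    (by
      intro Q
      obtain ⟨F, hF, hFA⟩ := ep_parSub_fin a b F0 x y hsep
        {A | ∃ h : IsClopen A, (Sum.inr ⟨A, h⟩ : ι ⊕ {A : Set V // IsClopen A}) ∈ Q}
        (by
          refine (Q.finite_toSet.image (Sum.elim (fun _ => ∅) (fun A => A.1))).subset ?_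
          rintro A ⟨h, hA⟩
          exact ⟨_, hA, rfl⟩) (fun A hA => hA.1)
      refine ⟨fun i => decide (i ∈ F), ?_⟩
      rintro (i | A) hk
      · simp only [Sum.elim_inl, decide_eq_true_eq]
        exact fun h => hF h
      · simp only [Sum.elim_inr, decide_eq_true_eq]
        exact hFA A.1 ⟨A.2, hk⟩)
  refine ⟨{i | g i = true}, fun i hi => hg (Sum.inl i) hi, fun A hA => hg (Sum.inr ⟨A, hA⟩)⟩

theorem ep_minSub {V ι : Type*} [TopologicalSpace V] (a b : ι → V)
    (hfin : ∀ A, IsClopen A → (support (epChi a b A)).Finite) (F0 : Set ι) (x y : V)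
    (hsep : ∀ A, IsClopen A → x ∈ A → (∀ i ∈ F0, a i ∈ A ↔ b i ∈ A) → y ∈ A) :
    ∃ F ⊆ F0, (∀ A, IsClopen A → epS a b A F = epInd A x + epInd A y) ∧
      (∀ M ⊆ F, (∀ A, IsClopen A → epS a b A M = 0) → M = ∅) ∧
      (∀ A, IsClopen A → x ∈ A → (∀ i ∈ F, a i ∈ A ↔ b i ∈ A) → ∀ i ∈ F, a i ∈ A) := by
  obtain ⟨F1, hF1, hF1A⟩ := ep_parSub a b hfin F0 x y hsep
  let 𝒮 : Set (Set ι) := {F | F ⊆ F0 ∧ ∀ A, IsClopen A → epS a b A F = epInd A x + epInd A y}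
  obtain ⟨F, hF⟩ := zorn_superset 𝒮 (by
    intro c hc hch
    by_cases hne : c.Nonempty
    · refine ⟨⋂₀ c, ⟨?_, ?_⟩, fun s hs => sInter_subset_of_mem hs⟩
      · obtain ⟨s, hs⟩ := hne
        exact (sInter_subset_of_mem hs).trans (hc hs).1
      · intro A hA
        obtain ⟨s, hs, hmin⟩ := ep_exists_min hne
          (fun s => (s ∩ support (epChi a b A)).ncard)
        rw [← (hc hs).2 A hA]
        refine epS_congr fun i hi => ⟨fun h => h s hs, fun h t ht => ?_⟩
        rcases hch.total hs ht with h1 | h1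
        · exact h1 h
        · have h2 := Set.eq_of_subset_of_ncard_le
            (inter_subset_inter_left (support (epChi a b A)) h1) (hmin t ht)
            ((hfin A hA).subset inter_subset_right)
          have : i ∈ s ∩ support (epChi a b A) := ⟨h, hi⟩
          rw [← h2] at this
          exact this.1
    · rw [not_nonempty_iff_eq_empty] at hne
      subst hne
      exact ⟨F1, ⟨hF1, hF1A⟩, by simp⟩)
  have hmin : ∀ M ⊆ F, (∀ A, IsClopen A → epS a b A M = 0) → M = ∅ := by
    intro M hM h0
    have hd : F \ M ∈ 𝒮 := by
      refine ⟨sdiff_subset.trans hF.prop.1, fun A hA => ?_⟩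
      have h1 := epS_union (hfin A hA) (disjoint_sdiff_left (s := M) (t := F))
      rw [sdiff_union_of_subset hM, h0 A hA, add_zero] at h1
      rw [← h1, hF.prop.2 A hA]
    have h2 := hF.le_of_le hd sdiff_subset
    ext i
    simp only [mem_empty_iff_false, iff_false]
    intro hi
    exact (h2 (hM hi)).2 hi
  refine ⟨F, hF.prop.1, hF.prop.2, hmin, ?_⟩
  intro A hA hx hcl i hi
  by_contra hia
  have hyA : y ∈ A := by
    have h1 := hF.prop.2 A hA
    rw [epS_congr (M' := ∅), epS_empty] at h1
    · exact (epInd_eq_iff.1 (epZ_eq_of_add _ _ h1.symm)).1 hx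
    · intro i hi
      simp only [mem_empty_iff_false, iff_false]
      exact fun h => hi (epChi_eq_zero_iff.2 (hcl i h))
  have h0 := hmin {i ∈ F | a i ∉ A} (fun i hi => hi.1) (by
    intro B hB
    have h1 := hF.prop.2 (B \ A) (hB.diff hA)
    have h2 : epS a b B {i ∈ F | a i ∉ A} = epS a b (B \ A) F := by
      unfold epS
      rw [finsum_mem_def, finsum_mem_def]
      congr 1; ext j
      by_cases hj : j ∈ F
      · by_cases hja : a j ∈ A
        · have := (hcl j hj).1 hja
          simp [indicator, hj, hja, epChi, epInd, this]
        · have : b j ∉ A := fun h => hja ((hcl j hj).2 h)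
          have e1 : epInd (B \ A) (a j) = epInd B (a j) :=
            epInd_eq_iff.2 ⟨fun h => h.1, fun h => ⟨h, hja⟩⟩
          have e2 : epInd (B \ A) (b j) = epInd B (b j) :=
            epInd_eq_iff.2 ⟨fun h => h.1, fun h => ⟨h, this⟩⟩
          simp [indicator, hj, hja, epChi, e1, e2]
      · simp [indicator, hj]
    rw [h2, h1]
    simp [epInd, hx, hyA])
  have : i ∈ ({i ∈ F | a i ∉ A} : Set ι) := ⟨hi, hia⟩
  rw [h0] at this
  exact this

theorem ep_notSep {V ι : Type*} [TopologicalSpace V] [CompactSpace V] (a b : ι → V)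
    (F0 : Set ι) (v : V) (B : Set V) (hB : IsClosed B)
    (hcr : ∀ D, IsClopen D → v ∈ D → Disjoint D B → ∃ i ∈ F0, ¬ (a i ∈ D ↔ b i ∈ D)) :
    ∃ y ∈ B, ∀ A, IsClopen A → v ∈ A → (∀ i ∈ F0, a i ∈ A ↔ b i ∈ A) → y ∈ A := by
  by_contra hcon
  push Not at hcon
  obtain ⟨D, hD, hvD, hDu, hDB⟩ := hB.isCompact.induction_on
    (p := fun s => ∃ D, IsClopen D ∧ v ∈ D ∧ (∀ i ∈ F0, a i ∈ D ↔ b i ∈ D) ∧ Disjoint D s)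
    ⟨univ, isClopen_univ, mem_univ _, by simp, by simp⟩
    (by rintro s t hst ⟨D, h1, h2, h3, h4⟩; exact ⟨D, h1, h2, h3, h4.mono_right hst⟩)
    (by
      rintro s t ⟨D, h1, h2, h3, h4⟩ ⟨D', h1', h2', h3', h4'⟩
      refine ⟨D ∩ D', h1.inter h1', ⟨h2, h2'⟩, fun i hi => ?_, ?_⟩
      · rw [mem_inter_iff, mem_inter_iff, h3 i hi, h3' i hi]
      · rw [disjoint_union_right]
        exact ⟨h4.mono_left inter_subset_left, h4'.mono_left inter_subset_right⟩)
    (by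
      intro y hy
      obtain ⟨A, hA, hvA, hAu, hyA⟩ := hcon y hy
      exact ⟨Aᶜ, mem_nhdsWithin_of_mem_nhds (hA.compl.isOpen.mem_nhds hyA),
        A, hA, hvA, hAu, disjoint_compl_right⟩)
  obtain ⟨i, hi, h⟩ := hcr D hD hvD hDB
  exact h (hDu i hi)


open Classical in
noncomputable def epOut {W κ : Type*} (src tgt : κ → W) (F : Finset κ) (S : Set W) : ℕ :=
  ∑ p ∈ F, if src p ∈ S ∧ tgt p ∉ S then 1 else 0

open Classical in
lemma epOut_submod {W κ : Type*} (src tgt : κ → W) (F : Finset κ) (S T : Set W) :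
    epOut src tgt F (S ∩ T) + epOut src tgt F (S ∪ T) +
      (∑ p ∈ F, if src p ∈ S ∧ src p ∉ T ∧ tgt p ∈ T ∧ tgt p ∉ S then 1 else 0)
      ≤ epOut src tgt F S + epOut src tgt F T := by
  unfold epOut
  rw [← Finset.sum_add_distrib, ← Finset.sum_add_distrib, ← Finset.sum_add_distrib]
  refine Finset.sum_le_sum fun p _ => ?_
  by_cases h1 : src p ∈ S <;> by_cases h2 : src p ∈ T <;> by_cases h3 : tgt p ∈ S <;>
    by_cases h4 : tgt p ∈ T <;> simp [h1, h2, h3, h4]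

open Classical in
lemma epOut_pos {W κ : Type*} {src tgt : κ → W} {F : Finset κ} {S : Set W}
    (h : 0 < epOut src tgt F S) : ∃ p ∈ F, src p ∈ S ∧ tgt p ∉ S := by
  by_contra hcon
  push Not at hcon
  have : epOut src tgt F S = 0 := by
    refine Finset.sum_eq_zero fun p hp => ?_
    rw [if_neg]
    exact fun h => h.2 (hcon p hp h.1)
  omega

open Classical in
lemma ep_colors {κ : Type*} (P : Finset κ) (k : ℕ) (h : k ≤ P.card) :
    ∃ c : κ → ℕ, ∀ j < k, ∃ i ∈ P, c i = j := by
  refine ⟨fun i => if h : i ∈ P then (P.equivFin ⟨i, h⟩).1 else 0, fun j hj => ?_⟩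
  refine ⟨(P.equivFin.symm ⟨j, by omega⟩).1, (P.equivFin.symm ⟨j, by omega⟩).2, ?_⟩
  simp

open Classical in
theorem ep_menger_dir {W κ : Type*} [Finite W] (src : κ → W) (s t : W) (hst : s ≠ t) (k : ℕ) :
    ∀ (n : ℕ) (F : Finset κ) (tgt : κ → W), F.card = n →
    (∀ S : Set W, s ∈ S → t ∉ S → k ≤ epOut src tgt F S) →
    ∃ c : κ → ℕ, ∀ S : Set W, s ∈ S → t ∉ S → ∀ j < k, ∃ p ∈ F, src p ∈ S ∧ tgt p ∉ S ∧ c p = j := by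
  intro n
  induction n with
  | zero =>
    intro F tgt hF hk
    rw [Finset.card_eq_zero] at hF
    subst hF
    have := hk {s} rfl hst.symm
    simp only [epOut, Finset.sum_empty, nonpos_iff_eq_zero] at this
    subst this
    exact ⟨fun _ => 0, fun S _ _ j hj => absurd hj (Nat.not_lt_zero _)⟩
  | succ n ih =>
  intro F tgt hF hk
  by_cases hcase : ∃ e ∈ F, src e = s ∧ tgt e ≠ s ∧ tgt e ≠ t
  · obtain ⟨e, heF, hes, hus, hut⟩ := hcase
    set u := tgt e with hu
    by_cases htight : ∃ S : Set W, (s ∈ S ∧ t ∉ S ∧ u ∉ S) ∧ epOut src tgt F S = k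
    · obtain ⟨T, ⟨⟨hsT, htT, huT⟩, hTk⟩, hTmax⟩ := (Set.toFinite
        {S : Set W | (s ∈ S ∧ t ∉ S ∧ u ∉ S) ∧ epOut src tgt F S = k}).exists_maximal htight
      obtain ⟨f, hfF, hfu, hfT, hfu'⟩ : ∃ f ∈ F, src f = u ∧ tgt f ∉ T ∧ tgt f ≠ u := by
        by_contra hcon
        push Not at hcon
        have h1 := hk (insert u T) (Or.inr hsT) (by
          rintro (h | h)
          · exact hut h.symm
          · exact htT h)
        have h2 : epOut src tgt F (insert u T) < epOut src tgt F T := by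
          unfold epOut
          refine Finset.sum_lt_sum (fun p hp => ?_) ⟨e, heF, ?_⟩
          · by_cases hp1 : src p ∈ insert u T ∧ tgt p ∉ insert u T
            · rw [if_pos hp1]
              have hp2 : tgt p ∉ T := fun h => hp1.2 (Or.inr h)
              have hp3 : tgt p ≠ u := fun h => hp1.2 (Or.inl h)
              have hp4 : src p ∈ T := hp1.1.resolve_left fun h => hp3 (hcon p hp h hp2)
              rw [if_pos ⟨hp4, hp2⟩]
            · rw [if_neg hp1]; exact Nat.zero_le _
          · rw [if_neg (fun h => h.2 (Or.inl rfl)), if_pos ⟨hes ▸ hsT, huT⟩]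
            exact Nat.zero_lt_one
        omega
      have hfe : f ≠ e := by
        rintro rfl
        exact hus (hfu.symm.trans hes)
      set w := tgt f with hw
      set tgt' := Function.update tgt e w with htgt'
      have ht'e : tgt' e = w := Function.update_self _ _ _
      have ht'n : ∀ p, p ≠ e → tgt' p = tgt p := fun p hp => Function.update_of_ne hp _ _
      have heF' : e ∈ F.erase f := Finset.mem_erase.2 ⟨hfe.symm, heF⟩
      obtain ⟨c, hc⟩ := ih (F.erase f) tgt' (by rw [Finset.card_erase_of_mem hfF, hF]; rfl) (by
        intro S hs ht
        have E1 : epOut src tgt F S = (if src f ∈ S ∧ tgt f ∉ S then 1 else 0) +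
            ((if src e ∈ S ∧ tgt e ∉ S then 1 else 0) + epOut src tgt ((F.erase f).erase e) S) := by
          unfold epOut
          rw [Finset.add_sum_erase _ (fun p => if src p ∈ S ∧ tgt p ∉ S then 1 else 0) heF',
            Finset.add_sum_erase _ (fun p => if src p ∈ S ∧ tgt p ∉ S then 1 else 0) hfF]
        have E2 : epOut src tgt' (F.erase f) S = (if src e ∈ S ∧ tgt' e ∉ S then 1 else 0) +
            epOut src tgt' ((F.erase f).erase e) S := by
          unfold epOut
          rw [Finset.add_sum_erase _ (fun p => if src p ∈ S ∧ tgt' p ∉ S then 1 else 0) heF']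
        have E3 : epOut src tgt' ((F.erase f).erase e) S = epOut src tgt ((F.erase f).erase e) S := by
          unfold epOut
          refine Finset.sum_congr rfl fun p hp => ?_
          rw [ht'n p (Finset.mem_erase.1 hp).1]
        rw [ht'e] at E2
        rw [← hu, ← hw, hfu] at E1
        rw [hes] at E1 E2
        have hkS := hk S hs ht
        by_cases hwS : w ∈ S <;> by_cases huS : u ∈ S
        · simp only [hwS, huS, hs, not_true, and_false, if_false] at E1 E2; omega
        · simp only [hwS, huS, hs, not_true, and_false, and_true, not_false_eq_true, if_true,
            if_false] at E1 E2
          have hne : epOut src tgt F S ≠ k := by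
            intro hSk
            have hsub := epOut_submod src tgt F S T
            have h1 := hk (S ∩ T) ⟨hs, hsT⟩ (fun h => ht h.1)
            have h2 := hk (S ∪ T) (Or.inl hs) (fun h => h.elim ht htT)
            have h3 : epOut src tgt F (S ∪ T) = k := by omega
            have h4 := hTmax (y := S ∪ T) ⟨⟨Or.inl hs, fun h => h.elim ht htT,
              fun h => h.elim huS huT⟩, h3⟩ subset_union_right
            exact hfT (h4 (Or.inl hwS))
          omega
        · simp only [hwS, huS, hs, not_true, and_false, and_true, not_false_eq_true, if_true,
            if_false] at E1 E2; omega
        · simp only [hwS, huS, hs, and_true, not_false_eq_true, if_true,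
            if_false, false_and] at E1 E2; omega)
      refine ⟨Function.update c f (c e), fun S hs ht j hj => ?_⟩
      obtain ⟨p, hpF, hp1, hp2, hp3⟩ := hc S hs ht j hj
      have hpf := (Finset.mem_erase.1 hpF).1
      have hpF2 := (Finset.mem_erase.1 hpF).2
      by_cases hpe : p = e
      · subst hpe
        rw [ht'e] at hp2
        by_cases huS : u ∈ S
        · exact ⟨f, hfF, hfu ▸ huS, hp2, by rw [Function.update_self, hp3]⟩
        · exact ⟨p, hpF2, hp1, huS, by rw [Function.update_of_ne hpf, hp3]⟩
      · rw [ht'n p hpe] at hp2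
        exact ⟨p, hpF2, hp1, hp2, by rw [Function.update_of_ne hpf, hp3]⟩
    · push Not at htight
      obtain ⟨c, hc⟩ := ih (F.erase e) tgt (by rw [Finset.card_erase_of_mem heF, hF]; rfl) (by
        intro S hs ht
        have h1 := hk S hs ht
        have E1 : (if src e ∈ S ∧ tgt e ∉ S then 1 else 0) + epOut src tgt (F.erase e) S =
            epOut src tgt F S := by
          unfold epOut
          rw [Finset.add_sum_erase _ (fun p => if src p ∈ S ∧ tgt p ∉ S then 1 else 0) heF]
        by_cases huS : u ∈ S
        · rw [if_neg (fun h => h.2 huS)] at E1; omega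
        · have := htight S ⟨hs, ht, huS⟩
          split_ifs at E1 <;> omega)
      refine ⟨c, fun S hs ht j hj => ?_⟩
      obtain ⟨p, hp, h⟩ := hc S hs ht j hj
      exact ⟨p, Finset.mem_of_mem_erase hp, h⟩
  · push Not at hcase
    obtain ⟨c, hc⟩ := ep_colors (F.filter (fun p => src p ∈ ({s} : Set W) ∧ tgt p ∉ ({s} : Set W))) k (by
      rw [Finset.card_filter]; exact hk {s} rfl hst.symm)
    refine ⟨c, fun S hs ht j hj => ?_⟩
    obtain ⟨p, hp, hpc⟩ := hc j hj
    rw [Finset.mem_filter] at hp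
    obtain ⟨hpF, h1, h2⟩ := hp
    have h3 := hcase p hpF h1 h2
    refine ⟨p, hpF, ?_, ?_, hpc⟩
    · rw [show src p = s from h1]; exact hs
    · rw [h3]; exact ht

open Classical in
theorem ep_menger_fin {W ι : Type*} [Finite W] (a b : ι → W) (s t : W) (hst : s ≠ t) (k : ℕ)
    (F : Finset ι)
    (hk : ∀ S : Set W, s ∈ S → t ∉ S → k ≤ (F.filter (fun i => epChi a b S i ≠ 0)).card) :
    ∃ c : ι → ℕ, ∀ S : Set W, s ∈ S → t ∉ S → ∀ j < k, ∃ i ∈ F, epChi a b S i ≠ 0 ∧ c i = j := by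
  let G (F' : Finset (ι × Bool)) : Prop := F' ⊆ F ×ˢ Finset.univ ∧
    ∀ S : Set W, s ∈ S → t ∉ S → k ≤ epOut (epTail a b) (epHead a b) F' S
  have hG0 : G (F ×ˢ Finset.univ) := by
    refine ⟨subset_rfl, fun S hs ht => (hk S hs ht).trans ?_⟩
    unfold epOut
    rw [Finset.sum_product, Finset.card_filter]
    refine Finset.sum_le_sum fun i _ => ?_
    simp only [ne_eq, epChi_eq_zero_iff, Fintype.sum_bool, epTail, epHead]
    by_cases h1 : a i ∈ S <;> by_cases h2 : b i ∈ S <;> simp [h1, h2]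
  obtain ⟨F', hF', hmin⟩ := ep_exists_min (c := {F' | G F'}) ⟨_, hG0⟩ Finset.card
  have htight : ∀ p ∈ F', ∃ S : Set W, s ∈ S ∧ t ∉ S ∧ epTail a b p ∈ S ∧ epHead a b p ∉ S ∧
      epOut (epTail a b) (epHead a b) F' S = k := by
    intro p hp
    by_contra hcon
    push Not at hcon
    have : G (F'.erase p) := by
      refine ⟨(Finset.erase_subset _ _).trans hF'.1, fun S hs ht => ?_⟩
      have h1 := hF'.2 S hs ht
      have E1 : (if epTail a b p ∈ S ∧ epHead a b p ∉ S then 1 else 0) +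
          epOut (epTail a b) (epHead a b) (F'.erase p) S =
          epOut (epTail a b) (epHead a b) F' S := by
        unfold epOut
        rw [Finset.add_sum_erase _ (fun p => if epTail a b p ∈ S ∧ epHead a b p ∉ S then 1 else 0) hp]
      by_cases hc : epTail a b p ∈ S ∧ epHead a b p ∉ S
      · rw [if_pos hc] at E1
        have := hcon S hs ht hc.1 hc.2
        omega
      · rw [if_neg hc] at E1; omega
    have h2 := hmin _ this
    have h3 := Finset.card_erase_lt_of_mem hp
    omega
  have hnot : ∀ i, ¬ ((i, true) ∈ F' ∧ (i, false) ∈ F') := by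
    rintro i ⟨h1, h2⟩
    obtain ⟨S, hsS, htS, hS1, hS2, hSk⟩ := htight _ h1
    obtain ⟨T, hsT, htT, hT1, hT2, hTk⟩ := htight _ h2
    simp only [epTail, epHead, if_true] at hS1 hS2
    simp only [epTail, epHead] at hT1 hT2
    have hsub := epOut_submod (epTail a b) (epHead a b) F' S T
    have g1 := hF'.2 (S ∩ T) ⟨hsS, hsT⟩ (fun h => htS h.1)
    have g2 := hF'.2 (S ∪ T) (Or.inl hsS) (fun h => h.elim htS htT)
    have g3 := Finset.single_le_sum (f := fun p => if epTail a b p ∈ S ∧ epTail a b p ∉ T ∧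
      epHead a b p ∈ T ∧ epHead a b p ∉ S then 1 else 0) (fun _ _ => Nat.zero_le _) h1
    simp only [epTail, epHead, if_true] at g3
    rw [if_pos ⟨hS1, hT2, hT1, hS2⟩] at g3
    have g4 : 1 ≤ ∑ p ∈ F', if epTail a b p ∈ S ∧ epTail a b p ∉ T ∧
      epHead a b p ∈ T ∧ epHead a b p ∉ S then 1 else 0 := g3
    omega
  obtain ⟨c, hc⟩ := ep_menger_dir (epTail a b) s t hst k _ F' (epHead a b) rfl hF'.2
  refine ⟨fun i => if (i, true) ∈ F' then c (i, true) else c (i, false), fun S hs ht j hj => ?_⟩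
  obtain ⟨p, hp, h1, h2, h3⟩ := hc S hs ht j hj
  refine ⟨p.1, (Finset.mem_product.1 (hF'.1 hp)).1, ?_, ?_⟩
  · rw [epChi_tail_head, epInd_mem h1, epInd_not_mem h2]; decide
  · rcases p with ⟨i, _ | _⟩
    · have : (i, true) ∉ F' := fun h => hnot i ⟨h, hp⟩
      simp only [this, if_false]; exact h3
    · simp only [hp, if_true]; exact h3

theorem ep_menger {V ι : Type*} [TopologicalSpace V] (a b : ι → V)
    (hfin : ∀ A, IsClopen A → (support (epChi a b A)).Finite) (v : V) (A : Set V)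
    (hA : IsClopen A) (hv : v ∈ A) (k : ℕ)
    (hk : ∀ D, IsClopen D → v ∈ D → D ⊆ A → k ≤ (support (epChi a b D)).ncard) :
    ∃ c : ι → ℕ, ∀ D, IsClopen D → v ∈ D → D ⊆ A → ∀ j < k, ∃ i, epChi a b D i ≠ 0 ∧ c i = j := by
  classical
  let K := {D : Set V // IsClopen D ∧ v ∈ D ∧ D ⊆ A}
  obtain ⟨g, hg⟩ := ep_rado (ι := ι) (T := Fin (k + 1)) (K := K)
    (fun D => support (epChi a b D.1)) (fun D => hfin _ D.2.1)
    (fun D g => ∀ j < k, ∃ i, epChi a b D.1 i ≠ 0 ∧ (g i : ℕ) = j)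
    (by
      intro D g g' h h1 j hj
      obtain ⟨i, hi, hj⟩ := h1 j hj
      exact ⟨i, hi, by rw [← h i hi]; exact hj⟩)
    (by
      intro Q
      let Q' : Finset K := insert ⟨A, hA, hv, subset_rfl⟩ Q
      let q : V → (Q' → Prop) := fun v D => v ∈ D.1.1
      have hq : ∀ S : Set (Q' → Prop), IsClopen (q ⁻¹' S) := fun S =>
        ep_isClopen_bool (fun D : Q' => D.1.1) (fun D => D.1.2.1) S
      have hbdf : (⋃ D : Q', support (epChi a b D.1.1)).Finite :=
        Set.finite_iUnion fun D => hfin _ D.1.2.1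
      have hsup : ∀ (S : Set (Q' → Prop)) i, epChi a b (q ⁻¹' S) i ≠ 0 → i ∈ hbdf.toFinset := by
        intro S i hne
        by_contra hi
        apply hne
        rw [epChi_eq_zero_iff, mem_preimage, mem_preimage]
        have : q (a i) = q (b i) := by
          funext D
          apply propext
          rw [← epChi_eq_zero_iff (a := a) (b := b)]
          by_contra hne
          apply hi
          rw [Set.Finite.mem_toFinset, mem_iUnion]
          exact ⟨D, hne⟩
        rw [this]
      obtain ⟨c, hc⟩ := ep_menger_fin (q ∘ a) (q ∘ b) (fun _ => True) (fun _ => False)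
        (fun h => by
          have := congrFun h ⟨⟨A, hA, hv, subset_rfl⟩, Finset.mem_insert_self _ _⟩
          simp at this) k hbdf.toFinset (by
        intro S hs ht
        refine (hk (q ⁻¹' S) (hq S) ?_ ?_).trans ?_
        · have : q v = fun _ => True := by
            funext D; simp only [q, eq_iff_iff, iff_true]; exact D.1.2.2.1
          rw [mem_preimage, this]; exact hs
        · intro z hz
          by_contra hzA
          have : q z = fun _ => False := by
            funext D; simp only [q, eq_iff_iff, iff_false]; exact fun h => hzA (D.1.2.2.2 h)
          rw [mem_preimage, this] at hz; exact ht hz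
        · rw [← Set.ncard_coe_finset]
          refine Set.ncard_le_ncard ?_ (Finset.finite_toSet _)
          intro i hi
          rw [Finset.mem_coe, Finset.mem_filter]
          exact ⟨hsup S i hi, hi⟩)
      refine ⟨fun i => ⟨min (c i) k, by omega⟩, fun D hD j hj => ?_⟩
      obtain ⟨i, _, h1, h2⟩ := hc {w | w ⟨D, Finset.mem_insert_of_mem hD⟩} trivial id j hj
      exact ⟨i, h1, by simp only; omega⟩)
  exact ⟨fun i => (g i : ℕ), fun D h1 h2 h3 j hj => hg ⟨D, h1, h2, h3⟩ j hj⟩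


def EpAdd {V : Type*} [TopologicalSpace V] (ψ : Set V → ZMod 2) : Prop :=
  ∀ A B, IsClopen A → IsClopen B → Disjoint A B → ψ (A ∪ B) = ψ A + ψ B

lemma EpAdd.empty {V : Type*} [TopologicalSpace V] {ψ : Set V → ZMod 2} (h : EpAdd ψ) :
    ψ ∅ = 0 := by
  have := h ∅ ∅ isClopen_empty isClopen_empty (by simp)
  simpa using this

lemma EpAdd.inter_sdiff {V : Type*} [TopologicalSpace V] {ψ : Set V → ZMod 2} (h : EpAdd ψ)
    {A B : Set V} (hA : IsClopen A) (hB : IsClopen B) : ψ A = ψ (A ∩ B) + ψ (A \ B) := by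
  rw [← h _ _ (hA.inter hB) (hA.diff hB), inter_union_sdiff]
  rw [Set.disjoint_left]; rintro x ⟨_, h1⟩ ⟨_, h2⟩; exact h2 h1

def EpHNull {V : Type*} [TopologicalSpace V] (ψ : Set V → ZMod 2) (G : Set V) : Prop :=
  ∀ H, IsClopen H → H ⊆ G → ψ H = 0

def epLU {V : Type*} (L : List (Set V)) : Set V := {z | ∃ E ∈ L, z ∈ E}

lemma epLU_nil {V : Type*} : epLU ([] : List (Set V)) = ∅ := by ext; simp [epLU]
lemma epLU_cons {V : Type*} (E : Set V) (L : List (Set V)) : epLU (E :: L) = E ∪ epLU L := by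
  ext; simp [epLU]
lemma epLU_clopen {V : Type*} [TopologicalSpace V] (L : List (Set V)) (h : ∀ E ∈ L, IsClopen E) :
    IsClopen (epLU L) := by
  induction L with
  | nil => rw [epLU_nil]; exact isClopen_empty
  | cons E L ih =>
    rw [epLU_cons]
    exact (h E (by simp)).union (ih fun E' h' => h E' (by simp [h']))

lemma ep_uncross {V : Type*} [TopologicalSpace V] (d : Set V → ℕ)
    (pos : ∀ A B, IsClopen A → IsClopen B → d (A \ B) + d (B \ A) ≤ d A + d B)
    (D : Set V) (c : ℕ) (ψ : Set V → ZMod 2) (hψ : EpAdd ψ)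
    (h0 : ∀ G, IsClopen G → G ⊆ D → d G < c → ψ G = 0) :
    ∀ (n : ℕ) (L : List (Set V)), L.length = n → (∀ G ∈ L, IsClopen G ∧ G ⊆ D ∧ d G < c) →
      ψ (epLU L) = 0 := by
  intro n
  induction n with
  | zero =>
    intro L hL _
    rw [List.length_eq_zero_iff] at hL
    subst hL
    rw [epLU_nil, hψ.empty]
  | succ n ih =>
    suffices H : ∀ (m : ℕ) (E : Set V) (L : List (Set V)), d E = m → L.length = n →
        (IsClopen E ∧ E ⊆ D ∧ d E < c) → (∀ G ∈ L, IsClopen G ∧ G ⊆ D ∧ d G < c) →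
        ψ (E ∪ epLU L) = 0 by
      intro L hL hG
      match L, hL with
      | E :: L, hL =>
        rw [epLU_cons]
        exact H _ E L rfl (by simpa using hL) (hG E (by simp)) (fun G h => hG G (by simp [h]))
    intro m
    induction m using Nat.strong_induction_on with
    | _ m ihm =>
    intro E L hEm hL hE hG
    by_cases hall : ∀ F ∈ L, d (F \ E) ≤ d F
    · have h1 := ih (L.map (fun F => F \ E)) (by simpa using hL) (by
        intro G hG'
        obtain ⟨F, hF, rfl⟩ := List.mem_map.1 hG'
        obtain ⟨g1, g2, g3⟩ := hG F hF
        exact ⟨g1.diff hE.1, sdiff_subset.trans g2, (hall F hF).trans_lt g3⟩)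
      have h2 : epLU (L.map (fun F => F \ E)) = epLU L \ E := by
        ext z; simp only [epLU, List.mem_map, Set.mem_sdiff, mem_ofPred_eq]
        constructor
        · rintro ⟨_, ⟨F, hF, rfl⟩, hz⟩; exact ⟨⟨F, hF, hz.1⟩, hz.2⟩
        · rintro ⟨⟨F, hF, hz⟩, hz2⟩; exact ⟨_, ⟨F, hF, rfl⟩, hz, hz2⟩
      rw [h2] at h1
      rw [← union_sdiff_self, hψ _ _ hE.1 ((epLU_clopen L fun G h => (hG G h).1).diff hE.1)
        disjoint_sdiff_right, h1, h0 E hE.1 hE.2.1 hE.2.2, add_zero]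
    · push Not at hall
      obtain ⟨F, hF, hlt⟩ := hall
      have hp := pos E F hE.1 (hG F hF).1
      have h1 := ihm (d (E \ F)) (by omega) (E \ F) L rfl hL
        ⟨hE.1.diff (hG F hF).1, sdiff_subset.trans hE.2.1, by omega⟩ hG
      have h2 : E \ F ∪ epLU L = E ∪ epLU L := by
        ext z
        simp only [mem_union, Set.mem_sdiff]
        constructor
        · rintro (h | h)
          · exact Or.inl h.1
          · exact Or.inr h
        · rintro (h | h)
          · by_cases hz : z ∈ F
            · exact Or.inr ⟨F, hF, hz⟩
            · exact Or.inl ⟨h, hz⟩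
          · exact Or.inr h
      rwa [h2] at h1

structure EpInv {V : Type*} [TopologicalSpace V] (d : Set V → ℕ) (φ : Set V → ZMod 2)
    (ψ : Set V → ZMod 2) (D : Set V) : Prop where
  clo : IsClopen D
  add : EpAdd ψ
  one : ψ D = 1
  mini : ∀ A, IsClopen A → A ⊆ D → ψ A = 1 → d D ≤ d A
  agree : ∀ A, IsClopen A → A ⊆ D → (∀ G, IsClopen G → EpHNull ψ G → d A ≤ d (A \ G)) → ψ A = φ A

theorem ep_bb_step {V : Type*} [TopologicalSpace V] (d : Set V → ℕ)
    (pos : ∀ A B, IsClopen A → IsClopen B → d (A \ B) + d (B \ A) ≤ d A + d B)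
    (φ ψ : Set V → ZMod 2) (D C : Set V) (hC : IsClopen C) (h : EpInv d φ ψ D) :
    ∃ (θ : Set V → ZMod 2) (D' : Set V), EpInv d φ θ D' ∧ D' ⊆ D ∧ (D' ⊆ C ∨ Disjoint D' C) ∧
      ∀ E, IsClopen E → D' ⊆ E → E ⊆ D → d D ≤ d E := by
  classical
  let Bad := {G : Set V // IsClopen G ∧ G ⊆ D ∧ d G < d D}
  let Un : Finset Bad → Set V := fun Q => epLU (Q.toList.map Subtype.val)
  have hmemUn : ∀ Q : Finset Bad, ∀ G ∈ Q.toList.map Subtype.val,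
      IsClopen G ∧ G ⊆ D ∧ d G < d D := by
    intro Q G hG
    obtain ⟨G', _, rfl⟩ := List.mem_map.1 hG
    exact G'.2
  have hUn : ∀ Q, IsClopen (Un Q) := fun Q => epLU_clopen _ fun G hG => (hmemUn Q G hG).1
  have hbad0 : ∀ G, IsClopen G → G ⊆ D → d G < d D → ψ G = 0 := by
    intro G h1 h2 h3
    rcases epZ_cases (ψ G) with h4 | h4
    · exact h4
    · have := h.mini G h1 h2 h4; omega
  let U : Ultrafilter (Finset Bad) := Ultrafilter.of atTop
  have hU : (U : Filter (Finset Bad)) ≤ atTop := Ultrafilter.of_le _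
  have h1 : ∀ A, ∃ t, ∀ᶠ Q in (U : Filter (Finset Bad)), ψ (A \ Un Q) = t := by
    intro A
    obtain ⟨t, ht⟩ := Ultrafilter.eq_pure_of_finite (U.map (fun Q => ψ (A \ Un Q)))
    refine ⟨t, ?_⟩
    have : ({t} : Set (ZMod 2)) ∈ U.map (fun Q => ψ (A \ Un Q)) := by rw [ht]; exact rfl
    exact this
  choose θ hθ using h1
  have hθu : ∀ A t, (∀ᶠ Q in (U : Filter (Finset Bad)), ψ (A \ Un Q) = t) → θ A = t := by
    intro A t ht
    obtain ⟨Q, h1, h2⟩ := ((hθ A).and ht).exists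
    rw [← h1, h2]
  have hθadd : EpAdd θ := by
    intro A B hA hB hAB
    apply hθu
    filter_upwards [hθ A, hθ B] with Q h1 h2
    rw [← h1, ← h2, union_sdiff_distrib, h.add _ _ (hA.diff (hUn Q)) (hB.diff (hUn Q))]
    exact hAB.mono sdiff_subset sdiff_subset
  have hθbad : ∀ G, IsClopen G → G ⊆ D → d G < d D → EpHNull θ G := by
    intro G h1 h2 h3 H hH hHG
    apply hθu
    have : ∀ᶠ Q in (U : Filter (Finset Bad)), (⟨G, h1, h2, h3⟩ : Bad) ∈ Q := by
      apply hU
      filter_upwards [eventually_ge_atTop ({⟨G, h1, h2, h3⟩} : Finset Bad)] with Q hQ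
      exact hQ (Finset.mem_singleton_self _)
    filter_upwards [this] with Q hQ
    have : H \ Un Q = ∅ := by
      rw [sdiff_eq_empty]
      intro z hz
      exact ⟨G, List.mem_map.2 ⟨_, Finset.mem_toList.2 hQ, rfl⟩, hHG hz⟩
    rw [this, h.add.empty]
  have hθnull : ∀ G, EpHNull ψ G → EpHNull θ G := by
    intro G hG H hH hHG
    apply hθu
    exact Filter.Eventually.of_forall fun Q => hG _ (hH.diff (hUn Q)) (sdiff_subset.trans hHG)
  have hθeq : ∀ A, IsClopen A → (∀ G, IsClopen G → G ⊆ D → d G < d D → ψ (A ∩ G) = 0) →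
      θ A = ψ A := by
    intro A hA h0
    apply hθu
    refine Filter.Eventually.of_forall fun Q => ?_
    have h2 := ep_uncross d pos D (d D) (fun X => ψ (A ∩ X)) (by
      intro X Y hX hY hXY
      simp only
      rw [inter_union_distrib_left, h.add _ _ (hA.inter hX) (hA.inter hY)]
      exact hXY.mono inter_subset_right inter_subset_right) h0 _ _ rfl (hmemUn Q)
    rw [h.add.inter_sdiff hA (hUn Q)]
    change ψ (A ∩ Un Q) = 0 at h2
    rw [h2, zero_add]
  have hθD : θ D = 1 := by
    rw [hθeq D h.clo, h.one]
    intro G h1 h2 h3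
    rw [inter_eq_self_of_subset_right h2, hbad0 G h1 h2 h3]
  obtain ⟨D0, hD0, hD0D, hD0C, hD01⟩ : ∃ D0, IsClopen D0 ∧ D0 ⊆ D ∧ (D0 ⊆ C ∨ Disjoint D0 C) ∧
      θ D0 = 1 := by
    have h2 := hθadd.inter_sdiff h.clo hC
    rcases epZ_cases (θ (D ∩ C)) with h3 | h3
    · rw [h3, hθD, zero_add] at h2
      exact ⟨D \ C, h.clo.diff hC, sdiff_subset, Or.inr disjoint_sdiff_left, h2.symm⟩
    · exact ⟨D ∩ C, h.clo.inter hC, inter_subset_left, Or.inl inter_subset_right, h3⟩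
  obtain ⟨D', ⟨hD', hD'D, hD'1⟩, hmin⟩ := ep_exists_min
    (c := {A | IsClopen A ∧ A ⊆ D0 ∧ θ A = 1}) ⟨D0, hD0, subset_rfl, hD01⟩ d
  refine ⟨θ, D', ⟨hD', hθadd, hD'1, ?_, ?_⟩, hD'D.trans hD0D, ?_, ?_⟩
  · intro A hA hAD h1
    exact hmin A ⟨hA, hAD.trans hD'D, h1⟩
  · intro A hA hAD hG
    have hAD2 : A ⊆ D := hAD.trans (hD'D.trans hD0D)
    rw [← h.agree A hA hAD2 (fun G hGc hGn => hG G hGc (hθnull G hGn))]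
    apply hθeq A hA
    intro G h1 h2 h3
    have h4 := hG G h1 (hθbad G h1 h2 h3)
    have h5 := pos A G hA h1
    have h6 := hbad0 (G \ A) (h1.diff hA) (sdiff_subset.trans h2) (by omega)
    have h7 := h.add.inter_sdiff h1 hA
    rw [hbad0 G h1 h2 h3, h6, add_zero] at h7
    rw [inter_comm, ← h7]
  · rcases hD0C with h1 | h1
    · exact Or.inl (hD'D.trans h1)
    · exact Or.inr (h1.mono_left hD'D)
  · intro E hE hE1 hE2
    by_contra hlt
    push Not at hlt
    have := hθbad E hE hE2 hlt D' hD' hE1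
    rw [hD'1] at this
    exact one_ne_zero this

theorem ep_bb {V : Type*} [TopologicalSpace V] [CompactSpace V]
    (Cs : ℕ → Set V) (hCs : ∀ n, IsClopen (Cs n)) (hCsur : ∀ C, IsClopen C → ∃ n, Cs n = C)
    (d : Set V → ℕ)
    (sub : ∀ A B, IsClopen A → IsClopen B → d (A ∩ B) + d (A ∪ B) ≤ d A + d B)
    (pos : ∀ A B, IsClopen A → IsClopen B → d (A \ B) + d (B \ A) ≤ d A + d B)
    (φ : Set V → ZMod 2) (hφ : EpAdd φ) (D : Set V) (hD : IsClopen D) (hD1 : φ D = 1) :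
    ∃ v, ∀ C, IsClopen C → v ∈ C → ∃ A, IsClopen A ∧ v ∈ A ∧ A ⊆ C ∧ φ A = 1 ∧
      ∀ E, IsClopen E → v ∈ E → E ⊆ A → d A ≤ d E := by
  classical
  let St := {p : (Set V → ZMod 2) × Set V // EpInv d φ p.1 p.2}
  have hstep : ∀ (n : ℕ) (p : St), ∃ p' : St, p'.1.2 ⊆ p.1.2 ∧
      (p'.1.2 ⊆ Cs n ∨ Disjoint p'.1.2 (Cs n)) ∧
      ∀ E, IsClopen E → p'.1.2 ⊆ E → E ⊆ p.1.2 → d p.1.2 ≤ d E := by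
    intro n p
    obtain ⟨θ, D', h1, h2⟩ := ep_bb_step d pos φ p.1.1 p.1.2 (Cs n) (hCs n) p.2
    exact ⟨⟨(θ, D'), h1⟩, h2⟩
  choose step hs1 hs2 hs3 using hstep
  obtain ⟨D0, ⟨hD0, hD0D, hD01⟩, hmin⟩ := ep_exists_min
    (c := {A | IsClopen A ∧ A ⊆ D ∧ φ A = 1}) ⟨D, hD, subset_rfl, hD1⟩ d
  let p0 : St := ⟨(φ, D0), hD0, hφ, hD01, fun A hA hAD h1 => hmin A ⟨hA, hAD.trans hD0D, h1⟩,
    fun A _ _ _ => rfl⟩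
  let p : ℕ → St := fun n => Nat.rec p0 (fun n q => step n q) n
  have hp : ∀ n, p (n + 1) = step n (p n) := fun n => rfl
  let Ds : ℕ → Set V := fun n => (p n).1.2
  have hanti : Antitone Ds := antitone_nat_of_succ_le fun n => hs1 n (p n)
  have hclo : ∀ n, IsClopen (Ds n) := fun n => (p n).2.clo
  have hkey : ∀ r n E, IsClopen E → Ds (n + r) ⊆ E → E ⊆ Ds n → d (Ds n) ≤ d E := by
    intro r
    induction r with
    | zero =>
      intro n E _ h1 h2
      rw [Subset.antisymm h2 h1]
    | succ r ih =>
      intro n E hE h1 h2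
      have e1 : Ds (n + 1 + r) ⊆ E := by
        have : n + 1 + r = n + (r + 1) := by ring
        rw [this]; exact h1
      have h3 := ih (n + 1) (E ∩ Ds (n + 1)) (hE.inter (hclo (n + 1)))
        (subset_inter e1 (hanti (Nat.le_add_right (n + 1) r))) inter_subset_right
      have h4 := hs3 n (p n) (E ∪ Ds (n + 1)) (hE.union (hclo (n + 1))) subset_union_right
        (union_subset h2 (hanti (Nat.le_succ n)))
      have h5 := sub E (Ds (n + 1)) hE (hclo (n + 1))
      change d (Ds n) ≤ _ at h4
      omega
  have hne : ∀ n, (Ds n).Nonempty := by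
    intro n
    rw [nonempty_iff_ne_empty]
    intro h
    have h1 := (p n).2.one
    change (p n).1.1 (Ds n) = 1 at h1
    rw [h, (p n).2.add.empty] at h1
    exact zero_ne_one h1
  obtain ⟨v, hv⟩ := IsCompact.nonempty_iInter_of_sequence_nonempty_isCompact_isClosed Ds
    (fun n => hanti (Nat.le_succ n)) hne (hclo 0).isClosed.isCompact (fun n => (hclo n).isClosed)
  rw [mem_iInter] at hv
  have hsub : ∀ C, IsClopen C → v ∈ C → ∃ n, Ds (n + 1) ⊆ C := by
    intro C hC hvC
    obtain ⟨n, rfl⟩ := hCsur C hC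
    refine ⟨n, ?_⟩
    rcases hs2 n (p n) with h1 | h1
    · exact h1
    · exact absurd hvC (Set.disjoint_left.1 h1 (hv (n + 1)))
  refine ⟨v, fun C hC hvC => ?_⟩
  obtain ⟨n, hn⟩ := hsub C hC hvC
  refine ⟨Ds (n + 1), hclo (n + 1), hv (n + 1), hn, ?_, ?_⟩
  · have hI := (p (n + 1)).2
    rw [← hI.agree (Ds (n + 1)) (hclo (n + 1)) subset_rfl ?_]
    · exact hI.one
    · intro G hG hGn
      apply hI.mini _ ((hclo (n + 1)).diff hG) sdiff_subset
      have h1 := hI.add.inter_sdiff (hclo (n + 1)) hG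
      rw [hGn _ ((hclo (n + 1)).inter hG) inter_subset_right, zero_add] at h1
      rw [← h1]; exact hI.one
  · intro E hE hvE hEA
    obtain ⟨m, hm⟩ := hsub E hE hvE
    exact hkey (m + 1) (n + 1) E hE ((hanti (show m + 1 ≤ n + 1 + (m + 1) by omega)).trans hm) hEA


structure EpPar {X : Type*} [TopologicalSpace X] (V : Set X) {E : Type*} (γ : E → ℝ → X) : Prop where
  cont : ∀ e, Continuous (γ e)
  zero : ∀ e, γ e 0 ∈ V
  one : ∀ e, γ e 1 ∈ V
  ioo : ∀ e, ∀ t ∈ Ioo (0:ℝ) 1, γ e t ∉ V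
  inj : ∀ e e', ∀ t ∈ Ioo (0:ℝ) 1, ∀ t' ∈ Ioo (0:ℝ) 1, γ e t = γ e' t' → e = e' ∧ t = t'
  surj : ∀ x, x ∉ V → ∃ e, ∃ t ∈ Ioo (0:ℝ) 1, γ e t = x
  opn : ∀ e U, IsOpen U → U ⊆ Ioo (0:ℝ) 1 → IsOpen (γ e '' U)
  few : ∀ O, IsOpen O → V ⊆ O → {e | ∃ t ∈ Icc (0:ℝ) 1, γ e t ∉ O}.Finite

/-- clopen subset of the subspace `V` with separating open sets of the ambient space. -/
lemma ep_sepOpen {X : Type*} [TopologicalSpace X] [CompactSpace X] [T2Space X] (V : Set X)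
    (hV : IsClosed V) (A : Set V) (hA : IsClopen A) (U : Set X) (hU : IsOpen U)
    (hAU : Subtype.val '' A ⊆ U) :
    ∃ O1 O2 : Set X, IsOpen O1 ∧ IsOpen O2 ∧ Disjoint O1 O2 ∧ O1 ⊆ U ∧
      (∀ z : V, z ∈ A → (z:X) ∈ O1) ∧ (∀ z : V, z ∉ A → (z:X) ∈ O2) := by
  have c1 : IsClosed (Subtype.val '' A) := hV.isClosedEmbedding_subtypeVal.isClosedMap _ hA.isClosed
  have c2 : IsClosed (Subtype.val '' Aᶜ) :=
    hV.isClosedEmbedding_subtypeVal.isClosedMap _ hA.compl.isClosed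
  have hd : Disjoint (Subtype.val '' A) (Subtype.val '' Aᶜ) :=
    (disjoint_image_iff Subtype.val_injective).2 disjoint_compl_right
  obtain ⟨O1, O2, h1, h2, h3, h4, h5⟩ := SeparatedNhds.of_isCompact_isCompact c1.isCompact c2.isCompact hd
  refine ⟨O1 ∩ U, O2, h1.inter hU, h2, h5.mono_left inter_subset_left, inter_subset_right, ?_, ?_⟩
  · intro z hz; exact ⟨h3 ⟨z, hz, rfl⟩, hAU ⟨z, hz, rfl⟩⟩
  · intro z hz; exact h4 ⟨z, hz, rfl⟩

lemma ep_clopenNhd {X : Type*} [TopologicalSpace X] [CompactSpace X] [T2Space X] (V : Set X)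
    (hV : IsClosed V) [TotallyDisconnectedSpace V] (p : V) (U : Set X) (hU : IsOpen U)
    (hp : (p : X) ∈ U) : ∃ A : Set V, IsClopen A ∧ p ∈ A ∧ Subtype.val '' A ⊆ U := by
  have : CompactSpace V := isCompact_iff_compactSpace.1 hV.isCompact
  obtain ⟨A, hA, hpA, hAU⟩ := compact_exists_isClopen_in_isOpen
    (hU.preimage continuous_subtype_val) hp
  exact ⟨A, hA, hpA, by rwa [image_subset_iff]⟩

lemma ep_lim {X : Type*} [TopologicalSpace X] [CompactSpace X] [T2Space X] (V : Set X)
    (hV : IsClosed V) [TotallyDisconnectedSpace V] (c : ℝ → X) (hc : ContinuousOn c (Ioo 0 1))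
    (hO : ∀ O, IsOpen O → V ⊆ O → ∃ δ > 0, δ < 1 ∧ ∀ t ∈ Ioo (0:ℝ) δ, c t ∈ O) :
    ∃ p ∈ V, Tendsto c (𝓝[>] 0) (𝓝 p) := by
  obtain ⟨p, hp⟩ := exists_clusterPt_of_compactSpace (map c (𝓝[>] (0:ℝ)))
  have hfreq : ∀ N ∈ 𝓝 p, ∃ᶠ t in 𝓝[>] (0:ℝ), c t ∈ N := by
    intro N hN
    exact (mapClusterPt_iff_frequently (F := 𝓝[>] (0:ℝ)) (u := c)).1 hp N hN
  have hev : ∀ O, IsOpen O → V ⊆ O → ∀ᶠ t in 𝓝[>] (0:ℝ), c t ∈ O := by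
    intro O h1 h2
    obtain ⟨δ, hδ, _, h⟩ := hO O h1 h2
    filter_upwards [Ioo_mem_nhdsGT hδ] with t ht using h t ht
  have hpV : p ∈ V := by
    by_contra hpV
    obtain ⟨O1, O2, h1, h2, h3, h4, h5⟩ :=
      SeparatedNhds.of_isCompact_isCompact hV.isCompact (isCompact_singleton (x := p))
        (by rw [Set.disjoint_singleton_right]; exact hpV)
    obtain ⟨t, ht1, ht2⟩ := ((hfreq O2 (h2.mem_nhds (h4 rfl))).and_eventually (hev O1 h1 h3)).exists
    exact Set.disjoint_left.1 h5 ht2 ht1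
  refine ⟨p, hpV, ?_⟩
  rw [tendsto_nhds]
  intro U hU hpU
  obtain ⟨A, hA, hpA, hAU⟩ := ep_clopenNhd V hV ⟨p, hpV⟩ U hU hpU
  obtain ⟨O1, O2, h1, h2, h3, h4, h5, h6⟩ := ep_sepOpen V hV A hA U hU hAU
  obtain ⟨δ, hδ, hδ1, hδO⟩ := hO (O1 ∪ O2) (h1.union h2) (fun z hz => by
    by_cases h : (⟨z, hz⟩ : V) ∈ A
    · exact Or.inl (h5 _ h)
    · exact Or.inr (h6 _ h))
  have hpre : IsPreconnected (c '' Ioo 0 δ) :=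
    isPreconnected_Ioo.image c (hc.mono (Ioo_subset_Ioo_right hδ1.le))
  obtain ⟨t, ht1, ht2⟩ := ((hfreq O1 (h1.mem_nhds (h5 _ hpA))).and_eventually
    (Ioo_mem_nhdsGT hδ)).exists
  have hsub := hpre.subset_left_of_subset_union h1 h2 h3
    (show c '' Ioo 0 δ ⊆ O1 ∪ O2 by rintro _ ⟨t, ht, rfl⟩; exact hδO t ht)
    (show (c '' Ioo 0 δ ∩ O1).Nonempty from ⟨c t, ⟨t, ht2, rfl⟩, ht1⟩)
  filter_upwards [Ioo_mem_nhdsGT hδ] with t ht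
  exact h4 (hsub ⟨t, ht, rfl⟩)

set_option maxHeartbeats 1000000 in
theorem ep_exists_par {X : Type*} [TopologicalSpace X] [CompactSpace X] [T2Space X] (V : Set X)
    (hV : IsClosed V) [TotallyDisconnectedSpace V] (E : Type*) [TopologicalSpace E]
    [DiscreteTopology E] (h : (Vᶜ : Set X) ≃ₜ (E × ↥(Set.Ioo (0 : ℝ) 1))) :
    ∃ γ : E → ℝ → X, EpPar V γ := by
  classical
  by_cases hE : IsEmpty E
  · refine ⟨fun e => isEmptyElim e, fun e => isEmptyElim e, fun e => isEmptyElim e,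
      fun e => isEmptyElim e, fun e => isEmptyElim e, fun e => isEmptyElim e, ?_,
      fun e => isEmptyElim e, ?_⟩
    · intro x hx; exact isEmptyElim (h ⟨x, hx⟩).1
    · intro O _ _; exact Set.toFinite _
  rw [not_isEmpty_iff] at hE
  obtain ⟨e0⟩ := hE
  let x0 : X := (h.symm (e0, ⟨1/2, by norm_num, by norm_num⟩)).1
  let g : E → ℝ → X := fun e t => if ht : t ∈ Ioo (0:ℝ) 1 then (h.symm (e, ⟨t, ht⟩)).1 else x0
  have hg : ∀ e t (ht : t ∈ Ioo (0:ℝ) 1), g e t = (h.symm (e, ⟨t, ht⟩)).1 := by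
    intro e t ht; simp only [g, dif_pos ht]
  have hgc : ∀ e, ContinuousOn (g e) (Ioo 0 1) := by
    intro e
    rw [continuousOn_iff_continuous_domRestrict]
    have : (Ioo (0:ℝ) 1).domRestrict (g e) = fun t => (h.symm (e, t)).1 := by
      funext t; exact hg e t t.2
    rw [this]
    exact continuous_subtype_val.comp (h.symm.continuous.comp (by fun_prop))
  have hgopn : ∀ e U, IsOpen U → U ⊆ Ioo (0:ℝ) 1 → IsOpen (g e '' U) := by
    intro e U hU hUs
    have : g e '' U = Subtype.val '' (h.symm '' (({e} : Set E) ×ˢ (Subtype.val ⁻¹' U))) := by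
      ext x
      constructor
      · rintro ⟨t, ht, rfl⟩
        exact ⟨_, ⟨(e, ⟨t, hUs ht⟩), ⟨rfl, ht⟩, rfl⟩, (hg e t (hUs ht)).symm⟩
      · rintro ⟨_, ⟨⟨e', t⟩, ⟨he, ht⟩, rfl⟩, rfl⟩
        simp only [mem_singleton_iff] at he
        subst he
        exact ⟨t, ht, hg _ t t.2⟩
    rw [this]
    apply hV.isOpen_compl.isOpenMap_subtype_val
    apply h.symm.isOpenMap
    exact (isOpen_discrete _).prod (hU.preimage continuous_subtype_val)
  have hK : ∀ O, IsOpen O → V ⊆ O → ∃ T : Set E, T.Finite ∧ ∃ δ > 0, δ < 1 ∧ ∀ e,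
      ∀ t ∈ Ioo (0:ℝ) 1, g e t ∉ O → e ∈ T ∧ δ ≤ t ∧ t ≤ 1 - δ := by
    intro O hO hVO
    have hC : IsCompact (Subtype.val ⁻¹' Oᶜ : Set (Vᶜ : Set X)) := by
      rw [Subtype.isCompact_iff, Subtype.image_preimage_coe, inter_eq_right.2 (compl_subset_compl.2 hVO)]
      exact hO.isClosed_compl.isCompact
    have hC2 := hC.image h.continuous
    have hT := (hC2.image continuous_fst).finite_of_discrete
    have hR := hC2.image (continuous_subtype_val.comp continuous_snd)
    set R := (Subtype.val ∘ Prod.snd) '' (h '' (Subtype.val ⁻¹' Oᶜ)) with hRdef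
    have hRsub : R ⊆ Ioo (0:ℝ) 1 := by rintro _ ⟨q, _, rfl⟩; exact q.2.2
    have hδ : ∃ δ > 0, δ < 1 ∧ ∀ t ∈ R, δ ≤ t ∧ t ≤ 1 - δ := by
      by_cases hne : R.Nonempty
      · obtain ⟨m, hm, hmin⟩ := hR.exists_isLeast hne
        obtain ⟨M, hM, hmax⟩ := hR.exists_isGreatest hne
        have h1 := hRsub hm
        have h2 := hRsub hM
        refine ⟨min m (1 - M), lt_min h1.1 (by linarith [h2.2]), (min_le_left _ _).trans_lt h1.2, ?_⟩
        intro t ht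
        have := hmin ht
        have := hmax ht
        have := min_le_left m (1 - M)
        have := min_le_right m (1 - M)
        constructor <;> linarith
      · rw [not_nonempty_iff_eq_empty] at hne
        exact ⟨1/2, by norm_num, by norm_num, by simp [hne]⟩
    obtain ⟨δ, hδ0, hδ1, hδ⟩ := hδ
    refine ⟨_, hT, δ, hδ0, hδ1, fun e t ht hO => ?_⟩
    have hmem : ((e, ⟨t, ht⟩) : E × Ioo (0:ℝ) 1) ∈ h '' (Subtype.val ⁻¹' Oᶜ) := by
      refine ⟨h.symm (e, ⟨t, ht⟩), ?_, h.apply_symm_apply _⟩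
      rw [mem_preimage, ← hg]; exact hO
    exact ⟨⟨_, hmem, rfl⟩, hδ t ⟨_, hmem, rfl⟩⟩
  have hl0 : ∀ e, ∃ p ∈ V, Tendsto (g e) (𝓝[>] 0) (𝓝 p) := by
    intro e
    refine ep_lim V hV (g e) (hgc e) fun O h1 h2 => ?_
    obtain ⟨T, _, δ, hδ, hδ1, hh⟩ := hK O h1 h2
    refine ⟨δ, hδ, hδ1, fun t ht => ?_⟩
    by_contra hcon
    have := (hh e t ⟨ht.1, ht.2.trans hδ1⟩ hcon).2.1
    exact absurd ht.2 (not_lt.2 this)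
  have hl1 : ∀ e, ∃ p ∈ V, Tendsto (g e) (𝓝[<] 1) (𝓝 p) := by
    intro e
    obtain ⟨p, hp, ht⟩ := ep_lim V hV (fun t => g e (1 - t)) ((hgc e).comp (by fun_prop)
      (fun t ht => ⟨by linarith [ht.2], by linarith [ht.1]⟩)) (fun O h1 h2 => by
        obtain ⟨T, _, δ, hδ, hδ1, hh⟩ := hK O h1 h2
        refine ⟨δ, hδ, hδ1, fun t ht => ?_⟩
        by_contra hcon
        have := (hh e (1 - t) ⟨by linarith [ht.2], by linarith [ht.1]⟩ hcon).2.2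
        exact absurd ht.2 (not_lt.2 (by linarith)))
    refine ⟨p, hp, ?_⟩
    have h2 : Tendsto (fun t : ℝ => 1 - t) (𝓝[<] 1) (𝓝[>] 0) := by
      refine tendsto_nhdsWithin_iff.2 ⟨?_, ?_⟩
      · have : Tendsto (fun t : ℝ => 1 - t) (𝓝 1) (𝓝 (1 - 1)) := by
          exact (continuous_const.sub continuous_id).tendsto 1
        rw [sub_self] at this
        exact this.mono_left nhdsWithin_le_nhds
      · filter_upwards [self_mem_nhdsWithin] with t ht
        have h5 : t < 1 := ht
        show (0:ℝ) < 1 - t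
        linarith
    have h3 := ht.comp h2
    refine h3.congr fun t => ?_
    simp
  choose p0 hp0 ht0 using hl0
  choose p1 hp1 ht1 using hl1
  let G : E → ℝ → X := fun e => extendFrom (Ioo 0 1) (g e)
  have hGc : ∀ e, ContinuousOn (G e) (Icc 0 1) := fun e =>
    continuousOn_Icc_extendFrom_Ioo (hgc e) (ht0 e) (ht1 e)
  have hG0 : ∀ e, G e 0 = p0 e := fun e => eq_lim_at_left_extendFrom_Ioo zero_lt_one (ht0 e)
  have hG1 : ∀ e, G e 1 = p1 e := fun e => eq_lim_at_right_extendFrom_Ioo zero_lt_one (ht1 e)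
  have hGi : ∀ e, ∀ t ∈ Ioo (0:ℝ) 1, G e t = g e t := fun e t ht =>
    extendFrom_extends (hgc e) t ht
  let γ : E → ℝ → X := fun e t => G e (max 0 (min 1 t))
  have hγ : ∀ e, ∀ t ∈ Icc (0:ℝ) 1, γ e t = G e t := fun e t ht => by
    show G e (max 0 (min 1 t)) = G e t
    rw [min_eq_right ht.2, max_eq_right ht.1]
  have hγi : ∀ e, ∀ t ∈ Ioo (0:ℝ) 1, γ e t = g e t := fun e t ht => by
    rw [hγ e t (Ioo_subset_Icc_self ht), hGi e t ht]
  have hγ0 : ∀ e, γ e 0 ∈ V := fun e => by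
    rw [hγ e 0 (by simp), hG0]; exact hp0 e
  have hγ1 : ∀ e, γ e 1 ∈ V := fun e => by
    rw [hγ e 1 (by simp), hG1]; exact hp1 e
  refine ⟨γ, ?_, hγ0, hγ1, ?_, ?_, ?_, ?_, ?_⟩
  · intro e
    exact (hGc e).comp_continuous (by fun_prop) (fun t => ⟨le_max_left _ _, max_le zero_le_one (min_le_left _ _)⟩)
  · intro e t ht
    rw [hγi e t ht, hg e t ht]
    exact (h.symm (e, ⟨t, ht⟩)).2
  · intro e e' t ht t' ht' heq
    rw [hγi e t ht, hγi e' t' ht', hg e t ht, hg e' t' ht'] at heq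
    have := h.symm.injective (Subtype.ext heq)
    simpa using this
  · intro x hx
    refine ⟨(h ⟨x, hx⟩).1, (h ⟨x, hx⟩).2.1, (h ⟨x, hx⟩).2.2, ?_⟩
    rw [hγi _ _ (h ⟨x, hx⟩).2.2, hg _ _ (h ⟨x, hx⟩).2.2]
    simp
  · intro e U hU hUs
    have : γ e '' U = g e '' U := image_congr fun t ht => hγi e t (hUs ht)
    rw [this]; exact hgopn e U hU hUs
  · intro O hO hVO
    obtain ⟨T, hT, δ, _, _, hh⟩ := hK O hO hVO
    refine hT.subset ?_
    rintro e ⟨t, ht, htO⟩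
    rcases eq_or_lt_of_le ht.1 with h0 | h0
    · rw [← h0] at htO; exact absurd (hVO (hγ0 e)) htO
    rcases eq_or_lt_of_le ht.2 with h1 | h1
    · rw [h1] at htO; exact absurd (hVO (hγ1 e)) htO
    rw [hγi e t ⟨h0, h1⟩] at htO
    exact (hh e t ⟨h0, h1⟩ htO).1


def epA {X : Type*} [TopologicalSpace X] {V : Set X} {E : Type*} {γ : E → ℝ → X}
    (hp : EpPar V γ) (e : E) : V := ⟨γ e 0, hp.zero e⟩
def epB {X : Type*} [TopologicalSpace X] {V : Set X} {E : Type*} {γ : E → ℝ → X}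
    (hp : EpPar V γ) (e : E) : V := ⟨γ e 1, hp.one e⟩

lemma ep_side {X : Type*} [TopologicalSpace X] [CompactSpace X] [T2Space X] {V : Set X}
    (hV : IsClosed V) {E : Type*} {γ : E → ℝ → X} (hp : EpPar V γ) (A : Set V) (hA : IsClopen A)
    (U : Set X) (hU : IsOpen U) (hAU : Subtype.val '' A ⊆ U) :
    ∃ T : Set E, T.Finite ∧ ∀ e, e ∉ T →
      ((∀ t ∈ Icc (0:ℝ) 1, γ e t ∈ U) ∧ epA hp e ∈ A ∧ epB hp e ∈ A) ∨
      (epA hp e ∉ A ∧ epB hp e ∉ A) := by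
  obtain ⟨O1, O2, h1, h2, h3, h4, h5, h6⟩ := ep_sepOpen V hV A hA U hU hAU
  refine ⟨_, hp.few (O1 ∪ O2) (h1.union h2) (fun z hz => ?_), fun e he => ?_⟩
  · by_cases h : (⟨z, hz⟩ : V) ∈ A
    · exact Or.inl (h5 _ h)
    · exact Or.inr (h6 _ h)
  have hsub : γ e '' Icc 0 1 ⊆ O1 ∪ O2 := by
    rintro _ ⟨t, ht, rfl⟩
    by_contra hc
    exact he ⟨t, ht, hc⟩
  have hpre : IsPreconnected (γ e '' Icc 0 1) :=
    isPreconnected_Icc.image _ (hp.cont e).continuousOn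
  have z0 : (0:ℝ) ∈ Icc (0:ℝ) 1 := by simp
  have z1 : (1:ℝ) ∈ Icc (0:ℝ) 1 := by simp
  have key : ∀ z : V, (z:X) ∈ O1 → z ∈ A := by
    intro z hz; by_contra hc
    exact Set.disjoint_left.1 h3 hz (h6 z hc)
  have key2 : ∀ z : V, (z:X) ∈ O2 → z ∉ A := by
    intro z hz hc
    exact Set.disjoint_left.1 h3 (h5 z hc) hz
  rcases hsub ⟨0, z0, rfl⟩ with h | h
  · left
    have hs := hpre.subset_left_of_subset_union h1 h2 h3 hsub ⟨_, ⟨0, z0, rfl⟩, h⟩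
    exact ⟨fun t ht => h4 (hs ⟨t, ht, rfl⟩), key _ h, key _ (hs ⟨1, z1, rfl⟩)⟩
  · right
    have hs := hpre.subset_right_of_subset_union h1 h2 h3 hsub ⟨_, ⟨0, z0, rfl⟩, h⟩
    exact ⟨key2 _ h, key2 _ (hs ⟨1, z1, rfl⟩)⟩

lemma ep_cutFin {X : Type*} [TopologicalSpace X] [CompactSpace X] [T2Space X] {V : Set X}
    (hV : IsClosed V) {E : Type*} {γ : E → ℝ → X} (hp : EpPar V γ) (A : Set V) (hA : IsClopen A) :
    (support (epChi (epA hp) (epB hp) A)).Finite := by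
  obtain ⟨T, hT, h⟩ := ep_side hV hp A hA univ isOpen_univ (subset_univ _)
  refine hT.subset fun e he => ?_
  by_contra hc
  apply he
  rw [epChi_eq_zero_iff]
  rcases h e hc with h | h
  · exact ⟨fun _ => h.2.2, fun _ => h.2.1⟩
  · exact ⟨fun g => absurd g h.1, fun g => absurd g h.2⟩

lemma ep_nbhd {X : Type*} [TopologicalSpace X] [CompactSpace X] [T2Space X] {V : Set X}
    (hV : IsClosed V) [TotallyDisconnectedSpace V] {E : Type*} {γ : E → ℝ → X} (hp : EpPar V γ)
    (p : V) (U : Set X) (hU : IsOpen U) (hpU : (p : X) ∈ U) :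
    ∃ A : Set V, IsClopen A ∧ p ∈ A ∧ (∀ z ∈ A, (z : X) ∈ U) ∧
    ∃ T : Set E, T.Finite ∧ ∀ e, e ∉ T →
      ((∀ t ∈ Icc (0:ℝ) 1, γ e t ∈ U) ∧ epA hp e ∈ A ∧ epB hp e ∈ A) ∨
      (epA hp e ∉ A ∧ epB hp e ∉ A) := by
  obtain ⟨A, hA, hpA, hAU⟩ := ep_clopenNhd V hV p U hU hpU
  exact ⟨A, hA, hpA, fun z hz => hAU ⟨z, hz, rfl⟩, ep_side hV hp A hA U hU hAU⟩

lemma ep_isEdge {X : Type*} [TopologicalSpace X] (G : GraphLike X) {E : Type*} {γ : E → ℝ → X}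
    (hp : EpPar G.V γ) (s : Set X) : G.IsEdge s ↔ ∃ e, s = γ e '' Ioo (0:ℝ) 1 := by
  have key : ∀ e, ∀ t ∈ Ioo (0:ℝ) 1,
      connectedComponentIn (G.V)ᶜ (γ e t) = γ e '' Ioo (0:ℝ) 1 := by
    intro e t ht
    apply Subset.antisymm
    · let O2 : Set X := ⋃ e' ∈ {e' | e' ≠ e}, γ e' '' Ioo (0:ℝ) 1
      have hO2 : IsOpen O2 := isOpen_biUnion fun e' _ => hp.opn e' _ isOpen_Ioo subset_rfl
      refine IsPreconnected.subset_left_of_subset_union (hp.opn e _ isOpen_Ioo subset_rfl) hO2 ?_ ?_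
        ?_ isPreconnected_connectedComponentIn
      · rw [Set.disjoint_left]
        rintro _ ⟨t, ht, rfl⟩ h2
        simp only [O2, mem_iUnion] at h2
        obtain ⟨e', he', t', ht', heq⟩ := h2
        exact he' (hp.inj _ _ _ ht' _ ht heq).1
      · intro z hz
        obtain ⟨e', t', ht', rfl⟩ := hp.surj z (connectedComponentIn_subset _ _ hz)
        by_cases h : e' = e
        · left; rw [← h]; exact ⟨t', ht', rfl⟩
        · right; simp only [O2, mem_iUnion]; exact ⟨e', h, t', ht', rfl⟩
      · exact ⟨γ e t, mem_connectedComponentIn (hp.ioo e t ht), t, ht, rfl⟩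
    · refine IsPreconnected.subset_connectedComponentIn
        (isPreconnected_Ioo.image _ (hp.cont e).continuousOn) ⟨t, ht, rfl⟩ ?_
      rintro _ ⟨t, ht, rfl⟩; exact hp.ioo e t ht
  constructor
  · rintro ⟨x, hx, rfl⟩
    obtain ⟨e, t, ht, rfl⟩ := hp.surj x hx
    exact ⟨e, key e t ht⟩
  · rintro ⟨e, rfl⟩
    have h : (1/2:ℝ) ∈ Ioo (0:ℝ) 1 := by norm_num
    exact ⟨γ e (1/2), hp.ioo e _ h, (key e _ h).symm⟩

lemma ep_countable {X : Type*} [TopologicalSpace X] [TopologicalSpace.SeparableSpace X] {V : Set X}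
    {E : Type*} {γ : E → ℝ → X} (hp : EpPar V γ) : Countable E := by
  refine Pairwise.countable_of_isOpen_disjoint (s := fun e => γ e '' Ioo (0:ℝ) 1) ?_
    (fun e => hp.opn e _ isOpen_Ioo subset_rfl) (fun e => (nonempty_Ioo.2 zero_lt_one).image _)
  intro e e' hne
  show Disjoint _ _
  rw [Set.disjoint_left]
  rintro _ ⟨t, ht, rfl⟩ ⟨t', ht', heq⟩
  exact hne (hp.inj _ _ _ ht' _ ht heq).1.symm


lemma ep_run_mono {X : Type*} [TopologicalSpace X] [T2Space X] (f g : ℝ → X) (hf : Continuous f)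
    (hg : Continuous g) (s : ℝ → ℝ) (c d : ℝ) (hcd : c < d) (hs : MonotoneOn s (Ioo c d))
    (hsc : ContinuousOn s (Ioo c d)) (hsm : ∀ t ∈ Ioo c d, s t ∈ Ioo (0:ℝ) 1)
    (hfg : ∀ t ∈ Ioo c d, f t = g (s t)) (hc : f c ∉ g '' Ioo 0 1) (hd : f d ∉ g '' Ioo 0 1) :
    f c = g 0 ∧ f d = g 1 ∧ Ioo (0:ℝ) 1 ⊆ s '' Ioo c d := by
  have hne : (Ioo c d).Nonempty := nonempty_Ioo.2 hcd
  have bb : BddBelow (s '' Ioo c d) := ⟨0, by rintro _ ⟨t, ht, rfl⟩; exact (hsm t ht).1.le⟩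
  have ba : BddAbove (s '' Ioo c d) := ⟨1, by rintro _ ⟨t, ht, rfl⟩; exact (hsm t ht).2.le⟩
  have l0 := hs.tendsto_nhdsWithin_Ioo_right hne bb
  have l1 := hs.tendsto_nhdsWithin_Ioo_left hne ba
  obtain ⟨t0, ht0⟩ := hne
  have i0 : 0 ≤ sInf (s '' Ioo c d) :=
    le_csInf ⟨_, t0, ht0, rfl⟩ (by rintro _ ⟨t, ht, rfl⟩; exact (hsm t ht).1.le)
  have i1 : sSup (s '' Ioo c d) ≤ 1 :=
    csSup_le ⟨_, t0, ht0, rfl⟩ (by rintro _ ⟨t, ht, rfl⟩; exact (hsm t ht).2.le)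
  have i2 : sInf (s '' Ioo c d) < 1 := (csInf_le bb ⟨t0, ht0, rfl⟩).trans_lt (hsm t0 ht0).2
  have i3 : 0 < sSup (s '' Ioo c d) := (hsm t0 ht0).1.trans_le (le_csSup ba ⟨t0, ht0, rfl⟩)
  have e0 : f c = g (sInf (s '' Ioo c d)) := by
    have h1 : Tendsto f (𝓝[>] c) (𝓝 (f c)) := hf.continuousAt.mono_left nhdsWithin_le_nhds
    have h2 : Tendsto (fun t => g (s t)) (𝓝[>] c) (𝓝 (g (sInf (s '' Ioo c d)))) :=
      (hg.tendsto _).comp l0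
    refine tendsto_nhds_unique h1 (h2.congr' ?_)
    filter_upwards [Ioo_mem_nhdsGT hcd] with t ht using (hfg t ht).symm
  have e1 : f d = g (sSup (s '' Ioo c d)) := by
    have h1 : Tendsto f (𝓝[<] d) (𝓝 (f d)) := hf.continuousAt.mono_left nhdsWithin_le_nhds
    have h2 : Tendsto (fun t => g (s t)) (𝓝[<] d) (𝓝 (g (sSup (s '' Ioo c d)))) :=
      (hg.tendsto _).comp l1
    refine tendsto_nhds_unique h1 (h2.congr' ?_)
    filter_upwards [Ioo_mem_nhdsLT hcd] with t ht using (hfg t ht).symm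
  have z0 : sInf (s '' Ioo c d) = 0 := by
    by_contra h
    exact hc ⟨_, ⟨lt_of_le_of_ne i0 (Ne.symm h), i2⟩, e0.symm⟩
  have z1 : sSup (s '' Ioo c d) = 1 := by
    by_contra h
    exact hd ⟨_, ⟨i3, lt_of_le_of_ne i1 h⟩, e1.symm⟩
  refine ⟨by rw [e0, z0], by rw [e1, z1], fun r hr => ?_⟩
  obtain ⟨_, ⟨t1, ht1, rfl⟩, h1⟩ := exists_lt_of_csInf_lt (s := s '' Ioo c d) ⟨_, t0, ht0, rfl⟩
    (by rw [z0]; exact hr.1)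
  obtain ⟨_, ⟨t2, ht2, rfl⟩, h2⟩ := exists_lt_of_lt_csSup (s := s '' Ioo c d) ⟨_, t0, ht0, rfl⟩
    (by rw [z1]; exact hr.2)
  exact (isPreconnected_Ioo.image s hsc).ordConnected.out ⟨t1, ht1, rfl⟩ ⟨t2, ht2, rfl⟩
    ⟨h1.le, h2.le⟩

theorem ep_run {X : Type*} [TopologicalSpace X] [T2Space X] {V : Set X}
    {E : Type*} {γ : E → ℝ → X} (hp : EpPar V γ) (f : ℝ → X) (hf : Continuous f) (a b : ℝ)
    (hfa : f a ∈ V) (hfb : f b ∈ V) (e : E)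
    (hinj : InjOn f (Icc a b ∩ f ⁻¹' (γ e '' Ioo (0:ℝ) 1)))
    (t0 : ℝ) (ht0 : t0 ∈ Icc a b) (hft : f t0 ∈ γ e '' Ioo (0:ℝ) 1) :
    ∃ c d, a ≤ c ∧ c < d ∧ d ≤ b ∧ (∀ t ∈ Icc a b, f t ∈ γ e '' Ioo (0:ℝ) 1 ↔ t ∈ Ioo c d) ∧
      γ e '' Ioo (0:ℝ) 1 ⊆ f '' Ioo c d ∧
      ((f c = γ e 0 ∧ f d = γ e 1) ∨ (f c = γ e 1 ∧ f d = γ e 0)) := by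
  classical
  set O := γ e '' Ioo (0:ℝ) 1 with hO
  have hOo : IsOpen O := hp.opn e _ isOpen_Ioo subset_rfl
  have hOV : ∀ z ∈ V, z ∉ O := by
    rintro _ hz ⟨t, ht, rfl⟩; exact hp.ioo e t ht hz
  have hK1 : IsCompact (Icc a t0 ∩ f ⁻¹' Oᶜ) :=
    isCompact_Icc.inter_right (hOo.isClosed_compl.preimage hf)
  have hK2 : IsCompact (Icc t0 b ∩ f ⁻¹' Oᶜ) :=
    isCompact_Icc.inter_right (hOo.isClosed_compl.preimage hf)
  obtain ⟨c, ⟨hc1, hc2⟩, hcm⟩ := hK1.exists_isGreatest ⟨a, ⟨le_rfl, ht0.1⟩, hOV _ hfa⟩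
  obtain ⟨d, ⟨hd1, hd2⟩, hdm⟩ := hK2.exists_isLeast ⟨b, ⟨ht0.2, le_rfl⟩, hOV _ hfb⟩
  have hct : c < t0 := lt_of_le_of_ne hc1.2 (by rintro rfl; exact hc2 hft)
  have htd : t0 < d := lt_of_le_of_ne hd1.1 (by rintro rfl; exact hd2 hft)
  have hcd := hct.trans htd
  have hin : ∀ t ∈ Ioo c d, f t ∈ O := by
    intro t ht
    by_contra hn
    rcases le_total t t0 with h | h
    · exact absurd (hcm ⟨⟨hc1.1.trans ht.1.le, h⟩, hn⟩) (not_le.2 ht.1)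
    · exact absurd (hdm ⟨⟨h, ht.2.le.trans hd1.2⟩, hn⟩) (not_le.2 ht.2)
  have hsubI : Ioo c d ⊆ Icc a b := fun t ht => ⟨hc1.1.trans ht.1.le, ht.2.le.trans hd1.2⟩
  choose! s hs using hin
  have hsm : ∀ t ∈ Ioo c d, s t ∈ Ioo (0:ℝ) 1 := fun t ht => (hs t ht).1
  have hfs : ∀ t ∈ Ioo c d, f t = γ e (s t) := fun t ht => (hs t ht).2.symm
  have hsc : ContinuousOn s (Ioo c d) := by
    intro t ht
    rw [ContinuousWithinAt, tendsto_nhds]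
    intro U hU htU
    have hopen : IsOpen (γ e '' (U ∩ Ioo 0 1)) :=
      hp.opn e _ (hU.inter isOpen_Ioo) inter_subset_right
    have hmem : f t ∈ γ e '' (U ∩ Ioo 0 1) := ⟨s t, ⟨htU, hsm t ht⟩, (hfs t ht).symm⟩
    have h1 : f ⁻¹' (γ e '' (U ∩ Ioo 0 1)) ∈ 𝓝[Ioo c d] t :=
      nhdsWithin_le_nhds ((hopen.preimage hf).mem_nhds hmem)
    filter_upwards [h1, self_mem_nhdsWithin] with t' h2 h3
    obtain ⟨r, hr, hre⟩ := h2
    rw [hfs t' h3] at hre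
    have := (hp.inj e e r hr.2 _ (hsm t' h3) hre).2
    show s t' ∈ U
    rw [← this]; exact hr.1
  have hsi : InjOn s (Ioo c d) := by
    intro t ht t' ht' hh
    refine hinj ⟨hsubI ht, ?_⟩ ⟨hsubI ht', ?_⟩ (by rw [hfs t ht, hfs t' ht', hh])
    · exact ⟨_, hs t ht⟩
    · exact ⟨_, hs t' ht'⟩
  have main : ((f c = γ e 0 ∧ f d = γ e 1) ∨ (f c = γ e 1 ∧ f d = γ e 0)) ∧
      O ⊆ f '' Ioo c d := by
    rcases hsc.strictMonoOn_of_injOn_Ioo hcd hsi with hm | hm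
    · obtain ⟨h1, h2, h3⟩ := ep_run_mono f (γ e) hf (hp.cont e) s c d hcd hm.monotoneOn hsc hsm hfs
        hc2 hd2
      refine ⟨Or.inl ⟨h1, h2⟩, ?_⟩
      rintro _ ⟨r, hr, rfl⟩
      obtain ⟨t, ht, rfl⟩ := h3 hr
      exact ⟨t, ht, hfs t ht⟩
    · have himg : (fun r => γ e (1 - r)) '' Ioo 0 1 = O := by
        ext z; constructor
        · rintro ⟨r, hr, rfl⟩; exact ⟨1 - r, ⟨by linarith [hr.2], by linarith [hr.1]⟩, rfl⟩
        · rintro ⟨r, hr, rfl⟩; exact ⟨1 - r, ⟨by linarith [hr.2], by linarith [hr.1]⟩, by simp⟩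
      obtain ⟨h1, h2, h3⟩ := ep_run_mono f (fun r => γ e (1 - r)) hf
        ((hp.cont e).comp (by fun_prop)) (fun t => 1 - s t) c d hcd
        (fun t ht t' ht' h => by
          have := hm.antitoneOn ht ht' h
          show 1 - s t ≤ 1 - s t'
          linarith)
        (continuousOn_const.sub hsc)
        (fun t ht => ⟨by linarith [(hsm t ht).2], by linarith [(hsm t ht).1]⟩)
        (fun t ht => by simpa using hfs t ht) (by rw [himg]; exact hc2) (by rw [himg]; exact hd2)
      refine ⟨Or.inr ⟨by simpa using h1, by simpa using h2⟩, ?_⟩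
      rw [← himg]
      rintro _ ⟨r, hr, rfl⟩
      obtain ⟨t, ht, rfl⟩ := h3 hr
      exact ⟨t, ht, by simpa using hfs t ht⟩
  refine ⟨c, d, hc1.1, hcd, hd1.2, fun t ht => ⟨fun h => ?_, fun h => ⟨_, hs t h⟩⟩, main.2, main.1⟩
  obtain ⟨t', ht', heq⟩ := main.2 h
  have := hinj ⟨hsubI ht', show f t' ∈ O from ⟨_, hs t' ht'⟩⟩ ⟨ht, h⟩ heq
  rw [← this]; exact ht'

/-- the closed side of a clopen vertex set -/
def epSide {X : Type*} [TopologicalSpace X] {V : Set X} {E : Type*} {γ : E → ℝ → X}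
    (hp : EpPar V γ) (A : Set V) : Set X :=
  {z | (∃ v ∈ A, (v : X) = z) ∨ ∃ e, epA hp e ∈ A ∧ epB hp e ∈ A ∧ z ∈ γ e '' Ioo (0:ℝ) 1}

lemma epSide_closed {X : Type*} [TopologicalSpace X] [CompactSpace X] [T2Space X] {V : Set X}
    (hV : IsClosed V) {E : Type*} {γ : E → ℝ → X} (hp : EpPar V γ) (A : Set V) (hA : IsClopen A) :
    IsClosed (epSide hp A) := by
  obtain ⟨O1, O2, h1, h2, h3, -, h5, h6⟩ := ep_sepOpen V hV A hA univ isOpen_univ (subset_univ _)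
  have hT := hp.few (O1 ∪ O2) (h1.union h2) (fun z hz => by
    by_cases h : (⟨z, hz⟩ : V) ∈ A
    · exact Or.inl (h5 _ h)
    · exact Or.inr (h6 _ h))
  set T := {e | ∃ t ∈ Icc (0:ℝ) 1, γ e t ∉ O1 ∪ O2} with hTdef
  rw [← isOpen_compl_iff, isOpen_iff_forall_mem_open]
  intro z hz
  by_cases hzV : z ∈ V
  · have hzA : (⟨z, hzV⟩ : V) ∉ A := fun h => hz (Or.inl ⟨_, h, rfl⟩)
    have hcl : IsClosed (⋃ e ∈ {e ∈ T | epA hp e ∈ A ∧ epB hp e ∈ A}, γ e '' Icc (0:ℝ) 1) := by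
      refine Set.Finite.isClosed_biUnion (hT.subset (fun e he => he.1)) fun e _ => ?_
      exact (isCompact_Icc.image (hp.cont e)).isClosed
    refine ⟨O2 \ (⋃ e ∈ {e ∈ T | epA hp e ∈ A ∧ epB hp e ∈ A}, γ e '' Icc (0:ℝ) 1), ?_,
      h2.sdiff hcl, h6 _ hzA, ?_⟩
    · rintro w ⟨hw2, hwn⟩ hwS
      rcases hwS with ⟨v, hv, rfl⟩ | ⟨e, ha, hb, t, ht, rfl⟩
      · exact Set.disjoint_left.1 h3 (h5 _ hv) hw2
      · by_cases heT : e ∈ T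
        · apply hwn
          simp only [mem_iUnion]
          exact ⟨e, ⟨heT, ha, hb⟩, t, Ioo_subset_Icc_self ht, rfl⟩
        · have hsub : γ e '' Icc 0 1 ⊆ O1 ∪ O2 := by
            rintro _ ⟨t, ht, rfl⟩
            by_contra hc
            exact heT ⟨t, ht, hc⟩
          have hpre : IsPreconnected (γ e '' Icc 0 1) :=
            isPreconnected_Icc.image _ (hp.cont e).continuousOn
          have hs := hpre.subset_left_of_subset_union h1 h2 h3 hsub
            ⟨_, ⟨0, by simp, rfl⟩, h5 _ ha⟩
          exact Set.disjoint_left.1 h3 (hs ⟨t, Ioo_subset_Icc_self ht, rfl⟩) hw2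
    · intro hm
      simp only [mem_iUnion] at hm
      obtain ⟨e, ⟨_, ha, hb⟩, t, ht, rfl⟩ := hm
      rcases eq_or_lt_of_le ht.1 with h0 | h0
      · subst h0; exact hzA ha
      rcases eq_or_lt_of_le ht.2 with h1 | h1
      · subst h1; exact hzA hb
      exact hp.ioo e t ⟨h0, h1⟩ hzV
  · obtain ⟨e, t, ht, rfl⟩ := hp.surj z hzV
    refine ⟨γ e '' Ioo 0 1, ?_, hp.opn e _ isOpen_Ioo subset_rfl, t, ht, rfl⟩
    rintro _ ⟨t', ht', rfl⟩ hw
    rcases hw with ⟨v, hv, heq⟩ | ⟨e', ha, hb, t'', ht'', heq⟩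
    · exact hp.ioo e t' ht' (heq ▸ v.2)
    · have := (hp.inj _ _ _ ht'' _ ht' heq).1
      subst this
      exact hz (Or.inr ⟨e', ha, hb, t, ht, rfl⟩)

lemma epSide_disj {X : Type*} [TopologicalSpace X] {V : Set X}
    {E : Type*} {γ : E → ℝ → X} (hp : EpPar V γ) (A : Set V) :
    Disjoint (epSide hp A) (epSide hp Aᶜ) := by
  rw [Set.disjoint_left]
  rintro z (⟨v, hv, rfl⟩ | ⟨e, ha, hb, t, ht, rfl⟩) (⟨v', hv', heq⟩ | ⟨e', ha', hb', t', ht', heq⟩)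
  · exact hv' (Subtype.ext heq ▸ hv)
  · exact hp.ioo e' t' ht' (heq ▸ v.2)
  · exact hp.ioo e t ht (heq ▸ v'.2)
  · have := (hp.inj _ _ _ ht' _ ht heq).1
    subst this
    exact ha' ha

lemma ep_conn_side {X : Type*} [TopologicalSpace X] [CompactSpace X] [T2Space X] {V : Set X}
    (hV : IsClosed V) {E : Type*} {γ : E → ℝ → X} (hp : EpPar V γ) (A : Set V) (hA : IsClopen A)
    (S : Set X) (hS : IsPreconnected S)
    (hcut : ∀ e, (∃ z ∈ S, z ∈ γ e '' Ioo (0:ℝ) 1) → (epA hp e ∈ A ↔ epB hp e ∈ A))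
    (hne : (S ∩ epSide hp A).Nonempty) : S ⊆ epSide hp A := by
  have hsub : S ⊆ epSide hp A ∪ epSide hp Aᶜ := by
    intro z hz
    by_cases hzV : z ∈ V
    · by_cases h : (⟨z, hzV⟩ : V) ∈ A
      · exact Or.inl (Or.inl ⟨_, h, rfl⟩)
      · exact Or.inr (Or.inl ⟨_, h, rfl⟩)
    · obtain ⟨e, t, ht, rfl⟩ := hp.surj z hzV
      have := hcut e ⟨_, hz, t, ht, rfl⟩
      by_cases h : epA hp e ∈ A
      · exact Or.inl (Or.inr ⟨e, h, this.1 h, t, ht, rfl⟩)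
      · exact Or.inr (Or.inr ⟨e, h, fun h' => h (this.2 h'), t, ht, rfl⟩)
  have c1 := epSide_closed hV hp A hA
  have c2 := epSide_closed hV hp Aᶜ hA.compl
  intro z hz
  rcases hsub hz with h | h
  · exact h
  · obtain ⟨w, -, hw1, hw2⟩ := isPreconnected_closed_iff.1 hS _ _ c1 c2 hsub hne ⟨z, hz, h⟩
    exact absurd hw2 (Set.disjoint_left.1 (epSide_disj hp A) hw1)

/-- edges hit -/
def epHit {X E : Type*} (γ : E → ℝ → X) (f : ℝ → X) (a b : ℝ) : Set E :=
  {e | ∃ t ∈ Icc a b, f t ∈ γ e '' Ioo (0:ℝ) 1}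

theorem ep_parity {X : Type*} [TopologicalSpace X] [CompactSpace X] [T2Space X] {V : Set X}
    (hV : IsClosed V) {E : Type*} {γ : E → ℝ → X} (hp : EpPar V γ) (f : ℝ → X) (hf : Continuous f)
    (A : Set V) (hA : IsClopen A) : ∀ (n : ℕ) (a b : ℝ) (hfa : f a ∈ V) (hfb : f b ∈ V), a ≤ b →
    (∀ e, InjOn f (Icc a b ∩ f ⁻¹' (γ e '' Ioo (0:ℝ) 1))) →
    (support (epChi (epA hp) (epB hp) A) ∩ epHit γ f a b).ncard = n →
    epS (epA hp) (epB hp) A (epHit γ f a b) = epInd A ⟨f a, hfa⟩ + epInd A ⟨f b, hfb⟩ := by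
  intro n
  induction n using Nat.strong_induction_on with
  | _ n ih =>
  intro a b hfa hfb hab hinj hn
  have hfin := ep_cutFin hV hp A hA
  by_cases hemp : (support (epChi (epA hp) (epB hp) A) ∩ epHit γ f a b) = ∅
  · have h0 : epS (epA hp) (epB hp) A (epHit γ f a b) = 0 := by
      rw [epS_congr (M' := ∅), epS_empty]
      intro i hi
      simp only [mem_empty_iff_false, iff_false]
      intro h
      have : i ∈ (support (epChi (epA hp) (epB hp) A) ∩ epHit γ f a b) := ⟨hi, h⟩
      rw [hemp] at this; exact this
    rw [h0]
    have hcut : ∀ e, (∃ z ∈ f '' Icc a b, z ∈ γ e '' Ioo (0:ℝ) 1) →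
        (epA hp e ∈ A ↔ epB hp e ∈ A) := by
      rintro e ⟨_, ⟨t, ht, rfl⟩, hz⟩
      rw [← epChi_eq_zero_iff]
      by_contra hc
      have : e ∈ (support (epChi (epA hp) (epB hp) A) ∩ epHit γ f a b) := ⟨hc, t, ht, hz⟩
      rw [hemp] at this; exact this
    have key : ∀ B : Set V, IsClopen B →
        (∀ e, (∃ z ∈ f '' Icc a b, z ∈ γ e '' Ioo (0:ℝ) 1) →
        (epA hp e ∈ B ↔ epB hp e ∈ B)) → (⟨f a, hfa⟩ : V) ∈ B → (⟨f b, hfb⟩ : V) ∈ B := by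
      intro B hB hcut h
      have h3 := ep_conn_side hV hp B hB (f '' Icc a b) (isPreconnected_Icc.image _ hf.continuousOn)
        hcut ⟨f a, ⟨a, ⟨le_rfl, hab⟩, rfl⟩, Or.inl ⟨_, h, rfl⟩⟩ ⟨b, ⟨hab, le_rfl⟩, rfl⟩
      rcases h3 with ⟨v, hv, heq⟩ | ⟨e, _, _, t, ht, heq⟩
      · have : v = ⟨f b, hfb⟩ := Subtype.ext heq
        exact this ▸ hv
      · exact absurd hfb (heq ▸ hp.ioo e t ht)
    have : ((⟨f a, hfa⟩ : V) ∈ A ↔ (⟨f b, hfb⟩ : V) ∈ A) := by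
      refine ⟨key A hA hcut, fun h => ?_⟩
      by_contra h'
      exact key Aᶜ hA.compl (fun e he => not_congr (hcut e he)) h' h
    rw [epInd_eq_iff.2 this, epZ_self]
  · obtain ⟨e, he, t0, ht0, hft⟩ := nonempty_iff_ne_empty.2 hemp
    obtain ⟨c, d, hac, hcd, hdb, hiff, -, hends⟩ := ep_run hp f hf a b hfa hfb e (hinj e) t0 ht0 hft
    have hfc : f c ∈ V := by
      rcases hends with h | h <;> rw [h.1]
      · exact hp.zero e
      · exact hp.one e
    have hfd : f d ∈ V := by
      rcases hends with h | h <;> rw [h.2]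
      · exact hp.one e
      · exact hp.zero e
    have s1 : Icc a c ⊆ Icc a b := Icc_subset_Icc_right (hcd.le.trans hdb)
    have s2 : Icc d b ⊆ Icc a b := Icc_subset_Icc_left (hac.trans hcd.le)
    have hun : epHit γ f a b = (epHit γ f a c ∪ {e}) ∪ epHit γ f d b := by
      ext i; constructor
      · rintro ⟨t, ht, hti⟩
        rcases le_or_gt t c with h | h
        · exact Or.inl (Or.inl ⟨t, ⟨ht.1, h⟩, hti⟩)
        rcases le_or_gt d t with h' | h'
        · exact Or.inr ⟨t, ⟨h', ht.2⟩, hti⟩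
        obtain ⟨r, hr, hre⟩ := (hiff t ht).2 ⟨h, h'⟩
        obtain ⟨r', hr', hre'⟩ := hti
        exact Or.inl (Or.inr (hp.inj _ _ _ hr' _ hr (hre'.trans hre.symm)).1)
      · rintro ((⟨t, ht, hti⟩ | h) | ⟨t, ht, hti⟩)
        · exact ⟨t, s1 ht, hti⟩
        · have h : i = e := h
          subst h; exact ⟨t0, ht0, hft⟩
        · exact ⟨t, s2 ht, hti⟩
    have ne1 : e ∉ epHit γ f a c := by
      rintro ⟨t, ht, hti⟩
      exact absurd ((hiff t (s1 ht)).1 hti).1 (not_lt.2 ht.2)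
    have ne2 : e ∉ epHit γ f d b := by
      rintro ⟨t, ht, hti⟩
      exact absurd ((hiff t (s2 ht)).1 hti).2 (not_lt.2 ht.1)
    have hd12 : ∀ i, i ∈ epHit γ f a c → i ∉ epHit γ f d b := by
      rintro i ⟨t, ht, hti⟩ ⟨t', ht', hti'⟩
      obtain ⟨c', d', -, -, -, hiff', -, -⟩ :=
        ep_run hp f hf a b hfa hfb i (hinj i) t (s1 ht) hti
      have q1 := (hiff' t (s1 ht)).1 hti
      have q2 := (hiff' t' (s2 ht')).1 hti'
      obtain ⟨r, hr, hre⟩ := (hiff' c ⟨hac, hcd.le.trans hdb⟩).2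
        ⟨q1.1.trans_le ht.2, (hcd.le.trans ht'.1).trans_lt q2.2⟩
      exact hp.ioo i r hr (hre ▸ hfc)
    have hsub1 : epHit γ f a c ⊆ epHit γ f a b := by rw [hun]; exact fun i hi => Or.inl (Or.inl hi)
    have hsub2 : epHit γ f d b ⊆ epHit γ f a b := by rw [hun]; exact fun i hi => Or.inr hi
    have hlt : ∀ M : Set E, M ⊆ epHit γ f a b → e ∉ M →
        (support (epChi (epA hp) (epB hp) A) ∩ M).ncard < n := by
      intro M hM heM
      rw [← hn]
      refine ncard_lt_ncard ⟨inter_subset_inter_right _ hM, fun h => heM ?_⟩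
        (hfin.subset inter_subset_left)
      exact (h ⟨he, t0, ht0, hft⟩).2
    have r1 := ih _ (hlt _ hsub1 ne1) a c hfa hfc hac
      (fun i => (hinj i).mono (inter_subset_inter_left _ s1)) rfl
    have r2 := ih _ (hlt _ hsub2 ne2) d b hfd hfb hdb
      (fun i => (hinj i).mono (inter_subset_inter_left _ s2)) rfl
    rw [hun, epS_union hfin, epS_union hfin, epS_single, r1, r2]
    · have : epChi (epA hp) (epB hp) A e = epInd A ⟨f c, hfc⟩ + epInd A ⟨f d, hfd⟩ := by
        rcases hends with h | h
        · have e1 : epA hp e = ⟨f c, hfc⟩ := Subtype.ext h.1.symm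
          have e2 : epB hp e = ⟨f d, hfd⟩ := Subtype.ext h.2.symm
          rw [epChi, e1, e2]
        · have e1 : epB hp e = ⟨f c, hfc⟩ := Subtype.ext h.1.symm
          have e2 : epA hp e = ⟨f d, hfd⟩ := Subtype.ext h.2.symm
          rw [epChi, e1, e2, add_comm]
      rw [this]
      generalize epInd A ⟨f a, hfa⟩ = p
      generalize epInd A ⟨f b, hfb⟩ = q
      generalize epInd A ⟨f c, hfc⟩ = r
      generalize epInd A ⟨f d, hfd⟩ = s
      revert p q r s; decide
    · rw [Set.disjoint_singleton_right]; exact ne1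
    · rw [Set.disjoint_left]
      rintro i (hi | hi)
      · exact hd12 i hi
      · have hi : i = e := hi
        rw [hi]; exact ne2


lemma ep_weights (ι : Type*) [Countable ι] [Nonempty ι] :
    ∃ w : ι → ℝ, (∀ i, 0 < w i) ∧ HasSum w 1 := by
  have := Encodable.ofCountable ι
  obtain ⟨w, hw, c, hc, -⟩ := posSumOfEncodable (ε := 1) zero_lt_one ι
  have hpos : 0 < c := by
    obtain ⟨i⟩ := ‹Nonempty ι›
    exact (hw i).trans_le (le_hasSum hc i fun k _ => (hw k).le)
  refine ⟨fun i => w i / c, fun i => div_pos (hw i) hpos, ?_⟩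
  have := hc.div_const c
  rwa [div_self hpos.ne'] at this

lemma ep_ivals (ι : Type*) [Countable ι] [Nonempty ι] [LinearOrder ι] :
    ∃ L R : ι → ℝ, (∀ i, 0 ≤ L i) ∧ (∀ i, L i < R i) ∧ (∀ i, R i ≤ 1) ∧
      (∀ i k, i < k → R i ≤ L k) ∧
      (∀ u v, 0 ≤ u → u < v → v ≤ 1 → ∃ i, ∃ t ∈ Ioo u v, t ∈ Ioo (L i) (R i)) := by
  obtain ⟨w, hw, hs⟩ := ep_weights ι
  let W : Set ι → ℝ := fun M => ∑' k, M.indicator w k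
  have hsum : ∀ M : Set ι, Summable (M.indicator w) := fun M => hs.summable.indicator M
  have hnn : ∀ (M : Set ι) k, 0 ≤ M.indicator w k := fun M k =>
    indicator_nonneg (fun i _ => (hw i).le) k
  have hmono : ∀ M N : Set ι, M ⊆ N → W M ≤ W N := fun M N h =>
    (hsum M).tsum_le_tsum (fun k => indicator_le_indicator_of_subset h (fun i => (hw i).le) k)
      (hsum N)
  have huniv : W univ = 1 := by
    show ∑' k, (univ : Set ι).indicator w k = 1
    rw [indicator_univ]; exact hs.tsum_eq
  have hunion : ∀ M N : Set ι, Disjoint M N → W (M ∪ N) = W M + W N := by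
    intro M N h
    show ∑' k, (M ∪ N).indicator w k = _
    rw [indicator_union_of_disjoint h]
    exact (hsum M).tsum_add (hsum N)
  have hsingle : ∀ i, W {i} = w i := by
    intro i
    show ∑' k, ({i} : Set ι).indicator w k = w i
    rw [tsum_eq_single i]
    · simp
    · intro k hk; simp [hk]
  have hnonneg : ∀ M, 0 ≤ W M := fun M => tsum_nonneg (hnn M)
  have hIic : ∀ i, W (Iic i) = W (Iio i) + w i := by
    intro i
    rw [← hsingle, ← hunion _ _ (by simp), Iio_union_right]
  refine ⟨fun i => W (Iio i), fun i => W (Iic i), fun i => hnonneg _, ?_, ?_, ?_, ?_⟩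
  · intro i; have := hw i; have := hIic i; simp only; linarith
  · intro i; rw [← huniv]; exact hmono _ _ (subset_univ _)
  · intro i k hik; exact hmono _ _ (fun l hl => lt_of_le_of_lt hl hik)
  · intro u v hu huv hv
    by_contra hcon
    push Not at hcon
    have hdich : ∀ i, W (Iic i) ≤ u ∨ v ≤ W (Iio i) := by
      intro i
      by_contra hc
      push Not at hc
      have h1 : W (Iio i) < W (Iic i) := by have := hw i; have := hIic i; linarith
      have hm : max u (W (Iio i)) < min v (W (Iic i)) := by
        rw [max_lt_iff, lt_min_iff, lt_min_iff]
        exact ⟨⟨huv, hc.1⟩, hc.2, h1⟩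
      obtain ⟨t, ht1, ht2⟩ := exists_between hm
      rw [max_lt_iff] at ht1
      rw [lt_min_iff] at ht2
      exact hcon i t ⟨ht1.1, ht2.1⟩ ⟨ht1.2, ht2.2⟩
    set P := {i | W (Iic i) ≤ u} with hP
    have hPle : W P ≤ u := by
      refine (hsum P).tsum_le_of_sum_le fun s => ?_
      by_cases hne : (s.filter (fun i => W (Iic i) ≤ u)).Nonempty
      · set m := (s.filter (fun i => W (Iic i) ≤ u)).max' hne with hmdef
        have hm := Finset.max'_mem _ hne
        rw [Finset.mem_filter] at hm
        refine le_trans ?_ hm.2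
        refine le_trans (Finset.sum_le_sum (g := (Iic m).indicator w) fun i hi => ?_)
          ((hsum (Iic m)).sum_le_tsum s fun k _ => hnn _ k)
        by_cases hiP : i ∈ P
        · have : i ∈ Iic m := Finset.le_max' _ _ (Finset.mem_filter.2 ⟨hi, hiP⟩)
          rw [indicator_of_mem hiP, indicator_of_mem this]
        · rw [indicator_of_notMem hiP]; exact hnn _ _
      · rw [Finset.sum_eq_zero]
        · exact hu
        · intro i hi
          rw [indicator_of_notMem]
          intro hiP
          exact hne ⟨i, Finset.mem_filter.2 ⟨hi, hiP⟩⟩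
    have hQle : W Pᶜ ≤ 1 - v := by
      refine (hsum Pᶜ).tsum_le_of_sum_le fun s => ?_
      by_cases hne : (s.filter (fun i => ¬ W (Iic i) ≤ u)).Nonempty
      · set m := (s.filter (fun i => ¬ W (Iic i) ≤ u)).min' hne with hmdef
        have hm := Finset.min'_mem _ hne
        rw [Finset.mem_filter] at hm
        have hv2 := (hdich m).resolve_left hm.2
        have hci : W (Iio m) + W (Ici m) = 1 := by
          rw [← hunion, ← huniv, Iio_union_Ici]
          rw [Set.disjoint_left]; intro i h1 h2; exact not_lt.2 h2 h1
        have : W (Ici m) ≤ 1 - v := by linarith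
        refine le_trans ?_ this
        refine le_trans (Finset.sum_le_sum (g := (Ici m).indicator w) fun i hi => ?_)
          ((hsum (Ici m)).sum_le_tsum s fun k _ => hnn _ k)
        by_cases hiP : i ∈ Pᶜ
        · have : i ∈ Ici m := Finset.min'_le _ _ (Finset.mem_filter.2 ⟨hi, hiP⟩)
          rw [indicator_of_mem hiP, indicator_of_mem this]
        · rw [indicator_of_notMem hiP]; exact hnn _ _
      · rw [Finset.sum_eq_zero]
        · linarith
        · intro i hi
          rw [indicator_of_notMem]
          intro hiP
          exact hne ⟨i, Finset.mem_filter.2 ⟨hi, hiP⟩⟩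
    have := hunion P Pᶜ disjoint_compl_right
    rw [union_compl_self, huniv] at this
    linarith

lemma ep_clopen_ext {V : Type*} [TopologicalSpace V] [CompactSpace V] [T2Space V]
    [TotallyDisconnectedSpace V] {p q : V} (h : ∀ A : Set V, IsClopen A → epInd A p = epInd A q) :
    p = q := by
  by_contra hne
  obtain ⟨A, hA, hpA, hqA⟩ := exists_isClopen_of_totally_separated hne
  have := (epInd_eq_iff.1 (h A hA)).1 hpA
  exact hqA this

lemma ep_point {V : Type*} [TopologicalSpace V] [CompactSpace V] {ι : Type*} [LinearOrder ι]
    (a b : ι → V) (hfin : ∀ A, IsClopen A → (support (epChi a b A)).Finite) (o : ι → Bool) (x y : V)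
    (hstar : ∀ A, IsClopen A → ∀ e,
      epInd A (epTail a b (e, o e)) = epInd A x + epS a b A {i | i < e})
    (hpar : ∀ A, IsClopen A → epS a b A univ = epInd A x + epInd A y)
    (L R : ι → ℝ) (hLR : ∀ i, L i < R i) (hord : ∀ i k, i < k → R i ≤ L k) (t : ℝ) :
    ∃ p : V, ∀ A, IsClopen A → epInd A p = epInd A x + epS a b A {i | R i ≤ t} := by
  classical
  have hord2 : ∀ i k, R i ≤ L k → i < k := by
    intro i k h
    rcases lt_trichotomy i k with h1 | h1 | h1
    · exact h1
    · subst h1; exact absurd h (not_le.2 (hLR i))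
    · have := hord _ _ h1; have := hLR i; have := hLR k; linarith
  have hfinite : ∀ S : Finset (Set V), (∀ A ∈ S, IsClopen A) →
      ∃ p : V, ∀ A ∈ S, epInd A p = epInd A x + epS a b A {i | R i ≤ t} := by
    intro S hS
    have hBf : (⋃ A ∈ S, support (epChi a b A)).Finite :=
      S.finite_toSet.biUnion fun A hA => hfin A (hS A hA)
    set B := ⋃ A ∈ S, support (epChi a b A) with hBdef
    have hBmem : ∀ A ∈ S, ∀ i, epChi a b A i ≠ 0 → i ∈ B := by
      intro A hA i hi
      exact mem_biUnion (show A ∈ (S : Set (Set V)) from hA) hi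
    by_cases hne : {i ∈ B | t < R i}.Nonempty
    · obtain ⟨i, hi, hmin⟩ := (hBf.subset (fun i hi => hi.1 : {i ∈ B | t < R i} ⊆ B)).exists_minimal hne
      refine ⟨epTail a b (i, o i), fun A hA => ?_⟩
      rw [hstar A (hS A hA)]
      congr 1
      refine epS_congr fun k hk => ?_
      have hkB := hBmem A hA k hk
      constructor
      · intro hki
        have hki : k < i := hki
        by_contra hc
        have hc : ¬ R k ≤ t := hc
        exact absurd (hmin ⟨hkB, not_le.1 hc⟩ hki.le) (not_le.2 hki)
      · intro hk
        have hk : R k ≤ t := hk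
        have h2 : t < R i := hi.2
        rcases lt_trichotomy k i with h1 | h1 | h1
        · exact h1
        · subst h1; linarith
        · have := hord _ _ h1; have := hLR k; linarith
    · refine ⟨y, fun A hA => ?_⟩
      have : epS a b A {i | R i ≤ t} = epS a b A univ := by
        refine epS_congr fun k hk => ?_
        simp only [mem_univ, iff_true]
        by_contra hc
        exact hne ⟨k, hBmem A hA k hk, not_le.1 hc⟩
      rw [this, hpar A (hS A hA), ← add_assoc, epZ_self, zero_add]
  let Z : {A : Set V // IsClopen A} → Set V := fun A =>
    {p | epInd A.1 p = epInd A.1 x + epS a b A.1 {i | R i ≤ t}}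
  have hZ : ∀ A, IsClosed (Z A) := by
    intro A
    rcases epZ_cases (epInd A.1 x + epS a b A.1 {i | R i ≤ t}) with h | h
    · have : Z A = A.1ᶜ := by
        ext p
        show epInd A.1 p = _ ↔ _
        rw [h]
        constructor
        · intro h1 h2; rw [epInd_mem h2] at h1; exact absurd h1 (by decide)
        · intro h1; exact epInd_not_mem h1
      rw [this]; exact A.2.compl.isClosed
    · have : Z A = A.1 := by
        ext p
        show epInd A.1 p = _ ↔ _
        rw [h]; exact epInd_eq_one_iff
      rw [this]; exact A.2.isClosed
  have hne : (univ ∩ ⋂ A, Z A).Nonempty := by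
    refine isCompact_univ.inter_iInter_nonempty Z hZ fun u => ?_
    obtain ⟨p, hp⟩ := hfinite (u.image Subtype.val) (by
      intro A hA
      obtain ⟨B, _, rfl⟩ := Finset.mem_image.1 hA
      exact B.2)
    refine ⟨p, mem_univ _, ?_⟩
    simp only [mem_iInter]
    intro A hA
    exact hp A.1 (Finset.mem_image.2 ⟨A, hA, rfl⟩)
  obtain ⟨p, -, hp⟩ := hne
  rw [mem_iInter] at hp
  exact ⟨p, fun A hA => hp ⟨A, hA⟩⟩


set_option maxHeartbeats 1000000 in
open Classical in
theorem ep_path {X : Type*} [TopologicalSpace X] [CompactSpace X] [T2Space X] {V : Set X}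
    (hV : IsClosed V) [TotallyDisconnectedSpace V] {E : Type*} {γ : E → ℝ → X} (hp : EpPar V γ)
    {ι : Type*} [Countable ι] [Nonempty ι] [LinearOrder ι] (j : ι → E) (hj : Injective j)
    (o : ι → Bool) (x y : V)
    (hstar : ∀ A, IsClopen A → ∀ e, epInd A (epTail (epA hp ∘ j) (epB hp ∘ j) (e, o e)) =
      epInd A x + epS (epA hp ∘ j) (epB hp ∘ j) A {i | i < e})
    (hpar : ∀ A, IsClopen A → epS (epA hp ∘ j) (epB hp ∘ j) A univ = epInd A x + epInd A y) :
    ∃ f : ℝ → X, Continuous f ∧ f 0 = x ∧ f 1 = y ∧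
      (∀ e, InjOn f (f ⁻¹' (γ e '' Ioo (0:ℝ) 1))) ∧
      (∀ i, γ (j i) '' Ioo (0:ℝ) 1 ⊆ f '' Icc 0 1) ∧
      (∀ e t, f t ∈ γ e '' Ioo (0:ℝ) 1 → e ∈ range j) ∧
      (∀ u v, 0 ≤ u → u < v → v ≤ 1 → ∃ t ∈ Ioo u v, f t ∉ V) ∧
      ((∀ M : Set ι, (∀ A, IsClopen A → epS (epA hp ∘ j) (epB hp ∘ j) A M = 0) → M = ∅) →
        InjOn f (Icc 0 1)) := by
  have hVc : CompactSpace V := isCompact_iff_compactSpace.1 hV.isCompact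
  set a := epA hp ∘ j with ha
  set b := epB hp ∘ j with hb
  have hfin : ∀ A, IsClopen A → (support (epChi a b A)).Finite := by
    intro A hA
    exact ((ep_cutFin hV hp A hA).preimage hj.injOn)
  obtain ⟨L, R, hL0, hLR, hR1, hord, hdense⟩ := ep_ivals ι
  have hord2 : ∀ i k, L i < R k → i ≤ k := by
    intro i k h
    by_contra hc
    have := hord _ _ (not_le.1 hc)
    linarith
  choose P hP using ep_point a b hfin o x y hstar hpar L R hLR hord
  -- tail and head
  have hPtail : ∀ i t, L i ≤ t → t < R i → P t = epTail a b (i, o i) := by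
    intro i t h1 h2
    apply ep_clopen_ext
    intro A hA
    rw [hP t A hA, hstar A hA]
    congr 2
    ext k
    constructor
    · intro hk
      have hk : R k ≤ t := hk
      refine lt_of_le_of_ne (hord2 k i (by have := hLR k; linarith)) ?_
      rintro rfl; linarith
    · intro hk
      have := hord k i hk
      show R k ≤ t
      linarith
  have hPhead : ∀ i, P (R i) = epHead a b (i, o i) := by
    intro i
    apply ep_clopen_ext
    intro A hA
    have e1 : {k | R k ≤ R i} = {k | k < i} ∪ {i} := by
      ext k
      constructor
      · intro hk
        have hk : R k ≤ R i := hk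
        rcases (hord2 k i (by have := hLR k; linarith)).lt_or_eq with h | h
        · exact Or.inl h
        · exact Or.inr h
      · rintro (hk | hk)
        · have := hord k i hk; have := hLR i
          show R k ≤ R i
          linarith
        · have hk : k = i := hk
          rw [hk]; exact le_refl (R i)
    have h2 := hstar A hA i
    have h3 := epChi_tail_head a b A (i, o i)
    rw [hP _ A hA, e1, epS_union (hfin A hA), epS_single, ← add_assoc, ← h2]
    · simp only at h3
      rw [h3, ← add_assoc, epZ_self, zero_add]
    · rw [Set.disjoint_singleton_right]; exact lt_irrefl i
  have hP0 : ∀ t, t ≤ 0 → P t = x := by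
    intro t ht
    apply ep_clopen_ext
    intro A hA
    have : {i | R i ≤ t} = ∅ := by
      rw [eq_empty_iff_forall_notMem]
      intro i hi
      have hi : R i ≤ t := hi
      have := hL0 i; have := hLR i; linarith
    rw [hP t A hA, this, epS_empty, add_zero]
  have hP1 : ∀ t, 1 ≤ t → P t = y := by
    intro t ht
    apply ep_clopen_ext
    intro A hA
    have : {i | R i ≤ t} = univ := by
      rw [eq_univ_iff_forall]
      intro i
      exact (hR1 i).trans ht
    rw [hP t A hA, this, hpar A hA, ← add_assoc, epZ_self, zero_add]
  let r : ι → ℝ → ℝ := fun i t => if o i then (t - L i) / (R i - L i) else 1 - (t - L i) / (R i - L i)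
  have hrc : ∀ i, Continuous (r i) := by
    intro i
    by_cases h : o i
    · simp only [r, h, if_true]; fun_prop
    · simp only [r, h, Bool.false_eq_true, if_false]; fun_prop
  have hpos : ∀ i, 0 < R i - L i := fun i => by have := hLR i; linarith
  have hr_ioo : ∀ i t, t ∈ Ioo (L i) (R i) → r i t ∈ Ioo (0:ℝ) 1 := by
    intro i t ht
    have h1 : 0 < (t - L i) / (R i - L i) := div_pos (by linarith [ht.1]) (hpos i)
    have h2 : (t - L i) / (R i - L i) < 1 := by rw [div_lt_one (hpos i)]; linarith [ht.2]
    by_cases h : o i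
    · simp only [r, h, if_true]; exact ⟨h1, h2⟩
    · simp only [r, h]; constructor <;> simp <;> linarith
  have hr_surj : ∀ i, ∀ s ∈ Ioo (0:ℝ) 1, ∃ t ∈ Ioo (L i) (R i), r i t = s := by
    intro i s hs
    have h0 := hpos i
    by_cases h : o i
    · refine ⟨L i + s * (R i - L i), ⟨by nlinarith [hs.1], by nlinarith [hs.2]⟩, ?_⟩
      simp only [r, h, if_true]; field_simp; ring
    · refine ⟨L i + (1 - s) * (R i - L i), ⟨by nlinarith [hs.2], by nlinarith [hs.1]⟩, ?_⟩
      simp only [r, h, Bool.false_eq_true, if_false]; field_simp; ring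
  have hr_inj : ∀ i, Injective (r i) := by
    intro i t t' h
    have h0 := (hpos i).ne'
    by_cases ho : o i
    · simp only [r, ho, if_true] at h
      field_simp at h; linarith
    · simp only [r, ho] at h
      simp at h
      field_simp at h; linarith
  have hrL : ∀ i, γ (j i) (r i (L i)) = epTail a b (i, o i) := by
    intro i
    by_cases h : o i
    · simp [r, h, epTail, ha, epA]
    · simp [r, h, epTail, hb, epB]
  have hrR : ∀ i, γ (j i) (r i (R i)) = epHead a b (i, o i) := by
    intro i
    have h0 := (hpos i).ne'
    by_cases h : o i
    · simp [r, h, epHead, hb, epB, h0]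
    · simp [r, h, epHead, ha, epA, h0]
  let f : ℝ → X := fun t => if h : ∃ i, t ∈ Ioo (L i) (R i) then γ (j h.choose) (r h.choose t) else P t
  have huniq : ∀ i k t, t ∈ Ioo (L i) (R i) → t ∈ Icc (L k) (R k) → i = k := by
    intro i k t h1 h2
    apply le_antisymm
    · exact hord2 _ _ (h1.1.trans_le h2.2)
    · exact hord2 _ _ (h2.1.trans_lt h1.2)
  have hfo : ∀ i t, t ∈ Ioo (L i) (R i) → f t = γ (j i) (r i t) := by
    intro i t ht
    have h : ∃ i, t ∈ Ioo (L i) (R i) := ⟨i, ht⟩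
    have h2 : h.choose = i := huniq _ _ t h.choose_spec (Ioo_subset_Icc_self ht)
    simp only [f, dif_pos h, h2]
  have hfv : ∀ t, (¬ ∃ i, t ∈ Ioo (L i) (R i)) → f t = P t := by
    intro t h; simp only [f, dif_neg h]
  have hfi : ∀ i t, t ∈ Icc (L i) (R i) → f t = γ (j i) (r i t) := by
    intro i t ht
    rcases eq_or_lt_of_le ht.1 with h0 | h0
    · have hn : ¬ ∃ k, t ∈ Ioo (L k) (R k) := by
        rintro ⟨k, hk⟩
        have := huniq k i t hk ht
        subst this; rw [← h0] at hk; exact lt_irrefl _ hk.1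
      rw [hfv t hn, hPtail i t ht.1 (h0 ▸ hLR i), ← hrL, h0]
    rcases eq_or_lt_of_le ht.2 with h1 | h1
    · have hn : ¬ ∃ k, t ∈ Ioo (L k) (R k) := by
        rintro ⟨k, hk⟩
        have := huniq k i t hk ht
        subst this; rw [h1] at hk; exact lt_irrefl _ hk.2
      rw [hfv t hn, h1, hPhead, ← hrR]
    exact hfo i t ⟨h0, h1⟩
  have hcont : Continuous f := by
    rw [continuous_iff_continuousAt]
    intro t
    by_cases ht : ∃ i, t ∈ Ioo (L i) (R i)
    · obtain ⟨i, hi⟩ := ht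
      have : (fun t => γ (j i) (r i t)) =ᶠ[𝓝 t] f := by
        filter_upwards [isOpen_Ioo.mem_nhds hi] with t' ht' using (hfo i t' ht').symm
      exact ContinuousAt.congr ((hp.cont (j i)).comp (hrc i)).continuousAt this
    · rw [ContinuousAt, hfv t ht, tendsto_nhds]
      intro U hU hpU
      obtain ⟨A, hA, hpA, hAU, T, hT, hTs⟩ := ep_nbhd hV hp (P t) U hU hpU
      have hT' : (j ⁻¹' T).Finite := hT.preimage hj.injOn
      have ev1 : ∀ᶠ t' in 𝓝 t, ∀ i ∈ j ⁻¹' T, t' ∈ Icc (L i) (R i) → f t' ∈ U := by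
        rw [Set.Finite.eventually_all hT']
        intro i _
        by_cases hti : t ∈ Icc (L i) (R i)
        · have h1 : γ (j i) (r i t) ∈ U := by rw [← hfi i t hti, hfv t ht]; exact hpU
          have h2 : ∀ᶠ t' in 𝓝 t, γ (j i) (r i t') ∈ U :=
            ((hp.cont (j i)).comp (hrc i)).continuousAt.eventually (hU.mem_nhds h1)
          filter_upwards [h2] with t' h3 h4
          rw [hfi i t' h4]; exact h3
        · filter_upwards [isClosed_Icc.isOpen_compl.mem_nhds hti] with t' h3 h4
          exact absurd h4 h3
      have ev2 : ∀ᶠ t' in 𝓝 t, ∀ i ∈ j ⁻¹' T, t' ∉ Icc (L i) (R i) → (R i ≤ t' ↔ R i ≤ t) := by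
        rw [Set.Finite.eventually_all hT']
        intro i _
        rcases lt_trichotomy (R i) t with h | h | h
        · filter_upwards [lt_mem_nhds h] with t' h1 _
          exact ⟨fun _ => h.le, fun _ => h1.le⟩
        · filter_upwards [lt_mem_nhds (show L i < t from h ▸ hLR i)] with t' h1 h2
          refine ⟨fun _ => h.le, fun _ => ?_⟩
          by_contra hc
          exact h2 ⟨h1.le, (not_le.1 hc).le⟩
        · filter_upwards [gt_mem_nhds h] with t' h1 _
          exact ⟨fun h2 => absurd h2 (not_le.2 h1), fun h2 => absurd h2 (not_le.2 h)⟩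
      filter_upwards [ev1, ev2] with t' h1 h2
      show f t' ∈ U
      by_cases hex : ∃ i ∈ j ⁻¹' T, t' ∈ Icc (L i) (R i)
      · obtain ⟨i, hi, hti⟩ := hex
        exact h1 i hi hti
      push Not at hex
      have hPA : P t' ∈ A := by
        have : epInd A (P t') = epInd A (P t) := by
          rw [hP t' A hA, hP t A hA]
          congr 1
          refine epS_congr fun i hi => ?_
          have hiT : i ∈ j ⁻¹' T := by
            by_contra hc
            apply hi
            rw [epChi_eq_zero_iff]
            rcases hTs (j i) hc with h | h
            · exact ⟨fun _ => h.2.2, fun _ => h.2.1⟩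
            · exact ⟨fun g => absurd g h.1, fun g => absurd g h.2⟩
          exact h2 i hiT (hex i hiT)
        exact (epInd_eq_iff.1 this).2 hpA
      by_cases hti : ∃ i, t' ∈ Ioo (L i) (R i)
      · obtain ⟨i, hi⟩ := hti
        have hiT : j i ∉ T := fun h => hex i h (Ioo_subset_Icc_self hi)
        rw [hPtail i t' hi.1.le hi.2] at hPA
        rw [hfo i t' hi]
        rcases hTs (j i) hiT with h | h
        · exact h.1 _ (Ioo_subset_Icc_self (hr_ioo i t' hi))
        · exfalso
          by_cases ho : o i
          · simp only [epTail, ho, if_true] at hPA; exact h.1 hPA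
          · simp only [epTail, ho] at hPA; exact h.2 hPA
      · rw [hfv t' hti]; exact hAU _ hPA
  have hnoV : ∀ i t, t ∈ Ioo (L i) (R i) → f t ∉ V := by
    intro i t ht
    rw [hfo i t ht]; exact hp.ioo _ _ (hr_ioo i t ht)
  have hedge : ∀ e t, f t ∈ γ e '' Ioo (0:ℝ) 1 → ∃ i, j i = e ∧ t ∈ Ioo (L i) (R i) := by
    rintro e t ⟨s, hs, hse⟩
    by_cases hti : ∃ i, t ∈ Ioo (L i) (R i)
    · obtain ⟨i, hi⟩ := hti
      rw [hfo i t hi] at hse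
      exact ⟨i, (hp.inj _ _ _ hs _ (hr_ioo i t hi) hse).1.symm, hi⟩
    · rw [hfv t hti] at hse
      exact absurd (P t).2 (hse ▸ hp.ioo e s hs)
  have hinj : ∀ e, InjOn f (f ⁻¹' (γ e '' Ioo (0:ℝ) 1)) := by
    intro e t ht t' ht' heq
    obtain ⟨i, hi, hti⟩ := hedge e t ht
    obtain ⟨i', hi', hti'⟩ := hedge e t' ht'
    have : i = i' := hj (hi.trans hi'.symm)
    subst this
    rw [hfo i t hti, hfo i t' hti'] at heq
    exact hr_inj i (hp.inj _ _ _ (hr_ioo i t hti) _ (hr_ioo i t' hti') heq).2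
  have no0 : ∀ t, t ≤ 0 → ¬ ∃ i, t ∈ Ioo (L i) (R i) := by
    rintro t ht ⟨i, hi⟩; have := hL0 i; have := hi.1; linarith
  have no1 : ∀ t, 1 ≤ t → ¬ ∃ i, t ∈ Ioo (L i) (R i) := by
    rintro t ht ⟨i, hi⟩; have := hR1 i; have := hi.2; linarith
  refine ⟨f, hcont, ?_, ?_, hinj, ?_, ?_, ?_, ?_⟩
  · rw [hfv 0 (no0 0 le_rfl), hP0 0 le_rfl]
  · rw [hfv 1 (no1 1 le_rfl), hP1 1 le_rfl]
  · rintro i _ ⟨s, hs, rfl⟩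
    obtain ⟨t, ht, rfl⟩ := hr_surj i s hs
    exact ⟨t, ⟨(hL0 i).trans ht.1.le, ht.2.le.trans (hR1 i)⟩, hfo i t ht⟩
  · intro e t h
    obtain ⟨i, hi, _⟩ := hedge e t h
    exact ⟨i, hi⟩
  · intro u v hu huv hv
    obtain ⟨i, t, ht, hti⟩ := hdense u v hu huv hv
    exact ⟨t, ht, hnoV i t hti⟩
  · intro hmin
    have key : ∀ t t', t ∈ Icc (0:ℝ) 1 → t' ∈ Icc (0:ℝ) 1 → t < t' → f t ≠ f t' := by
      intro t t' ht ht' hlt heq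
      by_cases hfV : f t ∈ V
      · have n1 : ¬ ∃ i, t ∈ Ioo (L i) (R i) := by
          rintro ⟨i, hi⟩; exact hnoV i t hi hfV
        have n2 : ¬ ∃ i, t' ∈ Ioo (L i) (R i) := by
          rintro ⟨i, hi⟩; exact hnoV i t' hi (heq ▸ hfV)
        have hPP : P t = P t' := by
          rw [hfv t n1, hfv t' n2] at heq; exact Subtype.ext heq
        have hM := hmin {i | t < R i ∧ R i ≤ t'} (by
          intro A hA
          have hu : {i | R i ≤ t'} = {i | R i ≤ t} ∪ {i | t < R i ∧ R i ≤ t'} := by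
            ext i; constructor
            · intro h
              rcases le_or_gt (R i) t with h1 | h1
              · exact Or.inl h1
              · exact Or.inr ⟨h1, h⟩
            · rintro (h | h)
              · exact le_trans h hlt.le
              · exact h.2
          have h1 := hP t A hA
          have h2 := hP t' A hA
          rw [hu, epS_union (hfin A hA)] at h2
          · rw [← hPP, ← add_assoc, ← h1] at h2
            exact (left_eq_add.1 h2)
          · rw [Set.disjoint_left]
            intro i h1 h2
            exact absurd h2.1 (not_lt.2 h1))
        obtain ⟨i, s, hs, hsi⟩ := hdense t t' ht.1 hlt ht'.2
        have : i ∈ {i | t < R i ∧ R i ≤ t'} := by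
          refine ⟨hs.1.trans hsi.2, ?_⟩
          by_contra hc
          exact n2 ⟨i, hsi.1.trans hs.2, not_le.1 hc⟩
        rw [hM] at this; exact this
      · obtain ⟨e, s, hs, hse⟩ := hp.surj _ hfV
        have := hinj e (show f t ∈ γ e '' Ioo (0:ℝ) 1 from ⟨s, hs, hse⟩)
          (show f t' ∈ γ e '' Ioo (0:ℝ) 1 from ⟨s, hs, heq ▸ hse⟩) heq
        exact hlt.ne this
    intro t ht t' ht' heq
    rcases lt_trichotomy t t' with h | h | h
    · exact absurd heq (key t t' ht ht' h)
    · exact h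
    · exact absurd heq.symm (key t' t ht' ht h)


lemma epS_image {W ι κ : Type*} (a b : ι → W) (A : Set W) (j : κ → ι) (hj : Injective j) (M : Set κ) :
    epS (a ∘ j) (b ∘ j) A M = epS a b A (j '' M) := by
  unfold epS
  rw [finsum_mem_image hj.injOn]
  rfl

theorem ep_pathF {X : Type*} [TopologicalSpace X] [CompactSpace X] [T2Space X] {V : Set X}
    (hV : IsClosed V) [TotallyDisconnectedSpace V] {E : Type*} [Countable E] {γ : E → ℝ → X}
    (hp : EpPar V γ) (F : Set E) (x y : V) (hxy : x ≠ y)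
    (par : ∀ A, IsClopen A → epS (epA hp) (epB hp) A F = epInd A x + epInd A y)
    (conn : ∀ A, IsClopen A → x ∈ A → (∀ i ∈ F, epA hp i ∈ A ↔ epB hp i ∈ A) →
      ∀ i ∈ F, epA hp i ∈ A) :
    ∃ f : ℝ → X, Continuous f ∧ f 0 = x ∧ f 1 = y ∧
      (∀ e, InjOn f (f ⁻¹' (γ e '' Ioo (0:ℝ) 1))) ∧
      (∀ e ∈ F, γ e '' Ioo (0:ℝ) 1 ⊆ f '' Icc 0 1) ∧
      (∀ e t, f t ∈ γ e '' Ioo (0:ℝ) 1 → e ∈ F) ∧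
      (∀ u v, 0 ≤ u → u < v → v ≤ 1 → ∃ t ∈ Ioo u v, f t ∉ V) ∧
      ((∀ M ⊆ F, (∀ A, IsClopen A → epS (epA hp) (epB hp) A M = 0) → M = ∅) →
        InjOn f (Icc 0 1)) := by
  classical
  have hVc : CompactSpace V := isCompact_iff_compactSpace.1 hV.isCompact
  have hj : Injective (Subtype.val : F → E) := Subtype.val_injective
  have par' : ∀ A, IsClopen A → epS (epA hp ∘ (Subtype.val : F → E))
      (epB hp ∘ (Subtype.val : F → E)) A univ = epInd A x + epInd A y := by
    intro A hA
    rw [epS_image _ _ _ _ hj, image_univ, Subtype.range_coe]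
    exact par A hA
  have hFne : Nonempty F := by
    by_contra hc
    rw [not_nonempty_iff] at hc
    apply hxy
    apply ep_clopen_ext
    intro A hA
    apply epZ_eq_of_add
    rw [← par' A hA, univ_eq_empty_iff.2 hc, epS_empty]
  obtain ⟨lt, o, h1, h2, h3, h4⟩ := ep_order (epA hp ∘ (Subtype.val : F → E))
    (epB hp ∘ (Subtype.val : F → E))
    (fun A hA => (ep_cutFin hV hp A hA).preimage hj.injOn) x y par'
    (fun A hA hxA h i => conn A hA hxA (fun i hi => h ⟨i, hi⟩) i i.2)
  have hsto : IsStrictTotalOrder F lt :=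
    { irrefl := h1
      trans := h2
      trichotomous := fun i k hik hki => by
        rcases h3 i k with h | h | h
        · exact h
        · exact absurd h hik
        · exact absurd h hki }
  let lo : LinearOrder F := linearOrderOfSTO lt
  obtain ⟨f, q1, q2, q3, q4, q5, q6, q7, q8⟩ := ep_path hV hp (Subtype.val : F → E) hj o x y h4 par'
  refine ⟨f, q1, q2, q3, q4, fun e he => q5 ⟨e, he⟩, ?_, q7, ?_⟩
  · intro e t h
    obtain ⟨i, rfl⟩ := q6 e t h
    exact i.2
  · intro hmin
    apply q8
    intro M hM
    have := hmin (Subtype.val '' M) (by rintro _ ⟨i, _, rfl⟩; exact i.2) (fun A hA => by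
      rw [← epS_image _ _ _ _ hj]; exact hM A hA)
    exact image_eq_empty.1 this

theorem ep_arc {X : Type*} [TopologicalSpace X] [CompactSpace X] [T2Space X] {V : Set X}
    (hV : IsClosed V) [TotallyDisconnectedSpace V] {E : Type*} [Countable E] {γ : E → ℝ → X}
    (hp : EpPar V γ) (F0 : Set E) (v : V) (A : Set V) (hA : IsClopen A) (hv : v ∈ A)
    (hcr : ∀ D, IsClopen D → v ∈ D → D ⊆ A → ∃ i ∈ F0, ¬ (epA hp i ∈ D ↔ epB hp i ∈ D)) :
    ∃ f : unitInterval → X, Continuous f ∧ Injective f ∧ f 0 = v ∧ (∃ y : V, y ∉ A ∧ f 1 = y) ∧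
      ∀ e t, f t ∈ γ e '' Ioo (0:ℝ) 1 → e ∈ F0 := by
  have hVc : CompactSpace V := isCompact_iff_compactSpace.1 hV.isCompact
  obtain ⟨y, hyB, hsep⟩ := ep_notSep (epA hp) (epB hp) F0 v Aᶜ hA.compl.isClosed
    (fun D hD hvD hdis => hcr D hD hvD (by rwa [disjoint_compl_right_iff_subset] at hdis))
  obtain ⟨F, hF, par, hmin, conn⟩ := ep_minSub (epA hp) (epB hp) (ep_cutFin hV hp) F0 v y hsep
  obtain ⟨f, q1, q2, q3, q4, q5, q6, q7, q8⟩ := ep_pathF hV hp F v y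
    (by rintro rfl; exact hyB hv) par conn
  refine ⟨fun t => f t, q1.comp continuous_subtype_val, ?_, by simpa using q2, ⟨y, hyB, by simpa using q3⟩, ?_⟩
  · intro t t' h
    exact Subtype.ext (q8 hmin t.2 t'.2 h)
  · intro e t h
    exact hF (q6 e t h)

lemma ep_unit {X : Type*} [TopologicalSpace X] [CompactSpace X] [T2Space X] {V : Set X}
    (hV : IsClosed V) {E : Type*} {γ : E → ℝ → X} (hp : EpPar V γ)
    (f : unitInterval → X) (hf : Continuous f) (h0 : f 0 ∈ V) (h1 : f 1 ∈ V)
    (hinj : ∀ e, InjOn f (f ⁻¹' (γ e '' Ioo (0:ℝ) 1))) :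
    (∀ e t, f t ∈ γ e '' Ioo (0:ℝ) 1 → γ e '' Ioo (0:ℝ) 1 ⊆ range f) ∧
    ∀ A, IsClopen A → epS (epA hp) (epB hp) A {e | ∃ t, f t ∈ γ e '' Ioo (0:ℝ) 1} =
      epInd A ⟨f 0, h0⟩ + epInd A ⟨f 1, h1⟩ := by
  let g : ℝ → X := IccExtend zero_le_one f
  have hg : Continuous g := hf.Icc_extend'
  have hgt : ∀ t (ht : t ∈ Icc (0:ℝ) 1), g t = f ⟨t, ht⟩ := fun t ht => IccExtend_of_mem _ _ ht
  have g0 : g 0 = f 0 := hgt 0 (by simp)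
  have g1 : g 1 = f 1 := hgt 1 (by simp)
  have hginj : ∀ e, InjOn g (Icc 0 1 ∩ g ⁻¹' (γ e '' Ioo (0:ℝ) 1)) := by
    rintro e t ⟨ht, hte⟩ t' ⟨ht', hte'⟩ heq
    have hte : g t ∈ γ e '' Ioo (0:ℝ) 1 := hte
    have hte' : g t' ∈ γ e '' Ioo (0:ℝ) 1 := hte'
    rw [hgt t ht] at hte heq
    rw [hgt t' ht'] at hte' heq
    have := hinj e hte hte' heq
    exact congrArg Subtype.val this
  constructor
  · intro e t ht
    obtain ⟨c, d, hc, _, hd, _, hsub, _⟩ := ep_run hp g hg 0 1 (g0 ▸ h0) (g1 ▸ h1) e (hginj e) t t.2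
      (by rw [hgt t t.2]; exact ht)
    intro z hz
    obtain ⟨s, hs, rfl⟩ := hsub hz
    exact ⟨⟨s, hc.trans hs.1.le, hs.2.le.trans hd⟩, (hgt s _).symm⟩
  · intro A hA
    have := ep_parity hV hp g hg A hA _ 0 1 (g0 ▸ h0) (g1 ▸ h1) zero_le_one hginj rfl
    have e1 : epHit γ g 0 1 = {e | ∃ t, f t ∈ γ e '' Ioo (0:ℝ) 1} := by
      ext e; constructor
      · rintro ⟨t, ht, h⟩; exact ⟨⟨t, ht⟩, by rwa [hgt t ht] at h⟩
      · rintro ⟨t, h⟩; exact ⟨t, t.2, by rw [hgt t t.2]; exact h⟩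
    rw [e1] at this
    rw [this]
    congr 2
    · exact Subtype.ext g0
    · exact Subtype.ext g1

lemma ep_card {W ι : Type*} (a b : ι → W) (A : Set W) (h : (support (epChi a b A)).Finite) :
    ((support (epChi a b A)).ncard : ZMod 2) = epS a b A univ := by
  rw [epS_eq_sum' h.toFinset (fun i hi => by simpa using hi), ncard_eq_toFinset_card _ h,
    Finset.sum_congr rfl (g := fun _ => (1 : ZMod 2))]
  · simp
  · intro i hi
    have : epChi a b A i ≠ 0 := by simpa using hi
    exact (epZ_cases _).resolve_left this


lemma ep_clopenIn {X : Type*} [TopologicalSpace X] (G : GraphLike X) (C : Set X) :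
    G.ClopenIn C ↔ ∃ A : Set G.V, IsClopen A ∧ C = Subtype.val '' A := by
  have hcl : IsClosedEmbedding (Subtype.val : G.V → X) := G.closedV.isClosedEmbedding_subtypeVal
  constructor
  · rintro ⟨h1, h2, h3⟩
    refine ⟨Subtype.val ⁻¹' C, ⟨h2.preimage continuous_subtype_val, ?_⟩, ?_⟩
    · have := h3.preimage (continuous_subtype_val (p := fun z => z ∈ G.V))
      rw [← isClosed_compl_iff]
      convert this using 1
      ext z; simp
    · ext z; simp only [mem_image, mem_preimage]
      constructor
      · intro hz; exact ⟨⟨z, h1 hz⟩, hz, rfl⟩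
      · rintro ⟨w, hw, rfl⟩; exact hw
  · rintro ⟨A, hA, rfl⟩
    refine ⟨by rintro _ ⟨w, _, rfl⟩; exact w.2, hcl.isClosedMap _ hA.isClosed, ?_⟩
    have : G.V \ (Subtype.val '' A) = Subtype.val '' Aᶜ := by
      ext z
      constructor
      · rintro ⟨hz, hn⟩
        exact ⟨⟨z, hz⟩, fun h => hn ⟨_, h, rfl⟩, rfl⟩
      · rintro ⟨w, hw, rfl⟩
        refine ⟨w.2, ?_⟩
        rintro ⟨w', hw', h⟩
        exact hw (Subtype.ext h ▸ hw')
    rw [this]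
    exact hcl.isClosedMap _ hA.compl.isClosed

lemma epS_ne {W ι : Type*} {a b : ι → W} {A : Set W} {M : Set ι} (h : epS a b A M ≠ 0) :
    ∃ i ∈ M, epChi a b A i ≠ 0 := by
  by_contra hc
  push Not at hc
  apply h
  rw [← epS_empty (a := a) (b := b) (A := A)]
  apply epS_congr
  intro i hi
  exact ⟨fun hm => absurd (hc i hm) hi, fun hm => absurd hm (by simp)⟩

lemma ep_hits {X : Type*} [TopologicalSpace X] [CompactSpace X] [T2Space X] (G : GraphLike X)
    {E : Type*} {γ : E → ℝ → X} (hp : EpPar G.V γ) (v : G.V) (A : Set G.V) (n : ℕ)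
    (f : Fin n → unitInterval → X)
    (hf : ∀ i, Continuous (f i) ∧ Function.Injective (f i) ∧ f i 0 ∈ ({(v : X)} : Set X) ∧
      f i 1 ∈ G.V \ (Subtype.val '' A))
    (hd : ∀ i j, i ≠ j → ∀ e, G.IsEdge e → ¬(e ⊆ Set.range (f i) ∧ e ⊆ Set.range (f j))) :
    (∀ i j, i ≠ j → Disjoint {e | ∃ t, f i t ∈ γ e '' Ioo (0:ℝ) 1}
      {e | ∃ t, f j t ∈ γ e '' Ioo (0:ℝ) 1}) ∧
    ∀ i D, IsClopen D → v ∈ D → D ⊆ A →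
      epS (epA hp) (epB hp) D {e | ∃ t, f i t ∈ γ e '' Ioo (0:ℝ) 1} = 1 := by
  have h0 : ∀ i, f i 0 ∈ G.V := fun i => by
    have := (hf i).2.2.1; rw [mem_singleton_iff] at this; rw [this]; exact v.2
  have hu := fun i => ep_unit G.closedV hp (f i) (hf i).1 (h0 i) (hf i).2.2.2.1
    (fun e => (hf i).2.1.injOn)
  constructor
  · intro i j hij
    rw [Set.disjoint_left]
    rintro e ⟨t, ht⟩ ⟨t', ht'⟩
    exact hd i j hij _ ((ep_isEdge G hp _).2 ⟨e, rfl⟩) ⟨(hu i).1 e t ht, (hu j).1 e t' ht'⟩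
  · intro i D hD hvD hDA
    rw [(hu i).2 D hD, epInd_mem, epInd_not_mem, add_zero]
    · intro h; exact (hf i).2.2.2.2 ⟨_, hDA h, rfl⟩
    · convert hvD
      exact (hf i).2.2.1

lemma ep_conn_le {X : Type*} [TopologicalSpace X] [CompactSpace X] [T2Space X] (G : GraphLike X)
    {E : Type*} {γ : E → ℝ → X} (hp : EpPar G.V γ) (v : G.V) (A : Set G.V) (hA : IsClopen A)
    (hv : v ∈ A) (n : ℕ) (hn : n ∈ G.arcConn {(v : X)} (G.V \ (Subtype.val '' A))) :
    n ≤ (support (epChi (epA hp) (epB hp) A)).ncard := by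
  obtain ⟨f, hf, hd⟩ := hn
  obtain ⟨h1, h2⟩ := ep_hits G hp v A n f hf hd
  have h3 : ∀ i, ∃ e, (∃ t, f i t ∈ γ e '' Ioo (0:ℝ) 1) ∧ epChi (epA hp) (epB hp) A e ≠ 0 := by
    intro i
    obtain ⟨e, he, hc⟩ := epS_ne (a := epA hp) (b := epB hp) (A := A) (M := {e | ∃ t, f i t ∈ γ e '' Ioo (0:ℝ) 1})
      (by rw [h2 i A hA hv subset_rfl]; exact one_ne_zero)
    exact ⟨e, he, hc⟩
  choose c hc1 hc2 using h3
  have hinj : Injective c := by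
    intro i j hij
    by_contra hne
    exact Set.disjoint_left.1 (h1 i j hne) (hc1 i) (hij ▸ hc1 j)
  have hfin := ep_cutFin G.closedV hp A hA
  have : (range c).ncard = n := by
    rw [← image_univ, ncard_image_of_injective _ hinj, ncard_univ, Nat.card_eq_fintype_card, Fintype.card_fin]
  rw [← this]
  apply ncard_le_ncard _ hfin
  rintro _ ⟨i, rfl⟩
  exact hc2 i

lemma ep_conn_succ {X : Type*} [TopologicalSpace X] [CompactSpace X] [T2Space X] (G : GraphLike X)
    {E : Type*} [Countable E] {γ : E → ℝ → X} (hp : EpPar G.V γ) (v : G.V) (A : Set G.V)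
    (hA : IsClopen A)
    (hv : v ∈ A) (n : ℕ) (hn : n ∈ G.arcConn {(v : X)} (G.V \ (Subtype.val '' A)))
    (hne : ∀ D, IsClopen D → v ∈ D → D ⊆ A → epS (epA hp) (epB hp) D univ ≠ (n : ZMod 2)) :
    n + 1 ∈ G.arcConn {(v : X)} (G.V \ (Subtype.val '' A)) := by
  classical
  have := G.zeroDimV
  obtain ⟨f, hf, hd⟩ := hn
  obtain ⟨h1, h2⟩ := ep_hits G hp v A n f hf hd
  set H : Fin n → Set E := fun i => {e | ∃ t, f i t ∈ γ e '' Ioo (0:ℝ) 1} with hH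
  have hsum : ∀ D, IsClopen D → v ∈ D → D ⊆ A →
      epS (epA hp) (epB hp) D (⋃ i, H i) = n := by
    intro D hD hvD hDA
    have : ∀ s : Finset (Fin n), epS (epA hp) (epB hp) D (⋃ i ∈ s, H i) = (s.card : ZMod 2) := by
      intro s
      induction s using Finset.induction_on with
      | empty => simp [epS_empty]
      | insert i s hi ih =>
        rw [Finset.set_biUnion_insert, epS_union (ep_cutFin G.closedV hp D hD), ih,
          Finset.card_insert_of_notMem hi, h2 i D hD hvD hDA]
        · push_cast; ring
        · rw [Set.disjoint_iUnion₂_right]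
          intro j hj
          exact h1 i j (by rintro rfl; exact hi hj)
    simpa using this Finset.univ
  obtain ⟨g, g1, g2, g3, ⟨y, hyA, g4⟩, g5⟩ := ep_arc G.closedV hp (⋃ i, H i)ᶜ v A hA hv (by
    intro D hD hvD hDA
    by_contra hc
    push Not at hc
    apply hne D hD hvD hDA
    rw [← hsum D hD hvD hDA]
    apply epS_congr
    intro i hi
    refine ⟨fun _ => ?_, fun _ => mem_univ _⟩
    by_contra hiU
    exact hi (epChi_eq_zero_iff.2 (hc i hiU)))
  have key : ∀ i e, G.IsEdge e → ¬ (e ⊆ range g ∧ e ⊆ range (f i)) := by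
    rintro i s hs ⟨hs1, hs2⟩
    obtain ⟨e, rfl⟩ := (ep_isEdge G hp s).1 hs
    have hz : γ e (1/2) ∈ γ e '' Ioo (0:ℝ) 1 := ⟨1/2, by norm_num, rfl⟩
    obtain ⟨t, ht⟩ := hs1 hz
    obtain ⟨t', ht'⟩ := hs2 hz
    exact g5 e t (ht ▸ hz) (mem_iUnion.2 ⟨i, t', ht' ▸ hz⟩)
  refine ⟨Fin.cons g f, ?_, ?_⟩
  · intro i
    refine Fin.cases ?_ (fun i => ?_) i
    · simp only [Fin.cons_zero]
      refine ⟨g1, g2, g3, by rw [g4]; exact y.2, ?_⟩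
      rintro ⟨w, hw, h⟩
      exact hyA (Subtype.ext (h.trans g4) ▸ hw)
    · simpa only [Fin.cons_succ] using hf i
  · intro i j
    refine Fin.cases ?_ (fun i => ?_) i <;> refine Fin.cases ?_ (fun j => ?_) j
    · intro h; exact absurd rfl h
    · intro _ e he; simpa only [Fin.cons_zero, Fin.cons_succ] using key j e he
    · intro _ e he; simp only [Fin.cons_zero, Fin.cons_succ]; rw [and_comm]; exact key i e he
    · intro h e he; simp only [Fin.cons_succ]; exact hd i j (fun h' => h (by rw [h'])) e he

lemma ep_conn_menger {X : Type*} [TopologicalSpace X] [CompactSpace X] [T2Space X] (G : GraphLike X)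
    {E : Type*} [Countable E] {γ : E → ℝ → X} (hp : EpPar G.V γ) (v : G.V) (A : Set G.V)
    (hA : IsClopen A) (hv : v ∈ A) (k : ℕ)
    (hk : ∀ D, IsClopen D → v ∈ D → D ⊆ A → k ≤ (support (epChi (epA hp) (epB hp) D)).ncard) :
    k ∈ G.arcConn {(v : X)} (G.V \ (Subtype.val '' A)) := by
  have := G.zeroDimV
  obtain ⟨c, hc⟩ := ep_menger (epA hp) (epB hp) (ep_cutFin G.closedV hp) v A hA hv k hk
  have h := fun j : Fin k => ep_arc G.closedV hp {i | c i = j} v A hA hv (by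
    intro D hD hvD hDA
    obtain ⟨i, hi, hci⟩ := hc D hD hvD hDA j j.2
    exact ⟨i, hci, fun h => hi (epChi_eq_zero_iff.2 h)⟩)
  choose f f1 f2 f3 f4 f5 using h
  refine ⟨f, fun i => ⟨f1 i, f2 i, f3 i, ?_⟩, ?_⟩
  · obtain ⟨y, hyA, g4⟩ := f4 i
    refine ⟨by rw [g4]; exact y.2, ?_⟩
    rintro ⟨w, hw, h⟩
    exact hyA (Subtype.ext (h.trans g4) ▸ hw)
  · rintro i j hij s hs ⟨hs1, hs2⟩
    obtain ⟨e, rfl⟩ := (ep_isEdge G hp s).1 hs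
    have hz : γ e (1/2) ∈ γ e '' Ioo (0:ℝ) 1 := ⟨1/2, by norm_num, rfl⟩
    obtain ⟨t, ht⟩ := hs1 hz
    obtain ⟨t', ht'⟩ := hs2 hz
    have h1 : c e = i := f5 i e t (ht ▸ hz)
    have h2 : c e = j := f5 j e t' (ht' ▸ hz)
    exact hij (Fin.ext (h1.symm.trans h2))

lemma ep_conn_parity {X : Type*} [TopologicalSpace X] [CompactSpace X] [T2Space X] (G : GraphLike X)
    {E : Type*} [Countable E] {γ : E → ℝ → X} (hp : EpPar G.V γ) (v : G.V) (A : Set G.V)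
    (hA : IsClopen A) (hv : v ∈ A) (z : ZMod 2)
    (hz : ∀ D, IsClopen D → v ∈ D → D ⊆ A → epS (epA hp) (epB hp) D univ = z) :
    ∃ m, IsGreatest (G.arcConn {(v : X)} (G.V \ (Subtype.val '' A))) m ∧ (m : ZMod 2) = z := by
  classical
  set N := (support (epChi (epA hp) (epB hp) A)).ncard
  set S := G.arcConn {(v : X)} (G.V \ (Subtype.val '' A))
  have hbd : ∀ n ∈ S, n ≤ N := fun n hn => ep_conn_le G hp v A hA hv n hn
  have h0 : 0 ∈ S := ⟨fun i => i.elim0, fun i => i.elim0, fun i => i.elim0⟩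
  have hg : IsGreatest S (Nat.findGreatest (· ∈ S) N) :=
    ⟨Nat.findGreatest_spec (P := (· ∈ S)) (Nat.zero_le N) h0, fun n hn => Nat.le_findGreatest (hbd n hn) hn⟩
  refine ⟨_, hg, ?_⟩
  by_contra hne
  have := hg.2 (ep_conn_succ G hp v A hA hv _ hg.1 (fun D hD hvD hDA => by
    rw [hz D hD hvD hDA]; exact fun h => hne h.symm))
  omega

lemma ep_not_both {X : Type*} [TopologicalSpace X] (G : GraphLike X) (v : X)
    (h1 : G.StronglyEvenDegree v) (h2 : G.StronglyOddDegree v) : False := by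
  obtain ⟨C, hC, hvC, h⟩ := h1
  obtain ⟨C', hC', hvC', h'⟩ := h2
  have hCC : G.ClopenIn (C ∩ C') := by
    rw [ep_clopenIn] at *
    obtain ⟨A, hA, rfl⟩ := hC
    obtain ⟨B, hB, rfl⟩ := hC'
    exact ⟨A ∩ B, hA.inter hB, (image_inter Subtype.val_injective).symm⟩
  obtain ⟨m, hm, he⟩ := h _ hCC ⟨hvC, hvC'⟩ inter_subset_left
  obtain ⟨m', hm', ho⟩ := h' _ hCC ⟨hvC, hvC'⟩ inter_subset_right
  rw [hm.unique hm'] at he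
  exact (Nat.not_even_iff_odd.2 ho) he

lemma ep_avoid {V : Type*} [TopologicalSpace V] [CompactSpace V] [T2Space V]
    [TotallyDisconnectedSpace V] (v x y : V) :
    ∃ C : Set V, IsClopen C ∧ v ∈ C ∧ (x ∈ C → x = v) ∧ (y ∈ C → y = v) := by
  obtain ⟨C, hC, hvC, hCU⟩ := compact_exists_isClopen_in_isOpen (x := v)
    (U := ({x, y} \ {v} : Set V)ᶜ) (Set.Finite.isClosed (by
      exact (Set.toFinite {x, y}).subset sdiff_subset)).isOpen_compl (by simp)
  refine ⟨C, hC, hvC, fun h => ?_, fun h => ?_⟩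
  · by_contra hne; exact hCU h (by simp [hne])
  · by_contra hne; exact hCU h (by simp [hne])


open Classical in
lemma ep_subm {ι : Type*} (SA SB SC SD : Set ι) (hA : SA.Finite) (hB : SB.Finite)
    (h : ∀ i, ((if i ∈ SC then 1 else 0 : ℕ) + if i ∈ SD then 1 else 0) ≤
      (if i ∈ SA then 1 else 0) + if i ∈ SB then 1 else 0) :
    SC.ncard + SD.ncard ≤ SA.ncard + SB.ncard := by
  have hT : (SA ∪ SB).Finite := hA.union hB
  have key : ∀ S : Set ι, S ⊆ SA ∪ SB → S.ncard = ∑ i ∈ hT.toFinset, if i ∈ S then 1 else 0 := by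
    intro S hS
    rw [← Finset.card_filter, ← ncard_coe_finset]
    congr 1
    ext i
    simp only [Finset.coe_filter, Finite.mem_toFinset, mem_ofPred_eq]
    exact ⟨fun hi => ⟨hS hi, hi⟩, fun hi => hi.2⟩
  have hC : SC ⊆ SA ∪ SB := by
    intro i hi
    by_contra hn
    have := h i
    simp only [mem_union, not_or] at hn
    simp [hi, hn.1, hn.2] at this
  have hD : SD ⊆ SA ∪ SB := by
    intro i hi
    by_contra hn
    have := h i
    simp only [mem_union, not_or] at hn
    simp [hi, hn.1, hn.2] at this
  rw [key SA subset_union_left, key SB subset_union_right, key SC hC, key SD hD,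
    ← Finset.sum_add_distrib, ← Finset.sum_add_distrib]
  exact Finset.sum_le_sum fun i _ => h i

lemma ep_sub {W ι : Type*} (a b : ι → W) (A B : Set W) (hA : (support (epChi a b A)).Finite)
    (hB : (support (epChi a b B)).Finite) :
    (support (epChi a b (A ∩ B))).ncard + (support (epChi a b (A ∪ B))).ncard ≤
      (support (epChi a b A)).ncard + (support (epChi a b B)).ncard := by
  classical
  apply ep_subm _ _ _ _ hA hB
  intro i
  simp only [mem_support, ne_eq, epChi_eq_zero_iff, mem_inter_iff, mem_union]
  by_cases h1 : a i ∈ A <;> by_cases h2 : b i ∈ A <;> by_cases h3 : a i ∈ B <;>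
    by_cases h4 : b i ∈ B <;> simp [h1, h2, h3, h4]

lemma ep_pos {W ι : Type*} (a b : ι → W) (A B : Set W) (hA : (support (epChi a b A)).Finite)
    (hB : (support (epChi a b B)).Finite) :
    (support (epChi a b (A \ B))).ncard + (support (epChi a b (B \ A))).ncard ≤
      (support (epChi a b A)).ncard + (support (epChi a b B)).ncard := by
  classical
  apply ep_subm _ _ _ _ hA hB
  intro i
  simp only [mem_support, ne_eq, epChi_eq_zero_iff, Set.mem_sdiff]
  by_cases h1 : a i ∈ A <;> by_cases h2 : b i ∈ A <;> by_cases h3 : a i ∈ B <;>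
    by_cases h4 : b i ∈ B <;> simp [h1, h2, h3, h4]

lemma epInd_union {W : Type*} (A B : Set W) (h : Disjoint A B) (w : W) :
    epInd (A ∪ B) w = epInd A w + epInd B w := by
  have : w ∈ A → w ∉ B := fun h1 => Set.disjoint_left.1 h h1
  by_cases h1 : w ∈ A <;> by_cases h2 : w ∈ B <;> simp_all [epInd]

lemma epS_add {V ι : Type*} (a b : ι → V) (A B : Set V)
    (hA : (support (epChi a b A)).Finite) (hB : (support (epChi a b B)).Finite)
    (h : Disjoint A B) : epS a b (A ∪ B) univ = epS a b A univ + epS a b B univ := by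
  unfold epS
  rw [finsum_mem_univ, finsum_mem_univ, finsum_mem_univ, ← finsum_add_distrib hA hB]
  congr 1; ext i
  simp only [epChi, epInd_union A B h]
  ring

theorem ep_forward {X : Type*} [TopologicalSpace X] [CompactSpace X] [T2Space X] (G : GraphLike X)
    {E : Type*} [Countable E] {γ : E → ℝ → X} (hp : EpPar G.V γ)
    (f : unitInterval → X) (hf : G.IsOpenEulerianPath f) :
    ∃ x y, x ∈ G.V ∧ y ∈ G.V ∧ x ≠ y ∧ {v ∈ G.V | G.StronglyOddDegree v} = {x, y} ∧
      ∀ v ∈ G.V, v ≠ x → v ≠ y → G.StronglyEvenDegree v := by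
  have := G.zeroDimV
  have hVc : CompactSpace G.V := isCompact_iff_compactSpace.1 G.closedV.isCompact
  obtain ⟨⟨f1, f2, f3, f4, f5⟩, hne, hE⟩ := hf
  obtain ⟨-, hu⟩ := ep_unit G.closedV hp f f1 f2 f3 (fun e => f4 _ ((ep_isEdge G hp _).2 ⟨e, rfl⟩))
  have huniv : {e | ∃ t, f t ∈ γ e '' Ioo (0:ℝ) 1} = univ := by
    ext e
    simp only [mem_univ, iff_true]
    have hz : γ e (1/2) ∈ γ e '' Ioo (0:ℝ) 1 := ⟨1/2, by norm_num, rfl⟩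
    obtain ⟨t, ht⟩ := hE _ ((ep_isEdge G hp _).2 ⟨e, rfl⟩) hz
    exact ⟨t, ht ▸ hz⟩
  rw [huniv] at hu
  set x : G.V := ⟨f 0, f2⟩ with hx
  set y : G.V := ⟨f 1, f3⟩ with hy
  have hxy : x ≠ y := fun h => hne (congrArg Subtype.val h)
  have main : ∀ v : G.V, ∃ C : Set G.V, IsClopen C ∧ v ∈ C ∧ ∀ A, IsClopen A → v ∈ A → A ⊆ C →
      ∃ m, IsGreatest (G.arcConn {(v : X)} (G.V \ (Subtype.val '' A))) m ∧
        (m : ZMod 2) = epInd {x, y} v := by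
    intro v
    obtain ⟨C, hC, hvC, hxC, hyC⟩ := ep_avoid v x y
    refine ⟨C, hC, hvC, fun A hA hvA hAC => ep_conn_parity G hp v A hA hvA _ ?_⟩
    intro D hD hvD hDA
    rw [hu D hD]
    have hxD : x ∈ D ↔ x = v := ⟨fun h => hxC (hAC (hDA h)), fun h => h ▸ hvD⟩
    have hyD : y ∈ D ↔ y = v := ⟨fun h => hyC (hAC (hDA h)), fun h => h ▸ hvD⟩
    by_cases h1 : x = v
    · have h2 : y ≠ v := fun h => hxy (h1.trans h.symm)
      rw [epInd_mem (hxD.2 h1), epInd_not_mem (fun h => h2 (hyD.1 h)), epInd_mem (by simp [h1]), add_zero]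
    · by_cases h2 : y = v
      · rw [epInd_mem (hyD.2 h2), epInd_not_mem (fun h => h1 (hxD.1 h)), epInd_mem (by simp [h2]), zero_add]
      · rw [epInd_not_mem (fun h => h1 (hxD.1 h)), epInd_not_mem (fun h => h2 (hyD.1 h)), epInd_not_mem, add_zero]
        rintro (h | h)
        · exact h1 h.symm
        · exact h2 (mem_singleton_iff.1 h).symm
  have conv : ∀ (v : G.V) (P : ℕ → Prop), (∀ m : ℕ, (m : ZMod 2) = epInd {x, y} v → P m) →
      ∃ C, G.ClopenIn C ∧ (v : X) ∈ C ∧ ∀ A, G.ClopenIn A → (v : X) ∈ A → A ⊆ C →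
      ∃ m, IsGreatest (G.arcConn {(v : X)} (G.V \ A)) m ∧ P m := by
    intro v P hP
    obtain ⟨C, hC, hvC, h⟩ := main v
    refine ⟨Subtype.val '' C, (ep_clopenIn G _).2 ⟨C, hC, rfl⟩, ⟨v, hvC, rfl⟩, ?_⟩
    intro A hA hvA hAC
    obtain ⟨A, hA2, rfl⟩ := (ep_clopenIn G _).1 hA
    obtain ⟨m, hm, hm'⟩ := h A hA2 (by obtain ⟨w, hw, h⟩ := hvA; exact Subtype.ext h ▸ hw)
      ((image_subset_image_iff Subtype.val_injective).1 hAC)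
    exact ⟨m, hm, hP m hm'⟩
  have hodd : ∀ v : G.V, v = x ∨ v = y → G.StronglyOddDegree v := by
    intro v hv
    refine conv v _ fun m hm => ?_
    rw [epInd_mem (by simpa using hv)] at hm
    exact ZMod.natCast_eq_one_iff_odd.1 hm
  have heven : ∀ v : G.V, v ≠ x → v ≠ y → G.StronglyEvenDegree v := by
    intro v hv hv'
    refine conv v _ fun m hm => ?_
    rw [epInd_not_mem (by simp [hv, hv'])] at hm
    exact (ZMod.natCast_eq_zero_iff_even).1 hm
  refine ⟨f 0, f 1, f2, f3, hne, ?_, ?_⟩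
  · ext v
    constructor
    · rintro ⟨hvV, ho⟩
      by_contra hn
      simp only [mem_insert_iff, mem_singleton_iff, not_or] at hn
      exact ep_not_both G v (heven ⟨v, hvV⟩ (fun h => hn.1 (congrArg Subtype.val h))
        (fun h => hn.2 (congrArg Subtype.val h))) ho
    · rintro (rfl | h)
      · exact ⟨f2, hodd x (Or.inl rfl)⟩
      · rw [mem_singleton_iff] at h; subst h
        exact ⟨f3, hodd y (Or.inr rfl)⟩
  · intro v hv h1 h2
    exact heven ⟨v, hv⟩ (fun h => h1 (congrArg Subtype.val h)) (fun h => h2 (congrArg Subtype.val h))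

theorem ep_backward_par {X : Type*} [TopologicalSpace X] [CompactSpace X] [T2Space X]
    [SecondCountableTopology X] (G : GraphLike X)
    {E : Type*} [Countable E] {γ : E → ℝ → X} (hp : EpPar G.V γ) (x y : G.V) (hxy : x ≠ y)
    (hx : G.StronglyOddDegree x) (hy : G.StronglyOddDegree y)
    (hev : ∀ v : G.V, v ≠ x → v ≠ y → G.StronglyEvenDegree v) (D : Set G.V) (hD : IsClopen D) :
    epS (epA hp) (epB hp) D univ = epInd D x + epInd D y := by
  have := G.zeroDimV
  have hVc : CompactSpace G.V := isCompact_iff_compactSpace.1 G.closedV.isCompact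
  have hfin := ep_cutFin G.closedV hp
  by_contra hne
  let φ : Set G.V → ZMod 2 := fun A => epS (epA hp) (epB hp) A univ + (epInd A x + epInd A y)
  have hφ : EpAdd φ := by
    intro A B hA hB hAB
    show epS (epA hp) (epB hp) (A ∪ B) univ + (epInd (A ∪ B) x + epInd (A ∪ B) y) = _
    rw [epS_add _ _ A B (hfin A hA) (hfin B hB) hAB, epInd_union A B hAB, epInd_union A B hAB]
    simp only [φ]; ring
  have hcount : Countable (TopologicalSpace.Clopens G.V) :=
    TopologicalSpace.Clopens.countable_iff_secondCountable.2 inferInstance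
  obtain ⟨Cs, hCs⟩ := exists_surjective_nat (TopologicalSpace.Clopens G.V)
  obtain ⟨v, hv⟩ := ep_bb (fun n => (Cs n : Set G.V)) (fun n => (Cs n).isClopen)
    (fun C hC => by obtain ⟨n, hn⟩ := hCs ⟨C, hC⟩; exact ⟨n, by rw [hn]; rfl⟩)
    (fun A => (support (epChi (epA hp) (epB hp) A)).ncard)
    (fun A B hA hB => ep_sub _ _ A B (hfin A hA) (hfin B hB))
    (fun A B hA hB => ep_pos _ _ A B (hfin A hA) (hfin B hB)) φ hφ D hD
    ((epZ_cases _).resolve_left (fun h => hne (epZ_eq_of_add _ _ h)))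
  obtain ⟨C0, hC0, hvC0, hxC, hyC⟩ := ep_avoid v x y
  have main : ∀ C : Set G.V, IsClopen C → v ∈ C → ∃ A, IsClopen A ∧ v ∈ A ∧ A ⊆ C ∧
      ∀ m, IsGreatest (G.arcConn {(v : X)} (G.V \ (Subtype.val '' A))) m →
        (m : ZMod 2) = 1 + epInd {x, y} v := by
    intro C hC hvC
    obtain ⟨A, hA, hvA, hAC, h1, hmin⟩ := hv (C ∩ C0) (hC.inter hC0) ⟨hvC, hvC0⟩
    refine ⟨A, hA, hvA, fun z hz => (hAC hz).1, fun m hm => ?_⟩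
    have hg := ep_conn_menger G hp v A hA hvA _ hmin
    have hm' : m = (support (epChi (epA hp) (epB hp) A)).ncard :=
      le_antisymm (ep_conn_le G hp v A hA hvA m hm.1) (hm.2 hg)
    rw [hm', ep_card _ _ _ (hfin A hA)]
    have h1' : epS (epA hp) (epB hp) A univ + (epInd A x + epInd A y) = 1 := h1
    have hxD : x ∈ A ↔ x = v := ⟨fun h => hxC (hAC h).2, fun h => h ▸ hvA⟩
    have hyD : y ∈ A ↔ y = v := ⟨fun h => hyC (hAC h).2, fun h => h ▸ hvA⟩
    have h2 : epInd A x + epInd A y = epInd {x, y} v := by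
      by_cases h1 : x = v
      · have h2 : y ≠ v := fun h => hxy (h1.trans h.symm)
        rw [epInd_mem (hxD.2 h1), epInd_not_mem (fun h => h2 (hyD.1 h)), epInd_mem (by simp [h1]), add_zero]
      · by_cases h2 : y = v
        · rw [epInd_mem (hyD.2 h2), epInd_not_mem (fun h => h1 (hxD.1 h)), epInd_mem (by simp [h2]), zero_add]
        · rw [epInd_not_mem (fun h => h1 (hxD.1 h)), epInd_not_mem (fun h => h2 (hyD.1 h)), epInd_not_mem, add_zero]
          rintro (h | h)
          · exact h1 h.symm
          · exact h2 (mem_singleton_iff.1 h).symm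
    rw [h2] at h1'
    have h3 := epZ_self (epInd {x, y} v)
    linear_combination h1' - h3
  have conv : ∀ P : ℕ → Prop, (∃ C, G.ClopenIn C ∧ (v : X) ∈ C ∧ ∀ A, G.ClopenIn A → (v : X) ∈ A →
      A ⊆ C → ∃ m, IsGreatest (G.arcConn {(v : X)} (G.V \ A)) m ∧ P m) →
      ∃ m : ℕ, P m ∧ (m : ZMod 2) = 1 + epInd {x, y} v := by
    rintro P ⟨C, hC, hvC, h⟩
    obtain ⟨C, hC2, rfl⟩ := (ep_clopenIn G _).1 hC
    obtain ⟨A, hA, hvA, hAC, hA'⟩ := main C hC2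
      (by obtain ⟨w, hw, h⟩ := hvC; exact Subtype.ext h ▸ hw)
    obtain ⟨m, hm, hP⟩ := h _ ((ep_clopenIn G _).2 ⟨A, hA, rfl⟩) ⟨v, hvA, rfl⟩ (image_mono hAC)
    exact ⟨m, hP, hA' m hm⟩
  by_cases hvxy : v = x ∨ v = y
  · have ho : G.StronglyOddDegree v := by rcases hvxy with h | h <;> rw [h] <;> assumption
    obtain ⟨m, hm, hm'⟩ := conv _ ho
    rw [epInd_mem (by simpa using hvxy), epZ_self] at hm'
    exact (Nat.not_even_iff_odd.2 hm) (ZMod.natCast_eq_zero_iff_even.1 hm')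
  · have hvxy' := not_or.1 hvxy
    obtain ⟨m, hm, hm'⟩ := conv _ (hev v hvxy'.1 hvxy'.2)
    rw [epInd_not_mem (by simpa using hvxy), add_zero] at hm'
    exact (Nat.not_even_iff_odd.2 (ZMod.natCast_eq_one_iff_odd.1 hm')) hm

theorem ep_backward {X : Type*} [TopologicalSpace X] [CompactSpace X] [T2Space X]
    [SecondCountableTopology X] [ConnectedSpace X] (G : GraphLike X)
    {E : Type*} [Countable E] {γ : E → ℝ → X} (hp : EpPar G.V γ) (x y : G.V) (hxy : x ≠ y)
    (hx : G.StronglyOddDegree x) (hy : G.StronglyOddDegree y)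
    (hev : ∀ v : G.V, v ≠ x → v ≠ y → G.StronglyEvenDegree v) :
    ∃ f, G.IsOpenEulerianPath f := by
  have := G.zeroDimV
  obtain ⟨f, q1, q2, q3, q4, q5, -, q7, -⟩ := ep_pathF G.closedV hp univ x y hxy
    (ep_backward_par G hp x y hxy hx hy hev) (by
      intro A hA hxA hcut i _
      have h := ep_conn_side G.closedV hp A hA univ isPreconnected_univ
        (fun e _ => hcut e (mem_univ _)) ⟨x, mem_univ _, Or.inl ⟨x, hxA, rfl⟩⟩
        (mem_univ ((epA hp i : G.V) : X))
      rcases h with ⟨w, hw, h⟩ | ⟨e, _, _, t, ht, h⟩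
      · exact Subtype.ext h ▸ hw
      · exact absurd (epA hp i).2 (h ▸ hp.ioo e t ht))
  refine ⟨fun t => f t, ⟨q1.comp continuous_subtype_val, ?_, ?_, ?_, ?_⟩, ?_, ?_⟩
  · show f ((0 : unitInterval) : ℝ) ∈ G.V
    rw [Set.Icc.coe_zero, q2]; exact x.2
  · show f ((1 : unitInterval) : ℝ) ∈ G.V
    rw [Set.Icc.coe_one, q3]; exact y.2
  · intro s hs
    obtain ⟨e, rfl⟩ := (ep_isEdge G hp s).1 hs
    intro t ht t' ht' h
    exact Subtype.ext (q4 e ht ht' h)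
  · rw [eq_empty_iff_forall_notMem]
    intro t ht
    rw [mem_interior_iff_mem_nhds, Metric.mem_nhds_iff] at ht
    obtain ⟨ε, hε, hb⟩ := ht
    obtain ⟨s, hs, hsV⟩ := q7 (max 0 (t - ε)) (min 1 (t + ε)) (le_max_left _ _)
      (by
        have := t.2.1; have := t.2.2
        apply max_lt <;> apply lt_min <;> linarith) (min_le_left _ _)
    rw [mem_Ioo, max_lt_iff, lt_min_iff] at hs
    have hs' : (⟨s, hs.1.1.le, hs.2.1.le⟩ : unitInterval) ∈ Metric.ball t ε := by
      rw [Metric.mem_ball, Subtype.dist_eq, Real.dist_eq, abs_lt]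
      constructor <;> simp only <;> linarith [hs.1.2, hs.2.2]
    exact hsV (hb hs')
  · show f ((0 : unitInterval) : ℝ) ≠ f ((1 : unitInterval) : ℝ)
    rw [Set.Icc.coe_zero, Set.Icc.coe_one, q2, q3]
    exact fun h => hxy (Subtype.ext h)
  · intro s hs
    obtain ⟨e, rfl⟩ := (ep_isEdge G hp s).1 hs
    intro z hz
    obtain ⟨t, ht, h⟩ := q5 e (mem_univ _) hz
    exact ⟨⟨t, ht⟩, h⟩

theorem ep_final {X : Type*} [TopologicalSpace X] [CompactSpace X] [TopologicalSpace.MetrizableSpace X]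
    [ConnectedSpace X] (G : GraphLike X) :
    (∃ f, G.IsOpenEulerianPath f) ↔
      ∃ x y, x ∈ G.V ∧ y ∈ G.V ∧ x ≠ y ∧
        {v ∈ G.V | G.StronglyOddDegree v} = {x, y} ∧
        ∀ v ∈ G.V, v ≠ x → v ≠ y → G.StronglyEvenDegree v := by
  have := G.zeroDimV
  have hsc : SecondCountableTopology X := by
    letI := TopologicalSpace.metrizableSpaceMetric X
    infer_instance
  obtain ⟨γ, hp⟩ : ∃ γ : G.E → ℝ → X, EpPar G.V γ := by
    letI : TopologicalSpace G.E := ⊥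
    haveI : DiscreteTopology G.E := ⟨rfl⟩
    obtain ⟨h⟩ := G.homeo
    exact ep_exists_par G.V G.closedV G.E h
  have := ep_countable hp
  constructor
  · rintro ⟨f, hf⟩; exact ep_forward G hp f hf
  · rintro ⟨x, y, hx, hy, hxy, hodd, hev⟩
    have h1 : x ∈ {v ∈ G.V | G.StronglyOddDegree v} := by rw [hodd]; simp
    have h2 : y ∈ {v ∈ G.V | G.StronglyOddDegree v} := by rw [hodd]; simp
    exact ep_backward G hp ⟨x, hx⟩ ⟨y, hy⟩ (fun h => hxy (congrArg Subtype.val h)) h1.2 h2.2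
      (fun v hv hv' => hev v v.2 (fun h => hv (Subtype.ext h)) (fun h => hv' (Subtype.ext h)))

/-- A graph-like continuum has an open Eulerian path iff it has
exactly two vertices of strongly odd degree and all of its remaining vertices have
strongly even degree. -/
theorem openEulerianPath_iff_two_stronglyOdd
    [CompactSpace X] [TopologicalSpace.MetrizableSpace X] [ConnectedSpace X]
    (G : GraphLike X) :
    (∃ f, G.IsOpenEulerianPath f) ↔
      ∃ x y, x ∈ G.V ∧ y ∈ G.V ∧ x ≠ y ∧
        {v ∈ G.V | G.StronglyOddDegree v} = {x, y} ∧
        ∀ v ∈ G.V, v ≠ x → v ≠ y → G.StronglyEvenDegree v := by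
  exact ep_final G
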